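/- arXiv:math/0406368 — 3 statements merged into one kernel-verified Lean document; each statement's English description precedes it below -/
import Mathlib

section
/- Let ν be a strictly positive C^∞-smooth function on the closed unit disk such that z ↦ ν(z)/(1−|z|²) is subharmonic in the open unit disk D. Define W(z) = log|z|² − ∫_D G(z,ζ)ν(ζ) dΣ(ζ) for z ∈ D, and let Ŵ be the smallest superharmonic majorant of W in D. If the coincidence set {z ∈ D : W(z) = Ŵ(z)} is a compact subset of D, then W(z) ≤ log|z|² + 3/2 − 2|z|² + (1/2)|z|⁴ < 0 for all z ∈ D with z ≠ 0; in particular the coincidence set is empty. -/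
open Complex MeasureTheory Metric Set ComplexConjugate
noncomputable section

/-- The normalized area measure `dΣ = dx dy / π` on `ℂ`. -/
def areaM : Measure ℂ := (ENNReal.ofReal Real.pi)⁻¹ • (volume : Measure ℂ)

/-- The Green function `G(z,ζ) = log |(z-ζ)/(1-ζ̄z)|²` for the Laplacian on the unit disk. -/
def greenG (z ζ : ℂ) : ℝ := Real.log (normSq ((z - ζ) / (1 - conj ζ * z)))

/-- The normalized Laplacian `Δ = ∂²/∂z∂z̄ = (1/4)(∂²/∂x² + ∂²/∂y²)`. -/
def lap (u : ℂ → ℝ) (z : ℂ) : ℝ :=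
  (1/4) * (fderiv ℝ (fun w => fderiv ℝ u w 1) z 1
    + fderiv ℝ (fun w => fderiv ℝ u w Complex.I) z Complex.I)

/-- Superharmonicity on a set: lower semicontinuity together with the
super-mean-value inequality on disks. -/
def SuperharmonicOn (s : ℂ → ℝ) (U : Set ℂ) : Prop :=
  LowerSemicontinuousOn s U ∧
    ∀ z ∈ U, ∀ r : ℝ, 0 < r → closedBall z r ⊆ U → (⨍ w in ball z r, s w) ≤ s z

/-- `log|z|²` with the correct value `-∞` at the origin. -/
def logAbsSq (z : ℂ) : EReal := if z = 0 then ⊥ else (Real.log (normSq z) : EReal)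

/-- `f` is real differentiable at `ζ` with Wirtinger derivatives `∂f = a` and `∂̄f = b`. -/
def HasWirtingerAt (f : ℂ → ℂ) (a b ζ : ℂ) : Prop :=
  HasFDerivAt f (a • ContinuousLinearMap.id ℝ ℂ + b • (conjCLE : ℂ →L[ℝ] ℂ)) ζ

namespace HasWirtingerAt

variable {f g : ℂ → ℂ} {a b a' b' ζ : ℂ}

theorem congr_deriv (hf : HasWirtingerAt f a b ζ) (ha : a = a') (hb : b = b') :
    HasWirtingerAt f a' b' ζ := by
  subst ha hb; exact hf

theorem const (c ζ : ℂ) : HasWirtingerAt (fun _ => c) 0 0 ζ := by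
  refine (hasFDerivAt_const (𝕜 := ℝ) c ζ).congr_fderiv ?_
  ext v; simp

theorem id (ζ : ℂ) : HasWirtingerAt (fun w => w) 1 0 ζ := by
  refine (hasFDerivAt_id (𝕜 := ℝ) ζ).congr_fderiv ?_
  ext v; simp

theorem conj_id (ζ : ℂ) : HasWirtingerAt (fun w => conj w) 0 1 ζ := by
  refine ((conjCLE : ℂ →L[ℝ] ℂ).hasFDerivAt (x := ζ)).congr_fderiv ?_
  ext v; simp

theorem conj_comp (hf : HasWirtingerAt f a b ζ) :
    HasWirtingerAt (fun w => conj (f w)) (conj b) (conj a) ζ := by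
  refine ((conjCLE : ℂ →L[ℝ] ℂ).hasFDerivAt.comp ζ hf).congr_fderiv ?_
  ext v; simp; ring

theorem hasDerivAt_comp {h : ℂ → ℂ} {h' : ℂ} (hf : HasWirtingerAt f a b ζ)
    (hh : HasDerivAt h h' (f ζ)) :
    HasWirtingerAt (fun w => h (f w)) (h' * a) (h' * b) ζ := by
  refine ((hh.hasFDerivAt.restrictScalars ℝ).comp ζ hf).congr_fderiv ?_
  ext v; simp; ring

theorem add (hf : HasWirtingerAt f a b ζ) (hg : HasWirtingerAt g a' b' ζ) :
    HasWirtingerAt (fun w => f w + g w) (a + a') (b + b') ζ := by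
  refine (HasFDerivAt.add hf hg).congr_fderiv ?_
  ext v; simp; ring

theorem sub (hf : HasWirtingerAt f a b ζ) (hg : HasWirtingerAt g a' b' ζ) :
    HasWirtingerAt (fun w => f w - g w) (a - a') (b - b') ζ := by
  refine (HasFDerivAt.sub hf hg).congr_fderiv ?_
  ext v; simp; ring

theorem mul (hf : HasWirtingerAt f a b ζ) (hg : HasWirtingerAt g a' b' ζ) :
    HasWirtingerAt (fun w => f w * g w) (a * g ζ + f ζ * a') (b * g ζ + f ζ * b') ζ := by
  refine (HasFDerivAt.mul hf hg).congr_fderiv ?_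
  ext v; simp; ring

theorem inv (hf : HasWirtingerAt f a b ζ) (h0 : f ζ ≠ 0) :
    HasWirtingerAt (fun w => (f w)⁻¹) (-a / f ζ ^ 2) (-b / f ζ ^ 2) ζ :=
  (hf.hasDerivAt_comp (hasDerivAt_inv h0)).congr_deriv (by ring) (by ring)

theorem continuousAt (hf : HasWirtingerAt f a b ζ) : ContinuousAt f ζ :=
  HasFDerivAt.continuousAt hf

theorem congr_of_eventuallyEq (hf : HasWirtingerAt f a b ζ) (h : g =ᶠ[nhds ζ] f) :
    HasWirtingerAt g a b ζ :=
  HasFDerivAt.congr_of_eventuallyEq hf h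

theorem log_normSq (hf : HasWirtingerAt f a 0 ζ) (h0 : f ζ ≠ 0) :
    HasWirtingerAt (fun w => ((Real.log (normSq (f w)) : ℝ) : ℂ)) (a / f ζ)
      (starRingEnd ℂ (a / f ζ)) ζ := by
  have h1 : HasWirtingerAt (fun w => Complex.log (f w * (f ζ)⁻¹)) (a / f ζ) 0 ζ := by
    refine ((hf.mul (const (f ζ)⁻¹ ζ)).hasDerivAt_comp
      (Complex.hasDerivAt_log (by simp [h0]))).congr_deriv ?_ ?_ <;> field_simp <;> simp
  have h2 := (h1.add h1.conj_comp).add (const ((Real.log (normSq (f ζ)) : ℝ) : ℂ) ζ)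
  refine (h2.congr_of_eventuallyEq ?_).congr_deriv (by simp) (by simp)
  filter_upwards [hf.continuousAt.eventually_ne h0] with w hw
  rw [Complex.add_conj, ← ofReal_add, Complex.log_re, norm_mul, norm_inv, normSq_eq_norm_sq,
    normSq_eq_norm_sq, Real.log_pow, Real.log_pow, Real.log_mul (by simpa) (by simpa), Real.log_inv]
  congr 1
  push_cast
  ring

theorem ofReal {u : ℂ → ℝ} (hu : DifferentiableAt ℝ u ζ) :
    HasWirtingerAt (fun w => (u w : ℂ)) ((fderiv ℝ u ζ 1 - I * fderiv ℝ u ζ I) / 2)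
      ((fderiv ℝ u ζ 1 + I * fderiv ℝ u ζ I) / 2) ζ := by
  refine (ofRealCLM.hasFDerivAt.comp ζ hu.hasFDerivAt).congr_fderiv ?_
  refine ContinuousLinearMap.ext fun v => ?_
  have hv : fderiv ℝ u ζ v = v.re * fderiv ℝ u ζ 1 + v.im * fderiv ℝ u ζ I := by
    conv_lhs => rw [show v = v.re • (1 : ℂ) + v.im • I by simp [re_add_im]]
    simp only [map_add, map_smul, smul_eq_mul]
  apply Complex.ext <;> simp [hv] <;> ring

theorem hasDerivAt_re (hf : HasWirtingerAt f a b ζ) :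
    HasDerivAt (fun x : ℝ => f (x + ζ.im * I)) (a + b) ζ.re := by
  have hl : HasDerivAt (fun x : ℝ => (x : ℂ) + ζ.im * I) 1 ζ.re :=
    (hasDerivAt_id ζ.re).ofReal_comp.add_const _
  have hf' : HasFDerivAt f (a • ContinuousLinearMap.id ℝ ℂ + b • (conjCLE : ℂ →L[ℝ] ℂ))
    ((ζ.re : ℂ) + ζ.im * I) := by rw [re_add_im]; exact hf
  exact (hf'.comp_hasDerivAt ζ.re hl).congr_deriv (by simp)

theorem hasDerivAt_im (hf : HasWirtingerAt f a b ζ) :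
    HasDerivAt (fun y : ℝ => f (ζ.re + y * I)) ((a - b) * I) ζ.im := by
  have hl : HasDerivAt (fun y : ℝ => (ζ.re : ℂ) + y * I) I ζ.im := by
    simpa using ((hasDerivAt_id ζ.im).ofReal_comp.mul_const I).const_add (ζ.re : ℂ)
  have hf' : HasFDerivAt f (a • ContinuousLinearMap.id ℝ ℂ + b • (conjCLE : ℂ →L[ℝ] ℂ))
    ((ζ.re : ℂ) + ζ.im * I) := by rw [re_add_im]; exact hf
  exact (hf'.comp_hasDerivAt ζ.im hl).congr_deriv (by simp; ring)

end HasWirtingerAt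

theorem integral_eq_zero_of_hasDerivAt_off_countable {f g : ℝ → ℂ} {s : Set ℝ} (hs : s.Countable)
    (hf : Continuous f) (hd : ∀ x ∉ s, HasDerivAt f (g x) x) (hg : Integrable g)
    {R : ℝ} (hR : ∀ x, R ≤ |x| → f x = 0) : ∫ x, g x = 0 := by
  have h1 : Filter.Tendsto (fun n : ℝ => ∫ x in (-n)..n, g x) Filter.atTop (nhds (∫ x, g x)) :=
    intervalIntegral_tendsto_integral hg Filter.tendsto_neg_atTop_atBot Filter.tendsto_id
  refine tendsto_nhds_unique h1 (tendsto_const_nhds.congr' ?_)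
  filter_upwards [Filter.eventually_ge_atTop (max R 0)] with n hn
  have hn0 : 0 ≤ n := le_trans (le_max_right _ _) hn
  have hnR : R ≤ n := le_trans (le_max_left _ _) hn
  rw [MeasureTheory.integral_eq_of_hasDerivAt_off_countable f g hs hf.continuousOn
    (fun x hx => hd x hx.2) hg.intervalIntegrable, hR n (by rwa [abs_of_nonneg hn0]),
    hR (-n) (by rwa [abs_neg, abs_of_nonneg hn0]), sub_zero]

theorem integral_wirtinger_eq_zero {F a b : ℂ → ℂ} (hF : Continuous F) {R : ℝ}
    (hR : ∀ ζ, R ≤ ‖ζ‖ → F ζ = 0) {E : Set ℂ}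
    (hEx : ∀ y : ℝ, {x : ℝ | (x + y * I : ℂ) ∈ E}.Countable)
    (hEy : ∀ x : ℝ, {y : ℝ | (x + y * I : ℂ) ∈ E}.Countable)
    (hd : ∀ ζ ∉ E, HasWirtingerAt F (a ζ) (b ζ) ζ) (ha : Integrable a) (hb : Integrable b) :
    ∫ ζ, a ζ = 0 ∧ ∫ ζ, b ζ = 0 := by
  have key : ∀ h : ℂ → ℂ, ∫ ζ, h ζ = ∫ p : ℝ × ℝ, h (p.1 + p.2 * I) := fun h => by
    rw [← Complex.volume_preserving_equiv_real_prod.symm.integral_comp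
      measurableEquivRealProd.symm.measurableEmbedding]
    simp [Complex.measurableEquivRealProd_symm_apply, Complex.mk_eq_add_mul_I]
  have keyi : ∀ h : ℂ → ℂ, Integrable h → Integrable (fun p : ℝ × ℝ => h (p.1 + p.2 * I)) := by
    intro h hh
    have := (Complex.volume_preserving_equiv_real_prod.symm.integrable_comp_emb
      measurableEquivRealProd.symm.measurableEmbedding).2 hh
    refine this.congr (Filter.Eventually.of_forall fun p => ?_)
    simp [Complex.measurableEquivRealProd_symm_apply, Complex.mk_eq_add_mul_I]
  have hx : ∫ ζ, (a ζ + b ζ) = 0 := by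
    have hi := keyi (fun ζ => a ζ + b ζ) (ha.add hb)
    rw [key, Measure.volume_eq_prod, integral_prod_symm _ hi]
    refine integral_eq_zero_of_ae ?_
    filter_upwards [hi.prod_left_ae] with y hy
    refine integral_eq_zero_of_hasDerivAt_off_countable (f := fun x : ℝ => F (x + y * I)) (hEx y)
      (by fun_prop) (fun x hx => ?_) hy (R := R) (fun x hx => hR _ ?_)
    · simpa using (hd _ hx).hasDerivAt_re
    · exact hx.trans (by simpa using abs_re_le_norm (x + y * I : ℂ))
  have hy : ∫ ζ, (a ζ - b ζ) * I = 0 := by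
    have hi := keyi (fun ζ => (a ζ - b ζ) * I) ((ha.sub hb).mul_const I)
    rw [key, Measure.volume_eq_prod, integral_prod _ hi]
    refine integral_eq_zero_of_ae ?_
    filter_upwards [hi.prod_right_ae] with x hx
    refine integral_eq_zero_of_hasDerivAt_off_countable (f := fun y : ℝ => F (x + y * I)) (hEy x)
      (by fun_prop) (fun y hy => ?_) hx (R := R) (fun y hy => hR _ ?_)
    · simpa using (hd _ hy).hasDerivAt_im
    · exact hy.trans (by simpa using abs_im_le_norm (x + y * I : ℂ))
  rw [integral_add ha hb] at hx
  rw [integral_mul_const, integral_sub ha hb] at hy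
  have hy' := (mul_eq_zero.1 hy).resolve_right I_ne_zero
  constructor
  · linear_combination (hx + hy') / 2
  · linear_combination (hx - hy') / 2

theorem countable_setOf_sq_add_eq_one_or (c d : ℝ) : {x : ℝ | x ^ 2 + c = 1 ∨ x = d}.Countable := by
  refine Set.Finite.countable (((Set.finite_singleton d).insert (-√(1 - c))).insert
    (√(1 - c)) |>.subset ?_)
  rintro x (hx | rfl)
  · have h : x ^ 2 = √(1 - c) ^ 2 := by rw [Real.sq_sqrt (by nlinarith [sq_nonneg x])]; linarith
    rcases sq_eq_sq_iff_eq_or_eq_neg.1 h with h | h <;> simp [h]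
  · simp

/-- Divergence theorem on the unit disk for fields vanishing on the unit circle, with one
exceptional interior point. -/
theorem setIntegral_ball_wirtinger_eq_zero {F a b : ℂ → ℂ} {z : ℂ}
    (hF : ContinuousOn F (closedBall 0 1)) (h0 : ∀ ζ ∈ sphere (0 : ℂ) 1, F ζ = 0)
    (hd : ∀ ζ ∈ ball (0 : ℂ) 1, ζ ≠ z → HasWirtingerAt F (a ζ) (b ζ) ζ)
    (ha : IntegrableOn a (ball 0 1)) (hb : IntegrableOn b (ball 0 1)) :
    ∫ ζ in ball (0 : ℂ) 1, a ζ = 0 ∧ ∫ ζ in ball (0 : ℂ) 1, b ζ = 0 := by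
  rw [← integral_indicator measurableSet_ball, ← integral_indicator measurableSet_ball]
  have hE : ∀ x y : ℝ, (x + y * I : ℂ) ∈ sphere (0 : ℂ) 1 ∪ {z} →
      x ^ 2 + y ^ 2 = 1 ∨ x = z.re ∧ y = z.im := by
    rintro x y (h | h)
    · left
      rw [mem_sphere_zero_iff_norm] at h
      have := Complex.normSq_add_mul_I x y
      rw [normSq_eq_norm_sq, h] at this
      exact (by linarith)
    · right
      rw [Set.mem_singleton_iff] at h
      rw [← h]
      simp
  refine integral_wirtinger_eq_zero (F := (closedBall (0 : ℂ) 1).indicator F) (R := 2)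
    (E := sphere (0 : ℂ) 1 ∪ {z}) ?_ ?_ ?_ ?_ ?_ (ha.integrable_indicator measurableSet_ball)
    (hb.integrable_indicator measurableSet_ball)
  · refine continuous_indicator (fun ζ hζ => h0 ζ ?_) (by rwa [isClosed_closedBall.closure_eq])
    rwa [frontier_closedBall _ one_ne_zero] at hζ
  · intro ζ hζ
    exact indicator_of_notMem (by rw [mem_closedBall_zero_iff]; linarith) _
  · intro y
    refine (countable_setOf_sq_add_eq_one_or (y ^ 2) z.re).mono fun x hx => ?_
    rcases hE x y hx with h | h
    exacts [Or.inl h, Or.inr h.1]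
  · intro x
    refine (countable_setOf_sq_add_eq_one_or (x ^ 2) z.im).mono fun y hy => ?_
    rcases hE x y hy with h | h
    exacts [Or.inl (by linarith [h]), Or.inr h.2]
  · intro ζ hζ
    rw [mem_union, not_or, mem_sphere_zero_iff_norm, mem_singleton_iff] at hζ
    rcases lt_or_gt_of_ne hζ.1 with h | h
    · have hb : ζ ∈ ball (0 : ℂ) 1 := by simpa using h
      rw [indicator_of_mem hb, indicator_of_mem hb]
      refine (hd ζ hb hζ.2).congr_of_eventuallyEq ?_
      filter_upwards [isOpen_ball.mem_nhds hb] with w hw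
      exact indicator_of_mem (ball_subset_closedBall hw) _
    · have hb : ζ ∉ ball (0 : ℂ) 1 := by simpa using h.le
      rw [indicator_of_notMem hb, indicator_of_notMem hb]
      refine (HasWirtingerAt.const 0 ζ).congr_of_eventuallyEq ?_
      have : ζ ∈ (closedBall (0 : ℂ) 1)ᶜ := by simpa using h
      filter_upwards [isClosed_closedBall.isOpen_compl.mem_nhds this] with w hw
      exact indicator_of_notMem hw _

/-- The harmonic function `H_z` with `ΔΓ(z,·) = (1-|ζ|²)(G(z,·) + H_z)`, polarized. -/
def harmPolar (z c ζ d : ℂ) : ℂ :=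
  (1 - z * c) * ((1 - z * d)⁻¹ + (1 - c * ζ)⁻¹ - 1 +
    (1 - z * c) * ((((1 - z * d)⁻¹) ^ 2 + ((1 - c * ζ)⁻¹) ^ 2) / 2 - 1 / 2))

/-- The weighted biharmonic Green function for the weight `1-|ζ|²`, polarized;
`g` stands for the value of the Green function. -/
def biharmPolar (z c ζ d g : ℂ) : ℂ :=
  ((z - ζ) * (c - d) - (z ^ 2 - ζ ^ 2) * (c ^ 2 - d ^ 2) / 4) * g +
    (1 - z * c) * (1 - ζ * d) * (9 - 3 * (z * c) - 3 * (ζ * d) + z * c * (ζ * d)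
      - 2 * (z * d + c * ζ)
      - 2 * (1 - z * c) * (1 - ζ * d) * ((1 - z * d)⁻¹ + (1 - c * ζ)⁻¹)) / 8

/-- The `∂/∂ζ`-derivative of `biharmPolar`. -/
def biharmPolarDeriv (z c ζ d g : ℂ) : ℂ :=
  -(c - d) * ((1 - ζ * (c + d) / 2) * g +
      (1 - (z + ζ) * (c + d) / 4) * (1 - z * c) * (1 - c * ζ)⁻¹) +
    (1 - z * c) * (-d * (9 - 3 * (z * c) - 3 * (ζ * d) + z * c * (ζ * d) - 2 * (z * d + c * ζ)
      - 2 * (1 - z * c) * (1 - ζ * d) * ((1 - z * d)⁻¹ + (1 - c * ζ)⁻¹)) +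
      (1 - ζ * d) * (-3 * d + z * c * d - 2 * c
        + 2 * (1 - z * c) * d * ((1 - z * d)⁻¹ + (1 - c * ζ)⁻¹)
        - 2 * (1 - z * c) * (1 - ζ * d) * (c * ((1 - c * ζ)⁻¹) ^ 2))) / 8

/-- The Green function split into its singular and regular parts. -/
def greenSplit (z ζ : ℂ) : ℝ := Real.log (normSq (z - ζ)) - Real.log (normSq (1 - conj z * ζ))

theorem one_sub_mul_ne_zero {z ζ : ℂ} (hz : ‖z‖ < 1) (hζ : ‖ζ‖ ≤ 1) : 1 - z * ζ ≠ 0 := by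
  intro h
  have h1 : ‖z * ζ‖ = 1 := by rw [← sub_eq_zero.1 h, norm_one]
  rw [norm_mul] at h1
  nlinarith [norm_nonneg z, norm_nonneg ζ]

section derivatives

variable {z ζ : ℂ}

theorem hasWirtingerAt_greenSplit (hne : ζ ≠ z) (h1 : 1 - conj z * ζ ≠ 0)
    (h2 : 1 - z * conj ζ ≠ 0) :
    HasWirtingerAt (fun w => (greenSplit z w : ℂ))
      (-(1 - z * conj z) / ((z - ζ) * (1 - conj z * ζ)))
      (-(1 - z * conj z) / ((conj z - conj ζ) * (1 - z * conj ζ))) ζ := by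
  have h0 : z - ζ ≠ 0 := sub_ne_zero.2 hne.symm
  have h0' : conj z - conj ζ ≠ 0 := by rw [← map_sub]; exact (map_ne_zero _).2 h0
  have ha := (((HasWirtingerAt.const z ζ).sub (HasWirtingerAt.id ζ)).congr_deriv rfl
    (sub_zero 0)).log_normSq h0
  have hb := (((HasWirtingerAt.const 1 ζ).sub ((HasWirtingerAt.const (conj z) ζ).mul
    (HasWirtingerAt.id ζ))).congr_deriv rfl (by simp)).log_normSq h1
  refine ((ha.sub hb).congr_of_eventuallyEq (Filter.Eventually.of_forall fun w => ?_)).congr_deriv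
    ?_ ?_
  · simp [greenSplit]
  · rw [div_sub_div _ _ h0 h1, div_left_inj' (mul_ne_zero h0 h1)]
    ring
  · simp only [map_div₀, map_sub, map_mul, map_one, map_zero, map_add, Complex.conj_conj]
    rw [div_sub_div _ _ h0' h2, div_left_inj' (mul_ne_zero h0' h2)]
    ring

theorem hasWirtingerAt_inv_one_sub_left (c : ℂ) (h1 : 1 - c * ζ ≠ 0) :
    HasWirtingerAt (fun w => (1 - c * w)⁻¹) (c * ((1 - c * ζ)⁻¹) ^ 2) 0 ζ := by
  refine (((HasWirtingerAt.const 1 ζ).sub ((HasWirtingerAt.const c ζ).mul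
    (HasWirtingerAt.id ζ))).inv h1).congr_deriv ?_ ?_ <;> field_simp <;> ring

theorem hasWirtingerAt_inv_one_sub_right (c : ℂ) (h1 : 1 - c * conj ζ ≠ 0) :
    HasWirtingerAt (fun w => (1 - c * conj w)⁻¹) 0 (c * ((1 - c * conj ζ)⁻¹) ^ 2) ζ := by
  refine (((HasWirtingerAt.const 1 ζ).sub ((HasWirtingerAt.const c ζ).mul
    (HasWirtingerAt.conj_id ζ))).inv h1).congr_deriv ?_ ?_ <;> field_simp <;> ring

theorem HasWirtingerAt.pow_two {f : ℂ → ℂ} {a b : ℂ} (hf : HasWirtingerAt f a b ζ) :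
    HasWirtingerAt (fun w => f w ^ 2) (2 * f ζ * a) (2 * f ζ * b) ζ := by
  refine ((hf.mul hf).congr_of_eventuallyEq (Filter.Eventually.of_forall fun w => ?_)).congr_deriv
    ?_ ?_
  · simp [sq]
  · ring
  · ring

theorem HasWirtingerAt.const_mul {f : ℂ → ℂ} {a b : ℂ} (c : ℂ) (hf : HasWirtingerAt f a b ζ) :
    HasWirtingerAt (fun w => c * f w) (c * a) (c * b) ζ :=
  ((HasWirtingerAt.const c ζ).mul hf).congr_deriv (by ring) (by ring)

theorem HasWirtingerAt.const_sub {f : ℂ → ℂ} {a b : ℂ} (c : ℂ) (hf : HasWirtingerAt f a b ζ) :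
    HasWirtingerAt (fun w => c - f w) (-a) (-b) ζ :=
  ((HasWirtingerAt.const c ζ).sub hf).congr_deriv (by ring) (by ring)

theorem HasWirtingerAt.const_add {f : ℂ → ℂ} {a b : ℂ} (c : ℂ) (hf : HasWirtingerAt f a b ζ) :
    HasWirtingerAt (fun w => c + f w) a b ζ :=
  ((HasWirtingerAt.const c ζ).add hf).congr_deriv (by ring) (by ring)

theorem HasWirtingerAt.div_const {f : ℂ → ℂ} {a b : ℂ} (hf : HasWirtingerAt f a b ζ) (c : ℂ) :
    HasWirtingerAt (fun w => f w / c) (a / c) (b / c) ζ := by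
  simp only [div_eq_mul_inv]
  exact (hf.mul (HasWirtingerAt.const c⁻¹ ζ)).congr_deriv (by ring) (by ring)

theorem hasWirtingerAt_biharmPolar (hne : ζ ≠ z) (h1 : 1 - conj z * ζ ≠ 0)
    (h2 : 1 - z * conj ζ ≠ 0) :
    HasWirtingerAt (fun w => biharmPolar z (conj z) w (conj w) (greenSplit z w))
      (biharmPolarDeriv z (conj z) ζ (conj ζ) (greenSplit z ζ))
      (biharmPolarDeriv (conj z) z (conj ζ) ζ (greenSplit z ζ)) ζ := by
  have h0 : z - ζ ≠ 0 := sub_ne_zero.2 hne.symm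
  have h0' : conj z - conj ζ ≠ 0 := by rw [← map_sub]; exact (map_ne_zero _).2 h0
  have hg := hasWirtingerAt_greenSplit hne h1 h2
  have hw := hasWirtingerAt_inv_one_sub_right z h2
  have hv := hasWirtingerAt_inv_one_sub_left (conj z) h1
  have hi := HasWirtingerAt.id ζ
  have hd := HasWirtingerAt.conj_id ζ
  have hid := hi.mul hd
  have hB := hid.const_sub 1
  have hk := ((hi.const_sub z).mul (hd.const_sub (conj z))).sub
    (((hi.pow_two.const_sub (z ^ 2)).mul (hd.pow_two.const_sub (conj z ^ 2))).div_const 4)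
  have hR := ((((hid.const_mul 3).const_sub (9 - 3 * (z * conj z))).add
    (hid.const_mul (z * conj z))).sub
    (((hd.const_mul z).add (hi.const_mul (conj z))).const_mul 2)).sub
    ((hB.const_mul (2 * (1 - z * conj z))).mul (hw.add hv))
  have h := (hk.mul hg).add (((hB.const_mul (1 - z * conj z)).mul hR).div_const 8)
  refine h.congr_deriv ?_ ?_
  · unfold biharmPolarDeriv
    generalize conj z = c at *
    generalize conj ζ = d at *
    field_simp
    ring
  · unfold biharmPolarDeriv
    generalize conj z = c at *
    generalize conj ζ = d at *
    field_simp
    ring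

end derivatives

section laplacian

variable {z ζ : ℂ}

/-- The part of the `∂²/∂ζ²`-derivative of `biharmPolar` that is smooth up to the boundary. -/
def biharmPolarRegDeriv₂ (z c ζ d : ℂ) : ℂ :=
  -(c - d) * (-(c + d) / 4 * (1 - z * c) * (1 - c * ζ)⁻¹ +
      (1 - (z + ζ) * (c + d) / 4) * (1 - z * c) * (c * ((1 - c * ζ)⁻¹) ^ 2)) +
    (1 - z * c) * (-2 * d * (-3 * d + z * c * d - 2 * c
      + 2 * (1 - z * c) * d * ((1 - z * d)⁻¹ + (1 - c * ζ)⁻¹)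
      - 2 * (1 - z * c) * (1 - ζ * d) * (c * ((1 - c * ζ)⁻¹) ^ 2)) +
    (1 - ζ * d) * (4 * (1 - z * c) * d * (c * ((1 - c * ζ)⁻¹) ^ 2)
      - 4 * (1 - z * c) * (1 - ζ * d) * (c ^ 2 * ((1 - c * ζ)⁻¹) ^ 3))) / 8

/-- The `∂²/∂ζ²`-derivative of `biharmPolar`. -/
def biharmPolarDeriv₂ (z c ζ d g : ℂ) : ℂ :=
  (c - d) * ((c + d) / 2) * g +
    (1 - ζ * (c + d) / 2) * (1 - z * c) * (1 - c * ζ)⁻¹ * ((c - d) / (z - ζ)) +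
    biharmPolarRegDeriv₂ z c ζ d

theorem hasWirtingerAt_biharmPolarDeriv (hne : ζ ≠ z) (h1 : 1 - conj z * ζ ≠ 0)
    (h2 : 1 - z * conj ζ ≠ 0) :
    HasWirtingerAt (fun w => biharmPolarDeriv z (conj z) w (conj w) (greenSplit z w))
      (biharmPolarDeriv₂ z (conj z) ζ (conj ζ) (greenSplit z ζ))
      ((1 - ζ * conj ζ) * (greenSplit z ζ + harmPolar z (conj z) ζ (conj ζ))) ζ := by
  have h0 : z - ζ ≠ 0 := sub_ne_zero.2 hne.symm
  have h0' : conj z - conj ζ ≠ 0 := by rw [← map_sub]; exact (map_ne_zero _).2 h0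
  have h1' : 1 - ζ * conj z ≠ 0 := by rwa [mul_comm]
  have h2' : 1 - conj ζ * z ≠ 0 := by rwa [mul_comm]
  have hg := hasWirtingerAt_greenSplit hne h1 h2
  have hw := hasWirtingerAt_inv_one_sub_right z h2
  have hv := hasWirtingerAt_inv_one_sub_left (conj z) h1
  have hi := HasWirtingerAt.id ζ
  have hd := HasWirtingerAt.conj_id ζ
  have hid := hi.mul hd
  have hB := hid.const_sub 1
  have hcd := hd.const_add (conj z)
  have hvw := hw.add hv
  have hsing := (((hi.mul hcd).div_const 2).const_sub 1).mul hg
  have hreg := (((((hi.const_add z).mul hcd).div_const 4).const_sub 1).mul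
    (HasWirtingerAt.const (1 - z * conj z) ζ)).mul hv
  have hfst := (((HasWirtingerAt.const 0 ζ).sub (hd.const_sub (conj z))).mul (hsing.add hreg))
  have hR := ((((hid.const_mul 3).const_sub (9 - 3 * (z * conj z))).add
    (hid.const_mul (z * conj z))).sub
    (((hd.const_mul z).add (hi.const_mul (conj z))).const_mul 2)).sub
    ((hB.const_mul (2 * (1 - z * conj z))).mul hvw)
  have hS := ((((hd.const_mul (-3)).add (hd.const_mul (z * conj z))).sub
    (HasWirtingerAt.const (2 * conj z) ζ)).add ((hd.const_mul (2 * (1 - z * conj z))).mul hvw)).sub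
    ((hB.const_mul (2 * (1 - z * conj z))).mul (hv.pow_two.const_mul (conj z)))
  have hsnd := ((((HasWirtingerAt.const 0 ζ).sub hd).mul hR).add (hB.mul hS)).const_mul
    (1 - z * conj z)
  have h := hfst.add (hsnd.div_const 8)
  refine (h.congr_of_eventuallyEq (Filter.Eventually.of_forall fun w => ?_)).congr_deriv ?_ ?_
  · simp only [biharmPolarDeriv, zero_sub]
  · unfold biharmPolarDeriv₂ biharmPolarRegDeriv₂
    generalize conj z = c at *
    generalize conj ζ = d at *
    field_simp
    ring
  · unfold harmPolar
    generalize conj z = c at *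
    generalize conj ζ = d at *
    field_simp
    ring

end laplacian

section regularity

variable {z ζ : ℂ}

theorem one_sub_conj_mul_ne_zero (hz : ‖z‖ < 1) (hζ : ‖ζ‖ ≤ 1) : 1 - conj z * ζ ≠ 0 :=
  one_sub_mul_ne_zero (by rwa [RCLike.norm_conj]) hζ

theorem one_sub_mul_conj_ne_zero (hz : ‖z‖ < 1) (hζ : ‖ζ‖ ≤ 1) : 1 - z * conj ζ ≠ 0 :=
  one_sub_mul_ne_zero hz (by rwa [RCLike.norm_conj])

theorem greenSplit_eq_zero (h : ζ * conj ζ = 1) : greenSplit z ζ = 0 := by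
  have h1 : normSq ζ = 1 := by rw [mul_conj] at h; exact_mod_cast h
  have : 1 - conj z * ζ = conj (ζ - z) * ζ := by
    rw [map_sub, sub_mul, mul_comm (conj ζ), h]
  rw [greenSplit, this, normSq_mul, h1, normSq_conj, mul_one, ← neg_sub z ζ, normSq_neg, sub_self]

theorem biharmPolar_eq_zero (h : ζ * conj ζ = 1) :
    biharmPolar z (conj z) ζ (conj ζ) (greenSplit z ζ) = 0 := by
  simp [biharmPolar, greenSplit_eq_zero h, h]

theorem biharmPolarDeriv_eq_zero (hz : ‖z‖ < 1) (h : ζ * conj ζ = 1) :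
    biharmPolarDeriv z (conj z) ζ (conj ζ) (greenSplit z ζ) = 0 := by
  have hζ : ‖ζ‖ ≤ 1 := by
    rw [mul_conj, normSq_eq_norm_sq] at h
    have h' : ‖ζ‖ ^ 2 = 1 := by exact_mod_cast h
    nlinarith [norm_nonneg ζ]
  have h1 := one_sub_conj_mul_ne_zero hz hζ
  have h0 : ζ ≠ 0 := by rintro rfl; simp at h
  rw [biharmPolarDeriv, greenSplit_eq_zero h]
  generalize conj z = c at *
  have hd : conj ζ = ζ⁻¹ := eq_inv_of_mul_eq_one_right h
  rw [hd]
  have h1' : 1 - ζ * c ≠ 0 := by rwa [mul_comm]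
  push_cast
  field_simp
  ring

theorem continuous_conj_mul_log_normSq :
    Continuous fun u : ℂ => conj u * (Real.log (normSq u) : ℂ) := by
  rw [continuous_iff_continuousAt]
  intro u
  rcases eq_or_ne u 0 with rfl | hu
  · have h : Continuous fun u : ℂ => 2 * |‖u‖ * Real.log ‖u‖| :=
      continuous_const.mul (Real.continuous_mul_log.comp continuous_norm).abs
    have h0 := h.tendsto 0
    simp only [norm_zero, zero_mul, abs_zero, mul_zero] at h0
    rw [ContinuousAt, map_zero, zero_mul]
    refine squeeze_zero_norm (fun v => ?_) h0
    rw [norm_mul, RCLike.norm_conj, normSq_eq_norm_sq, Real.log_pow, norm_real, Real.norm_eq_abs,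
      abs_mul, abs_mul, abs_norm]
    simp only [Nat.cast_ofNat, abs_two]
    exact le_of_eq (by ring)
  · have : ContinuousAt (fun u : ℂ => Real.log (normSq u)) u :=
      (Real.continuousAt_log (by simpa using hu)).comp continuous_normSq.continuousAt
    exact (continuous_conj.continuousAt).mul (continuous_ofReal.continuousAt.comp this)

theorem continuousOn_log_normSq_one_sub (hz : ‖z‖ < 1) :
    ContinuousOn (fun ζ : ℂ => Real.log (normSq (1 - conj z * ζ))) (closedBall 0 1) := by
  refine ContinuousOn.log (Continuous.continuousOn (by fun_prop)) fun ζ hζ => ?_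
  exact (map_ne_zero normSq).2 (one_sub_conj_mul_ne_zero hz (by simpa using hζ))

theorem continuousOn_conj_sub_mul_greenSplit (hz : ‖z‖ < 1) :
    ContinuousOn (fun ζ : ℂ => (conj z - conj ζ) * (greenSplit z ζ : ℂ)) (closedBall 0 1) := by
  have h1 : Continuous fun ζ : ℂ => conj (z - ζ) * (Real.log (normSq (z - ζ)) : ℂ) :=
    continuous_conj_mul_log_normSq.comp (continuous_const.sub continuous_id)
  have h2 : ContinuousOn (fun ζ : ℂ => (Real.log (normSq (1 - conj z * ζ)) : ℂ)) (closedBall 0 1) :=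
    continuous_ofReal.comp_continuousOn (continuousOn_log_normSq_one_sub hz)
  have h3 : ContinuousOn (fun ζ : ℂ => (conj z - conj ζ)) (closedBall 0 1) :=
    Continuous.continuousOn (by fun_prop)
  refine (h1.continuousOn.sub (h3.mul h2)).congr fun ζ _ => ?_
  simp only [greenSplit, map_sub, ofReal_sub, Pi.sub_apply, Pi.mul_apply]
  ring

theorem continuousOn_inv_one_sub (hz : ‖z‖ < 1) :
    ContinuousOn (fun ζ : ℂ => (1 - conj z * ζ)⁻¹) (closedBall 0 1) :=
  ContinuousOn.inv₀ (Continuous.continuousOn (by fun_prop)) fun ζ hζ =>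
    one_sub_conj_mul_ne_zero hz (by simpa using hζ)

theorem continuousOn_inv_one_sub_conj (hz : ‖z‖ < 1) :
    ContinuousOn (fun ζ : ℂ => (1 - z * conj ζ)⁻¹) (closedBall 0 1) :=
  ContinuousOn.inv₀ (Continuous.continuousOn (by fun_prop)) fun ζ hζ =>
    one_sub_mul_conj_ne_zero hz (by simpa using hζ)

theorem continuousOn_biharmPolar (hz : ‖z‖ < 1) :
    ContinuousOn (fun ζ => biharmPolar z (conj z) ζ (conj ζ) (greenSplit z ζ))
      (closedBall 0 1) := by
  have hg := continuousOn_conj_sub_mul_greenSplit hz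
  have hv := continuousOn_inv_one_sub hz
  have hw := continuousOn_inv_one_sub_conj hz
  have h : ContinuousOn (fun ζ : ℂ =>
      (z - ζ) * (1 - (z + ζ) * (conj z + conj ζ) / 4) * ((conj z - conj ζ) * (greenSplit z ζ : ℂ)) +
      biharmPolar z (conj z) ζ (conj ζ) 0) (closedBall 0 1) := by
    unfold biharmPolar
    fun_prop
  refine h.congr fun ζ _ => ?_
  simp only [biharmPolar]
  ring

theorem continuousOn_biharmPolarDeriv (hz : ‖z‖ < 1) :
    ContinuousOn (fun ζ => biharmPolarDeriv z (conj z) ζ (conj ζ) (greenSplit z ζ))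
      (closedBall 0 1) := by
  have hg := continuousOn_conj_sub_mul_greenSplit hz
  have hv := continuousOn_inv_one_sub hz
  have hw := continuousOn_inv_one_sub_conj hz
  have h : ContinuousOn (fun ζ : ℂ =>
      -(1 - ζ * (conj z + conj ζ) / 2) * ((conj z - conj ζ) * (greenSplit z ζ : ℂ)) +
      biharmPolarDeriv z (conj z) ζ (conj ζ) 0) (closedBall 0 1) := by
    unfold biharmPolarDeriv
    fun_prop
  refine h.congr fun ζ _ => ?_
  simp only [biharmPolarDeriv]
  ring

theorem continuousOn_harmPolar (hz : ‖z‖ < 1) :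
    ContinuousOn (fun ζ => harmPolar z (conj z) ζ (conj ζ)) (closedBall 0 1) := by
  have hv := continuousOn_inv_one_sub hz
  have hw := continuousOn_inv_one_sub_conj hz
  unfold harmPolar
  fun_prop

end regularity

section positivity

variable {z ζ : ℂ}

theorem mul_log_add_nonneg {x : ℝ} (hx : 0 ≤ x) (hx1 : x ≤ 1) :
    0 ≤ x * Real.log x + (1 - x ^ 2) / 2 := by
  rcases hx.eq_or_lt with rfl | hx
  · norm_num
  have hd : ∀ y ∈ interior (Icc x 1), HasDerivAt (fun y => Real.log y + (y⁻¹ - y) / 2)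
      (y⁻¹ + (-(y ^ 2)⁻¹ - 1) / 2) y := fun y hy => by
    rw [interior_Icc] at hy
    have h0 : y ≠ 0 := (hx.trans hy.1).ne'
    exact (Real.hasDerivAt_log h0).add (((hasDerivAt_inv h0).sub (hasDerivAt_id y)).div_const 2)
  have hanti : AntitoneOn (fun y => Real.log y + (y⁻¹ - y) / 2) (Icc x 1) := by
    refine antitoneOn_of_deriv_nonpos (convex_Icc x 1) ?_
      (fun y hy => (hd y hy).differentiableAt.differentiableWithinAt) fun y hy => ?_
    · have : ∀ y ∈ Icc x 1, y ≠ 0 := fun y hy => (hx.trans_le hy.1).ne'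
      exact (continuousOn_id.log this).add
        (((continuousOn_id.inv₀ this).sub continuousOn_id).div_const 2)
    · rw [(hd y hy).deriv]
      have : y⁻¹ + (-(y ^ 2)⁻¹ - 1) / 2 = -(y⁻¹ - 1) ^ 2 / 2 := by ring
      rw [this]
      nlinarith [sq_nonneg (y⁻¹ - 1)]
  have h := hanti (left_mem_Icc.2 hx1) (right_mem_Icc.2 hx1) hx1
  simp only [Real.log_one, inv_one, sub_self, zero_div, add_zero] at h
  have h' := mul_nonneg hx.le h
  have : x * (Real.log x + (x⁻¹ - x) / 2) = x * Real.log x + (1 - x ^ 2) / 2 := by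
    field_simp
  linarith

/-- The weighted biharmonic Green function for the weight `1-|ζ|²`. -/
def biharmGreen (z ζ : ℂ) : ℝ :=
  normSq (1 - conj z * ζ) * (1 - normSq (z + ζ) / 4) *
      (normSq (z - ζ) / normSq (1 - conj z * ζ) * greenSplit z ζ +
        (1 - (normSq (z - ζ) / normSq (1 - conj z * ζ)) ^ 2) / 2) +
    (1 - normSq z) ^ 3 * (1 - normSq ζ) ^ 3 / (8 * normSq (1 - conj z * ζ))

/-- The harmonic function `H_z` with `ΔΓ(z,·) = (1-|ζ|²)(G(z,·) + H_z)`. -/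
def harmKernel (z ζ : ℂ) : ℝ := (harmPolar z (conj z) ζ (conj ζ)).re

theorem ofReal_harmKernel (z ζ : ℂ) :
    (harmKernel z ζ : ℂ) = harmPolar z (conj z) ζ (conj ζ) := by
  rw [harmKernel, ← conj_eq_iff_re]
  simp only [harmPolar, map_sub, map_add, map_mul, map_one, map_inv₀, map_div₀, map_pow,
    Complex.conj_conj, map_ofNat]
  ring

theorem harmKernel_eq_of_norm_eq_one (hz : ‖z‖ < 1) (hζ : ‖ζ‖ = 1) :
    harmKernel z ζ = (1 - normSq z) ^ 2 * ((1 - normSq z) / normSq (1 - conj z * ζ) +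
      ((1 - normSq z) / normSq (1 - conj z * ζ)) ^ 2 / 2) := by
  have h1 := one_sub_conj_mul_ne_zero hz hζ.le
  have h2 := one_sub_mul_conj_ne_zero hz hζ.le
  have h1' : 1 - ζ * conj z ≠ 0 := by rwa [mul_comm]
  have h2' : 1 - conj ζ * z ≠ 0 := by rwa [mul_comm]
  have h0 : ζ ≠ 0 := by rintro rfl; simp at hζ
  have hd : conj ζ = ζ⁻¹ := by
    rw [Complex.inv_def, normSq_eq_norm_sq, hζ]
    simp
  have key : (harmKernel z ζ : ℂ) = (((1 - normSq z) ^ 2 * ((1 - normSq z) /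
      normSq (1 - conj z * ζ) + ((1 - normSq z) / normSq (1 - conj z * ζ)) ^ 2 / 2) : ℝ) : ℂ) := by
    rw [ofReal_harmKernel, harmPolar]
    push_cast
    simp only [normSq_eq_conj_mul_self, map_sub, map_mul, map_one, Complex.conj_conj]
    rw [hd] at h2 h2' ⊢
    generalize conj z = c at *
    have h3 : ζ - z ≠ 0 := by
      intro h
      apply h2
      rw [← sub_eq_zero.1 h, mul_inv_cancel₀ h0, sub_self]
    field_simp
    ring
  exact_mod_cast key

theorem normSq_lt_one (hz : ‖z‖ < 1) : normSq z < 1 := by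
  rw [normSq_eq_norm_sq]
  nlinarith [norm_nonneg z]

theorem harmKernel_nonneg (hz : ‖z‖ < 1) (hζ : ‖ζ‖ = 1) : 0 ≤ harmKernel z ζ := by
  rw [harmKernel_eq_of_norm_eq_one hz hζ]
  have := normSq_lt_one hz
  have h : 0 ≤ (1 - normSq z) / normSq (1 - conj z * ζ) :=
    div_nonneg (by linarith) (normSq_nonneg _)
  positivity

theorem harmKernel_zero_right (z : ℂ) :
    harmKernel z 0 = 3 / 2 - 2 * normSq z + normSq z ^ 2 / 2 := by
  have key : (harmKernel z 0 : ℂ) = ((3 / 2 - 2 * normSq z + normSq z ^ 2 / 2 : ℝ) : ℂ) := by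
    rw [ofReal_harmKernel, harmPolar]
    push_cast
    rw [normSq_eq_conj_mul_self]
    simp
    ring
  exact_mod_cast key

theorem continuousOn_harmKernel (hz : ‖z‖ < 1) :
    ContinuousOn (harmKernel z) (closedBall 0 1) :=
  continuous_re.comp_continuousOn (continuousOn_harmPolar hz)

theorem greenSplit_eq (hne : ζ ≠ z) (h1 : 1 - conj z * ζ ≠ 0) :
    greenSplit z ζ = Real.log (normSq (z - ζ) / normSq (1 - conj z * ζ)) := by
  rw [greenSplit, Real.log_div ((map_ne_zero normSq).2 (sub_ne_zero.2 hne.symm))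
    ((map_ne_zero normSq).2 h1)]

/-- The identity `|1-z̄ζ|² = |z-ζ|² + (1-|z|²)(1-|ζ|²)`. -/
theorem normSq_one_sub_conj_mul (z ζ : ℂ) :
    normSq (1 - conj z * ζ) = normSq (z - ζ) + (1 - normSq z) * (1 - normSq ζ) := by
  simp only [normSq_apply, sub_re, sub_im, mul_re, mul_im, one_re, one_im, conj_re, conj_im]
  ring

theorem biharmGreen_nonneg (hz : ‖z‖ < 1) (hζ : ‖ζ‖ < 1) : 0 ≤ biharmGreen z ζ := by
  have hA := normSq_lt_one hz
  have hB := normSq_lt_one hζ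
  have h1 := one_sub_conj_mul_ne_zero hz hζ.le
  have hN : 0 < normSq (1 - conj z * ζ) := normSq_pos.2 h1
  have hm : 0 ≤ 1 - normSq (z + ζ) / 4 := by
    have : ‖z + ζ‖ ≤ 2 := (norm_add_le z ζ).trans (by linarith)
    rw [normSq_eq_norm_sq]
    nlinarith [norm_nonneg (z + ζ)]
  have hx : 0 ≤ normSq (z - ζ) / normSq (1 - conj z * ζ) := div_nonneg (normSq_nonneg _) hN.le
  have hx1 : normSq (z - ζ) / normSq (1 - conj z * ζ) ≤ 1 := by
    rw [div_le_one hN, normSq_one_sub_conj_mul]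
    nlinarith
  have hlog : normSq (z - ζ) / normSq (1 - conj z * ζ) * greenSplit z ζ =
      normSq (z - ζ) / normSq (1 - conj z * ζ) *
        Real.log (normSq (z - ζ) / normSq (1 - conj z * ζ)) := by
    rcases eq_or_ne ζ z with rfl | hne
    · simp
    · rw [greenSplit_eq hne h1]
  have hp := mul_log_add_nonneg hx hx1
  rw [biharmGreen, hlog]
  have h3 : 0 ≤ (1 - normSq z) ^ 3 * (1 - normSq ζ) ^ 3 / (8 * normSq (1 - conj z * ζ)) := by
    have := sub_pos.2 hA
    have := sub_pos.2 hB
    positivity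
  exact add_nonneg (mul_nonneg (mul_nonneg hN.le hm) hp) h3

theorem biharmPolar_eq_ofReal (h1 : 1 - conj z * ζ ≠ 0) :
    biharmPolar z (conj z) ζ (conj ζ) (greenSplit z ζ) = (biharmGreen z ζ : ℂ) := by
  have h2 : 1 - z * conj ζ ≠ 0 := by
    rw [← map_ne_zero (starRingEnd ℂ)] at h1
    simpa using h1
  have h1' : 1 - ζ * conj z ≠ 0 := by rwa [mul_comm]
  have h2' : 1 - conj ζ * z ≠ 0 := by rwa [mul_comm]
  rw [biharmGreen, biharmPolar]
  push_cast
  simp only [normSq_eq_conj_mul_self, map_sub, map_add, map_mul, map_one, Complex.conj_conj]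
  generalize (greenSplit z ζ : ℂ) = g at *
  generalize conj z = c at *
  generalize conj ζ = d at *
  field_simp
  ring

end positivity

section integrability

variable {z ζ : ℂ}

theorem integrableOn_inv_norm_ball (r : ℝ) : IntegrableOn (fun p : ℂ => ‖p‖⁻¹) (ball 0 r) := by
  have h := integrableOn_fun_norm_addHaar (volume : Measure ℂ) (f := fun y : ℝ => y⁻¹) (r := r)
  refine h.2 ?_
  have h1 : IntegrableOn (fun _ : ℝ => (1 : ℝ)) (Ioo 0 r) := by simp
  refine h1.congr_fun (fun y hy => ?_) measurableSet_Ioo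
  rw [Complex.finrank_real_complex, smul_eq_mul, pow_one, mul_inv_cancel₀ hy.1.ne']

theorem integrableOn_inv_norm_sub (hz : ‖z‖ < 1) :
    IntegrableOn (fun ζ : ℂ => ‖z - ζ‖⁻¹) (ball 0 1) := by
  have h1 := (integrableOn_inv_norm_ball 2).integrable_indicator measurableSet_ball
  have h2 := (h1.comp_sub_left z).integrableOn (s := ball (0 : ℂ) 1)
  refine h2.congr_fun (fun ζ hζ => ?_) measurableSet_ball
  refine indicator_of_mem ?_ _
  rw [mem_ball_zero_iff] at hζ ⊢
  exact (norm_sub_le _ _).trans_lt (by linarith)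

theorem neg_greenSplit_eq (hz : ‖z‖ < 1) (hζ : ‖ζ‖ < 1) (hne : ζ ≠ z) :
    -greenSplit z ζ =
      Real.log (1 + (1 - normSq z) * (1 - normSq ζ) / normSq (z - ζ)) := by
  have h0 : normSq (z - ζ) ≠ 0 := (map_ne_zero normSq).2 (sub_ne_zero.2 hne.symm)
  rw [greenSplit_eq hne (one_sub_conj_mul_ne_zero hz hζ.le), ← Real.log_inv, inv_div,
    normSq_one_sub_conj_mul, add_div, div_self h0]

theorem neg_greenSplit_nonneg (hz : ‖z‖ < 1) (hζ : ‖ζ‖ < 1) (hne : ζ ≠ z) :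
    0 ≤ -greenSplit z ζ := by
  rw [neg_greenSplit_eq hz hζ hne]
  refine Real.log_nonneg (le_add_of_nonneg_right (div_nonneg (mul_nonneg ?_ ?_) (normSq_nonneg _)))
  · linarith [normSq_lt_one hz]
  · linarith [normSq_lt_one hζ]

theorem neg_greenSplit_le (hz : ‖z‖ < 1) (hζ : ‖ζ‖ < 1) (hne : ζ ≠ z) :
    -greenSplit z ζ ≤ 2 * √(1 - normSq z) * ‖z - ζ‖⁻¹ := by
  rw [neg_greenSplit_eq hz hζ hne]
  have hA := sub_pos.2 (normSq_lt_one hz)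
  have hB := sub_pos.2 (normSq_lt_one hζ)
  have h0 : 0 < ‖z - ζ‖ := norm_pos_iff.2 (sub_ne_zero.2 hne.symm)
  set y := √(1 - normSq z) * ‖z - ζ‖⁻¹ with hy
  have hy0 : 0 ≤ y := by positivity
  have hle : 1 + (1 - normSq z) * (1 - normSq ζ) / normSq (z - ζ) ≤ (1 + y) ^ 2 := by
    have h1 : (1 - normSq z) * (1 - normSq ζ) / normSq (z - ζ) ≤ y ^ 2 := by
      rw [hy, mul_pow, Real.sq_sqrt hA.le, inv_pow, ← normSq_eq_norm_sq, div_eq_mul_inv]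
      have : 0 ≤ (normSq (z - ζ))⁻¹ := inv_nonneg.2 (normSq_nonneg _)
      have := mul_nonneg hA.le this
      nlinarith [normSq_nonneg ζ]
    nlinarith
  calc _ ≤ Real.log ((1 + y) ^ 2) :=
        Real.log_le_log (by have := normSq_nonneg (z - ζ); positivity) hle
    _ = 2 * Real.log (1 + y) := by rw [Real.log_pow]; norm_num
    _ ≤ 2 * y := by linarith [Real.log_le_sub_one_of_pos (show 0 < 1 + y by linarith)]
    _ = _ := by rw [hy]; ring

theorem le_neg_greenSplit (hz : ‖z‖ < 1) (hζ : ‖ζ‖ < 1) (hne : ζ ≠ z) :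
    (1 - normSq z) * (1 - normSq ζ) / normSq (1 - conj z * ζ) ≤ -greenSplit z ζ := by
  have h1 := one_sub_conj_mul_ne_zero hz hζ.le
  have hN : 0 < normSq (1 - conj z * ζ) := normSq_pos.2 h1
  have h0 : 0 < normSq (z - ζ) := normSq_pos.2 (sub_ne_zero.2 hne.symm)
  rw [greenSplit_eq hne h1]
  have h := Real.log_le_sub_one_of_pos (div_pos h0 hN)
  have : (1 - normSq z) * (1 - normSq ζ) / normSq (1 - conj z * ζ) =
      1 - normSq (z - ζ) / normSq (1 - conj z * ζ) := by
    rw [eq_sub_iff_add_eq, ← add_div, div_eq_one_iff_eq hN.ne', normSq_one_sub_conj_mul]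
    ring
  linarith

theorem measurable_greenSplit : Measurable fun p : ℂ × ℂ => greenSplit p.1 p.2 := by
  have h1 : Measurable fun p : ℂ × ℂ => normSq (p.1 - p.2) :=
    (continuous_normSq.comp (by fun_prop)).measurable
  have h2 : Measurable fun p : ℂ × ℂ => normSq (1 - conj p.1 * p.2) :=
    (continuous_normSq.comp (by fun_prop)).measurable
  exact h1.log.sub h2.log

theorem integrableOn_greenSplit (hz : ‖z‖ < 1) : IntegrableOn (greenSplit z) (ball 0 1) := by
  refine Integrable.mono' ((integrableOn_inv_norm_sub hz).const_mul (2 * √(1 - normSq z)))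
    (measurable_greenSplit.comp measurable_prodMk_left).aestronglyMeasurable ?_
  filter_upwards [ae_restrict_mem measurableSet_ball,
    ae_restrict_of_ae (Measure.ae_ne volume z)] with ζ hζ hne
  rw [mem_ball_zero_iff] at hζ
  rw [Real.norm_eq_abs, abs_of_nonpos (by linarith [neg_greenSplit_nonneg hz hζ hne])]
  exact neg_greenSplit_le hz hζ hne

theorem integrableOn_conj_div (z : ℂ) :
    IntegrableOn (fun ζ : ℂ => (conj z - conj ζ) / (z - ζ)) (ball 0 1) := by
  refine Measure.integrableOn_of_bounded (M := 1) measure_ball_lt_top.ne ?_ ?_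
  · have h1 : Measurable fun ζ : ℂ => conj z - conj ζ := Continuous.measurable (by fun_prop)
    have h2 : Measurable fun ζ : ℂ => z - ζ := by fun_prop
    exact (h1.div h2).aestronglyMeasurable
  · refine Filter.Eventually.of_forall fun ζ => ?_
    rw [← map_sub, norm_div, RCLike.norm_conj]
    exact div_self_le_one _

theorem integrableOn_continuousOn_mul {f g : ℂ → ℂ} (hf : IntegrableOn f (ball 0 1))
    (hg : ContinuousOn g (closedBall 0 1)) : IntegrableOn (fun ζ => g ζ * f ζ) (ball 0 1) := by
  obtain ⟨C, hC⟩ := (isCompact_closedBall (0 : ℂ) 1).exists_bound_of_continuousOn hg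
  refine Integrable.bdd_mul hf ((hg.mono ball_subset_closedBall).aestronglyMeasurable
    measurableSet_ball) (c := C) ?_
  filter_upwards [ae_restrict_mem measurableSet_ball] with ζ hζ
  exact hC ζ (ball_subset_closedBall hζ)

theorem integrableOn_ball_of_continuousOn {g : ℂ → ℂ} (hg : ContinuousOn g (closedBall 0 1)) :
    IntegrableOn g (ball 0 1) :=
  (hg.integrableOn_compact (isCompact_closedBall 0 1)).mono_set ball_subset_closedBall

theorem integrableOn_biharmPolarDeriv₂ (hz : ‖z‖ < 1) :
    IntegrableOn (fun ζ => biharmPolarDeriv₂ z (conj z) ζ (conj ζ) (greenSplit z ζ))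
      (ball 0 1) := by
  have hv := continuousOn_inv_one_sub hz
  have hw := continuousOn_inv_one_sub_conj hz
  have h1 := (integrableOn_greenSplit hz).ofReal (𝕜 := ℂ)
  have h2 := integrableOn_conj_div z
  have e1 := integrableOn_continuousOn_mul h1
    (g := fun ζ => (conj z - conj ζ) * ((conj z + conj ζ) / 2)) (by fun_prop)
  have e2 := integrableOn_continuousOn_mul h2
    (g := fun ζ => (1 - ζ * (conj z + conj ζ) / 2) * (1 - z * conj z) * (1 - conj z * ζ)⁻¹)
    (by fun_prop)
  refine (e1.add e2).add (integrableOn_ball_of_continuousOn ?_)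
  unfold biharmPolarRegDeriv₂
  fun_prop

end integrability

section greenFormula

variable {z : ℂ} {u : ℂ → ℝ} {R : ℝ}

theorem ContDiffOn.fderiv_apply_ball {m n : WithTop ℕ∞} (hu : ContDiffOn ℝ n u (ball 0 R))
    (hmn : m + 1 ≤ n) (v : ℂ) : ContDiffOn ℝ m (fun w => fderiv ℝ u w v) (ball 0 R) :=
  (hu.fderiv_of_isOpen isOpen_ball hmn).clm_apply contDiffOn_const

theorem conj_biharmPolarDeriv (z ζ : ℂ) (g : ℝ) :
    conj (biharmPolarDeriv z (conj z) ζ (conj ζ) g) =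
      biharmPolarDeriv (conj z) z (conj ζ) ζ g := by
  simp only [biharmPolarDeriv, map_sub, map_add, map_mul, map_one, map_inv₀, map_div₀, map_pow,
    map_neg, Complex.conj_conj, map_ofNat, conj_ofReal]

/-- Green's formula for the weighted biharmonic Green function. -/
theorem integral_mul_green_add_harmKernel (hz : ‖z‖ < 1) (hR : 1 < R)
    (hu : ContDiffOn ℝ 2 u (ball 0 R)) :
    ∫ ζ in ball (0 : ℂ) 1, u ζ * ((1 - normSq ζ) * (greenSplit z ζ + harmKernel z ζ)) =
      ∫ ζ in ball (0 : ℂ) 1, biharmGreen z ζ * lap u ζ := by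
  have hsub : closedBall (0 : ℂ) 1 ⊆ ball 0 R := closedBall_subset_ball hR
  have hu' : ∀ v : ℂ, ContDiffOn ℝ 1 (fun w => fderiv ℝ u w v) (ball 0 R) :=
    hu.fderiv_apply_ball (by norm_num)
  have hu'' : ∀ v v' : ℂ, ContinuousOn (fun w => fderiv ℝ (fun w => fderiv ℝ u w v) w v')
      (closedBall 0 1) := fun v v' =>
    (((hu' v).fderiv_apply_ball (m := 0) (by norm_num) v').continuousOn).mono hsub
  have cu' : ∀ v : ℂ, ContinuousOn (fun w => (fderiv ℝ u w v : ℂ)) (closedBall 0 1) := fun v =>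
    continuous_ofReal.comp_continuousOn ((hu' v).continuousOn.mono hsub)
  have cu'' : ∀ v v' : ℂ, ContinuousOn
      (fun w => (fderiv ℝ (fun w => fderiv ℝ u w v) w v' : ℂ)) (closedBall 0 1) := fun v v' =>
    continuous_ofReal.comp_continuousOn (hu'' v v')
  have cu : ContinuousOn (fun w => (u w : ℂ)) (closedBall 0 1) :=
    continuous_ofReal.comp_continuousOn (hu.continuousOn.mono hsub)
  have wu : ∀ ζ ∈ ball (0 : ℂ) 1, HasWirtingerAt (fun w => (u w : ℂ))
      ((fderiv ℝ u ζ 1 - I * fderiv ℝ u ζ I) / 2) ((fderiv ℝ u ζ 1 + I * fderiv ℝ u ζ I) / 2) ζ :=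
    fun ζ hζ => HasWirtingerAt.ofReal ((hu.contDiffAt (isOpen_ball.mem_nhds
      (hsub (ball_subset_closedBall hζ)))).differentiableAt (by norm_num))
  have wu' : ∀ v, ∀ ζ ∈ ball (0 : ℂ) 1, HasWirtingerAt (fun w => (fderiv ℝ u w v : ℂ))
      ((fderiv ℝ (fun w => fderiv ℝ u w v) ζ 1 - I * fderiv ℝ (fun w => fderiv ℝ u w v) ζ I) / 2)
      ((fderiv ℝ (fun w => fderiv ℝ u w v) ζ 1 + I * fderiv ℝ (fun w => fderiv ℝ u w v) ζ I) / 2)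
      ζ :=
    fun v ζ hζ => HasWirtingerAt.ofReal (((hu' v).contDiffAt (isOpen_ball.mem_nhds
      (hsub (ball_subset_closedBall hζ)))).differentiableAt (by norm_num))
  have wbar := fun ζ hζ => ((wu' 1 ζ hζ).add ((wu' I ζ hζ).const_mul I)).div_const 2
  have cG := continuousOn_biharmPolar hz
  have cp := continuousOn_biharmPolarDeriv hz
  have cp' : ContinuousOn (fun ζ => biharmPolarDeriv (conj z) z (conj ζ) ζ (greenSplit z ζ))
      (closedBall 0 1) := by
    simpa only [Function.comp_def, conj_biharmPolarDeriv] using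
      continuous_conj.comp_continuousOn cp
  have ip2 := integrableOn_biharmPolarDeriv₂ hz
  have cH := continuousOn_harmPolar hz
  have iq : IntegrableOn (fun ζ => (1 - ζ * conj ζ) *
      (greenSplit z ζ + harmPolar z (conj z) ζ (conj ζ))) (ball 0 1) :=
    integrableOn_continuousOn_mul (((integrableOn_greenSplit hz).ofReal (𝕜 := ℂ)).add
      (integrableOn_ball_of_continuousOn cH)) (by fun_prop)
  have hne : ∀ ζ ∈ ball (0 : ℂ) 1, 1 - conj z * ζ ≠ 0 := fun ζ hζ =>
    one_sub_conj_mul_ne_zero hz (by simpa using (mem_ball_zero_iff.1 hζ).le)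
  have hne' : ∀ ζ ∈ ball (0 : ℂ) 1, 1 - z * conj ζ ≠ 0 := fun ζ hζ =>
    one_sub_mul_conj_ne_zero hz (by simpa using (mem_ball_zero_iff.1 hζ).le)
  have hsph : ∀ ζ ∈ sphere (0 : ℂ) 1, ζ * conj ζ = 1 := fun ζ hζ => by
    rw [mul_conj, normSq_eq_norm_sq, mem_sphere_zero_iff_norm.1 hζ]
    simp
  have i1 : IntegrableOn (fun ζ => (fderiv ℝ u ζ 1 + I * fderiv ℝ u ζ I) / 2 *
        biharmPolarDeriv z (conj z) ζ (conj ζ) (greenSplit z ζ) +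
      u ζ * ((1 - ζ * conj ζ) * (greenSplit z ζ + harmPolar z (conj z) ζ (conj ζ)))) (ball 0 1) :=
    (integrableOn_ball_of_continuousOn (by have := cu' 1; have := cu' I; fun_prop)).add
      (integrableOn_continuousOn_mul iq cu)
  have i2 : IntegrableOn (fun ζ => biharmPolarDeriv z (conj z) ζ (conj ζ) (greenSplit z ζ) *
        ((fderiv ℝ u ζ 1 + I * fderiv ℝ u ζ I) / 2) +
      biharmPolar z (conj z) ζ (conj ζ) (greenSplit z ζ) *
      (((fderiv ℝ (fun w => fderiv ℝ u w 1) ζ 1 - I * fderiv ℝ (fun w => fderiv ℝ u w 1) ζ I) / 2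
        + I * ((fderiv ℝ (fun w => fderiv ℝ u w I) ζ 1 -
          I * fderiv ℝ (fun w => fderiv ℝ u w I) ζ I) / 2)) / 2)) (ball 0 1) :=
    integrableOn_ball_of_continuousOn (by
      have := cu' 1; have := cu' I; have := cu'' 1 1; have := cu'' 1 I; have := cu'' I 1
      have := cu'' I I; fun_prop)
  have h1 := (setIntegral_ball_wirtinger_eq_zero (z := z) (cu.mul cp)
    (fun ζ hζ => mul_eq_zero_of_right _ (biharmPolarDeriv_eq_zero hz (hsph ζ hζ)))
    (fun ζ hζ hz' => (wu ζ hζ).mul (hasWirtingerAt_biharmPolarDeriv hz' (hne ζ hζ) (hne' ζ hζ)))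
    ((integrableOn_ball_of_continuousOn (by have := cu' 1; have := cu' I; fun_prop)).add
      (integrableOn_continuousOn_mul ip2 cu)) i1).2
  have h2 := (setIntegral_ball_wirtinger_eq_zero (z := z)
    (cG.mul (g := fun ζ => ((fderiv ℝ u ζ 1 : ℂ) + I * fderiv ℝ u ζ I) / 2)
      (by have := cu' 1; have := cu' I; fun_prop))
    (fun ζ hζ => mul_eq_zero_of_left (biharmPolar_eq_zero (hsph ζ hζ)) _)
    (fun ζ hζ hz' => (hasWirtingerAt_biharmPolar hz' (hne ζ hζ) (hne' ζ hζ)).mul (wbar ζ hζ))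
    i2 (integrableOn_ball_of_continuousOn (by
      have := cu' 1; have := cu' I; have := cu'' 1 1; have := cu'' 1 I; have := cu'' I 1
      have := cu'' I I; fun_prop))).1
  have h3 := integral_sub i1 i2
  rw [h1, h2, sub_self] at h3
  have h4 := integral_re (𝕜 := ℂ) (i1.sub i2)
  simp only [Pi.sub_apply] at h4
  rw [h3, map_zero] at h4
  have j1 : IntegrableOn (fun ζ => u ζ * ((1 - normSq ζ) * (greenSplit z ζ + harmKernel z ζ)))
      (ball 0 1) := by
    refine IntegrableOn.congr_fun (integrableOn_continuousOn_mul iq cu).re (fun ζ _ => ?_)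
      measurableSet_ball
    simp only [← ofReal_harmKernel, mul_conj, RCLike.re_eq_complex_re]
    exact_mod_cast rfl
  have j2 : IntegrableOn (fun ζ => biharmGreen z ζ * lap u ζ) (ball 0 1) := by
    have hl : ContinuousOn (fun ζ => (lap u ζ : ℂ)) (closedBall 0 1) := by
      have := cu'' 1 1; have := cu'' I I
      simp only [lap]
      push_cast
      fun_prop
    refine IntegrableOn.congr_fun (integrableOn_ball_of_continuousOn (cG.mul hl)).re
      (fun ζ hζ => ?_)
      measurableSet_ball
    simp only [Pi.mul_apply, biharmPolar_eq_ofReal (hne ζ hζ), RCLike.re_eq_complex_re]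
    exact_mod_cast rfl
  rw [← sub_eq_zero, ← integral_sub j1 j2, ← h4]
  refine setIntegral_congr_fun measurableSet_ball fun ζ hζ => ?_
  have hlap (a b c d : ℝ) : (((a - I * b) / 2 + I * ((c - I * d) / 2)) / 2 : ℂ).re =
      1 / 4 * (a + d) := by
    simp
    ring
  have hring (X Y Γ L : ℂ) (a b : ℝ) :
      X * Y + a * b - (Y * X + Γ * L) = ((a * b : ℝ) : ℂ) - Γ * L := by
    push_cast
    ring
  have hq : (1 - ζ * conj ζ) * (greenSplit z ζ + harmPolar z (conj z) ζ (conj ζ)) =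
      (((1 - normSq ζ) * (greenSplit z ζ + harmKernel z ζ) : ℝ) : ℂ) := by
    rw [← ofReal_harmKernel, mul_conj]
    push_cast
    rfl
  simp only [hq, hring]
  rw [RCLike.re_eq_complex_re, sub_re, ofReal_re, biharmPolar_eq_ofReal (hne ζ hζ), re_ofReal_mul,
    hlap, lap]

end greenFormula

section limit

variable {z : ℂ} {ν : ℂ → ℝ}

theorem lap_comp_smul (u : ℂ → ℝ) (ρ : ℝ) (ζ : ℂ) :
    lap (fun w => u (ρ • w)) ζ = ρ ^ 2 * lap u (ρ • ζ) := by
  have h (u : ℂ → ℝ) (v ζ : ℂ) :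
      fderiv ℝ (fun w => u (ρ • w)) ζ v = ρ * fderiv ℝ u (ρ • ζ) v := by
    rw [fderiv_comp_smul]
    simp
  have h2 (v ζ : ℂ) : fderiv ℝ (fun w => ρ * fderiv ℝ u (ρ • w) v) ζ v =
      ρ ^ 2 * fderiv ℝ (fun w => fderiv ℝ u w v) (ρ • ζ) v := by
    have e : fderiv ℝ (ρ • fun w => fderiv ℝ u (ρ • w) v) ζ =
        ρ • fderiv ℝ (fun w => fderiv ℝ u (ρ • w) v) ζ := by
      rw [fderiv_const_smul_field, Pi.smul_apply]
    simp only [Pi.smul_def, smul_eq_mul] at e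
    rw [e, _root_.smul_apply, h (fun w => fderiv ℝ u w v), smul_eq_mul]
    ring
  simp only [lap, h, h2]
  ring

theorem tendsto_one_sub_inv :
    Filter.Tendsto (fun n : ℕ => 1 - 1 / ((n : ℝ) + 2)) Filter.atTop (nhds 1) := by
  have h := (tendsto_one_div_add_atTop_nhds_zero_nat (𝕜 := ℝ)).comp (Filter.tendsto_add_atTop_nat 1)
  have h' := h.const_sub 1
  rw [sub_zero] at h'
  refine h'.congr fun n => ?_
  simp only [Function.comp_apply]
  push_cast
  ring

theorem one_sub_inv_mem (n : ℕ) : 1 - 1 / ((n : ℝ) + 2) ∈ Ioo (0 : ℝ) 1 := by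
  have : (0 : ℝ) < n + 2 := by positivity
  constructor
  · rw [sub_pos, div_lt_one this]
    have : (0 : ℝ) ≤ n := n.cast_nonneg
    linarith
  · have : 0 < 1 / ((n : ℝ) + 2) := by positivity
    linarith

theorem contDiffOn_div_one_sub_normSq (hν : ContDiffOn ℝ (⊤ : ℕ∞) ν (closedBall (0 : ℂ) 1)) :
    ContDiffOn ℝ 2 (fun w => ν w / (1 - normSq w)) (ball 0 1) := by
  have h1 : ContDiffOn ℝ 2 ν (ball 0 1) :=
    (hν.of_le (WithTop.coe_le_coe.2 (le_top : (2 : ℕ∞) ≤ ⊤))).mono ball_subset_closedBall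
  have h2 : ContDiff ℝ 2 fun w : ℂ => 1 - normSq w := by
    simp only [normSq_eq_norm_sq]
    exact contDiff_const.sub (contDiff_norm_sq ℝ)
  refine h1.div h2.contDiffOn fun w hw => ?_
  rw [mem_ball_zero_iff] at hw
  exact (sub_pos.2 (normSq_lt_one hw)).ne'

theorem integral_green_add_harmKernel_mul_nonneg (hz : ‖z‖ < 1)
    (hν : ContDiffOn ℝ (⊤ : ℕ∞) ν (closedBall (0 : ℂ) 1))
    (hsub : ∀ z ∈ ball (0 : ℂ) 1, 0 ≤ lap (fun w => ν w / (1 - normSq w)) z) :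
    0 ≤ ∫ ζ in ball (0 : ℂ) 1, ν ζ * (greenSplit z ζ + harmKernel z ζ) := by
  set ω : ℂ → ℝ := fun w => ν w / (1 - normSq w) with hω
  have hω2 : ContDiffOn ℝ 2 ω (ball 0 1) := contDiffOn_div_one_sub_normSq hν
  obtain ⟨C, hC⟩ := (isCompact_closedBall (0 : ℂ) 1).exists_bound_of_continuousOn hν.continuousOn
  have hmem (ρ : ℝ) (hρ : ρ ∈ Ioo (0 : ℝ) 1) (ζ : ℂ) (hζ : ζ ∈ ball (0 : ℂ) 1) :
      ρ • ζ ∈ ball (0 : ℂ) 1 := by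
    rw [mem_ball_zero_iff] at hζ ⊢
    rw [norm_smul, Real.norm_eq_abs, abs_of_pos hρ.1]
    nlinarith [hρ.1, hρ.2, norm_nonneg ζ]
  have hI : IntegrableOn (fun ζ => greenSplit z ζ + harmKernel z ζ) (ball 0 1) :=
    (integrableOn_greenSplit hz).add (((continuousOn_harmKernel hz).integrableOn_compact
      (isCompact_closedBall 0 1)).mono_set ball_subset_closedBall)
  have hstep (n : ℕ) : 0 ≤ ∫ ζ in ball (0 : ℂ) 1, ω ((1 - 1 / ((n : ℝ) + 2)) • ζ) *
      ((1 - normSq ζ) * (greenSplit z ζ + harmKernel z ζ)) := by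
    have hρ := one_sub_inv_mem n
    set ρ : ℝ := 1 - 1 / ((n : ℝ) + 2)
    have hmaps : MapsTo (fun w : ℂ => ρ • w) (ball 0 ρ⁻¹) (ball 0 1) := fun w hw => by
      rw [mem_ball_zero_iff] at hw ⊢
      rw [norm_smul, Real.norm_eq_abs, abs_of_pos hρ.1]
      calc ρ * ‖w‖ < ρ * ρ⁻¹ := mul_lt_mul_of_pos_left hw hρ.1
        _ = 1 := mul_inv_cancel₀ hρ.1.ne'
    rw [integral_mul_green_add_harmKernel (R := ρ⁻¹) (u := fun w => ω (ρ • w)) hz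
      ((one_lt_inv₀ hρ.1).2 hρ.2) (hω2.comp (contDiff_const_smul ρ).contDiffOn hmaps)]
    refine setIntegral_nonneg measurableSet_ball fun ζ hζ => ?_
    rw [lap_comp_smul]
    exact mul_nonneg (biharmGreen_nonneg hz (mem_ball_zero_iff.1 hζ))
      (mul_nonneg (sq_nonneg _) (hsub _ (hmem ρ hρ ζ hζ)))
  refine ge_of_tendsto' (x := Filter.atTop) ?_ hstep
  refine tendsto_integral_of_dominated_convergence
    (fun ζ => C * ‖greenSplit z ζ + harmKernel z ζ‖) (fun n => ?_) (hI.norm.const_mul C)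
    (fun n => ?_) ?_
  · have hc : ContinuousOn (fun ζ : ℂ => ω ((1 - 1 / ((n : ℝ) + 2)) • ζ)) (ball 0 1) :=
      hω2.continuousOn.comp (continuous_const_smul _).continuousOn (hmem _ (one_sub_inv_mem n))
    have h1 : Continuous fun ζ : ℂ => 1 - normSq ζ := by
      have := continuous_normSq
      fun_prop
    exact (hc.aestronglyMeasurable measurableSet_ball).mul
      (h1.aestronglyMeasurable.mul hI.aestronglyMeasurable)
  · filter_upwards [ae_restrict_mem measurableSet_ball] with ζ hζ
    have hρ := one_sub_inv_mem n
    set ρ : ℝ := 1 - 1 / ((n : ℝ) + 2)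
    have hm := hmem ρ hρ ζ hζ
    have h1 := sub_pos.2 (normSq_lt_one (mem_ball_zero_iff.1 hm))
    have h2 := sub_pos.2 (normSq_lt_one (mem_ball_zero_iff.1 hζ))
    rw [← mul_assoc, norm_mul]
    refine mul_le_mul_of_nonneg_right ?_ (norm_nonneg _)
    have hle : (1 - normSq ζ) / (1 - normSq (ρ • ζ)) ≤ 1 := by
      rw [div_le_one h1]
      have : normSq (ρ • ζ) ≤ normSq ζ := by
        rw [normSq_eq_norm_sq, normSq_eq_norm_sq, norm_smul, Real.norm_eq_abs, abs_of_pos hρ.1]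
        exact pow_le_pow_left₀ (mul_nonneg hρ.1.le (norm_nonneg ζ))
          (mul_le_of_le_one_left (norm_nonneg ζ) hρ.2.le) 2
      linarith
    have e : ω (ρ • ζ) * (1 - normSq ζ) = ν (ρ • ζ) * ((1 - normSq ζ) / (1 - normSq (ρ • ζ))) := by
      simp only [hω]
      ring
    rw [e, norm_mul, Real.norm_of_nonneg (div_pos h2 h1).le]
    have hb := hC _ (ball_subset_closedBall hm)
    nlinarith [norm_nonneg (ν (ρ • ζ)), div_pos h2 h1]
  · filter_upwards [ae_restrict_mem measurableSet_ball] with ζ hζ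
    have h2 := sub_pos.2 (normSq_lt_one (mem_ball_zero_iff.1 hζ))
    have e : ν ζ * (greenSplit z ζ + harmKernel z ζ) =
        ω ((1 : ℝ) • ζ) * ((1 - normSq ζ) * (greenSplit z ζ + harmKernel z ζ)) := by
      simp only [hω, one_smul]
      field_simp
    rw [e]
    refine Filter.Tendsto.mul_const _ ?_
    have hc : ContinuousAt ω ((1 : ℝ) • ζ) := by
      rw [one_smul]
      exact hω2.continuousOn.continuousAt (isOpen_ball.mem_nhds hζ)
    exact hc.tendsto.comp (tendsto_one_sub_inv.smul_const ζ)

end limit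

section potential

variable {z : ℂ} {ν : ℂ → ℝ}

/-- The Green potential `-∫ G(z,ζ)ν(ζ)` over the unit disk, for the Lebesgue measure. -/
def greenPotential (ν : ℂ → ℝ) (z : ℂ) : ℝ := ∫ ζ in ball (0 : ℂ) 1, -greenSplit z ζ * ν ζ

theorem ae_ball_ne (z : ℂ) :
    ∀ᵐ ζ ∂(volume.restrict (ball (0 : ℂ) 1)), ‖ζ‖ < 1 ∧ ζ ≠ z := by
  filter_upwards [ae_restrict_mem measurableSet_ball,
    ae_restrict_of_ae (Measure.ae_ne volume z)] with ζ hζ hne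
  exact ⟨mem_ball_zero_iff.1 hζ, hne⟩

theorem integral_greenG_eq (hz : ‖z‖ < 1) :
    ∫ ζ in ball (0 : ℂ) 1, greenG z ζ * ν ζ ∂areaM = -(Real.pi⁻¹ * greenPotential ν z) := by
  rw [areaM, Measure.restrict_smul, integral_smul_measure, ENNReal.toReal_inv,
    ENNReal.toReal_ofReal Real.pi_pos.le, smul_eq_mul, ← mul_neg, greenPotential, ← integral_neg]
  congr 1
  refine integral_congr_ae ?_
  filter_upwards [ae_ball_ne z] with ζ ⟨hζ, hne⟩
  have e : normSq (1 - conj ζ * z) = normSq (1 - conj z * ζ) := by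
    rw [← normSq_conj]
    simp [mul_comm]
  rw [greenSplit_eq hne (one_sub_conj_mul_ne_zero hz hζ.le), greenG, normSq_div, e]
  ring

theorem greenPotential_nonneg (hz : ‖z‖ < 1) (hν : ∀ ζ ∈ closedBall (0 : ℂ) 1, 0 < ν ζ) :
    0 ≤ greenPotential ν z := by
  refine integral_nonneg_of_ae ?_
  filter_upwards [ae_ball_ne z] with ζ ⟨hζ, hne⟩
  exact mul_nonneg (neg_greenSplit_nonneg hz hζ hne) (hν ζ (mem_closedBall_zero_iff.2 hζ.le)).le

theorem integrableOn_mul_of_continuousOn {f g : ℂ → ℝ} (hf : IntegrableOn f (ball 0 1))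
    (hg : ContinuousOn g (closedBall 0 1)) : IntegrableOn (fun ζ => f ζ * g ζ) (ball 0 1) := by
  obtain ⟨C, hC⟩ := (isCompact_closedBall (0 : ℂ) 1).exists_bound_of_continuousOn hg
  refine Integrable.mul_bdd hf ((hg.mono ball_subset_closedBall).aestronglyMeasurable
    measurableSet_ball) (c := C) ?_
  filter_upwards [ae_restrict_mem measurableSet_ball] with ζ hζ
  exact hC ζ (ball_subset_closedBall hζ)

theorem greenPotential_le_integral_harmKernel (hz : ‖z‖ < 1)
    (hν : ContDiffOn ℝ (⊤ : ℕ∞) ν (closedBall (0 : ℂ) 1))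
    (hsub : ∀ z ∈ ball (0 : ℂ) 1, 0 ≤ lap (fun w => ν w / (1 - normSq w)) z) :
    greenPotential ν z ≤ ∫ ζ in ball (0 : ℂ) 1, harmKernel z ζ * ν ζ := by
  have h := integral_green_add_harmKernel_mul_nonneg hz hν hsub
  have h1 : IntegrableOn (fun ζ => -greenSplit z ζ * ν ζ) (ball 0 1) :=
    integrableOn_mul_of_continuousOn (integrableOn_greenSplit hz).neg hν.continuousOn
  have h2 : IntegrableOn (fun ζ => harmKernel z ζ * ν ζ) (ball 0 1) :=
    integrableOn_mul_of_continuousOn (((continuousOn_harmKernel hz).integrableOn_compact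
      (isCompact_closedBall 0 1)).mono_set ball_subset_closedBall) hν.continuousOn
  rw [← sub_nonneg, greenPotential, ← integral_sub h2 h1]
  convert h using 3
  ring

/-- The integrand of the Green potential in the variable `p = z - ζ`. -/
def shiftedGreen (ν : ℂ → ℝ) (z p : ℂ) : ℝ :=
  (ball (0 : ℂ) 1).indicator (fun ζ => -greenSplit z ζ * ν ζ) (z - p)

theorem greenPotential_eq_integral_shiftedGreen (ν : ℂ → ℝ) (z : ℂ) :
    greenPotential ν z = ∫ p, shiftedGreen ν z p := by
  simp only [shiftedGreen]
  rw [integral_sub_left_eq_self, integral_indicator measurableSet_ball, greenPotential]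

theorem norm_shiftedGreen_le {C : ℝ} (hC : ∀ ζ ∈ closedBall (0 : ℂ) 1, ‖ν ζ‖ ≤ C) {p : ℂ}
    (hz : ‖z‖ < 1) (hp : p ≠ 0) :
    ‖shiftedGreen ν z p‖ ≤ 2 * C * √(1 - normSq z) * (ball (0 : ℂ) 2).indicator (‖·‖⁻¹) p := by
  have hC0 : 0 ≤ C := (norm_nonneg _).trans (hC 0 (mem_closedBall_self zero_le_one))
  by_cases hm : z - p ∈ ball (0 : ℂ) 1
  · have hm' := mem_ball_zero_iff.1 hm
    have hp2 : p ∈ ball (0 : ℂ) 2 := by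
      rw [mem_ball_zero_iff]
      calc ‖p‖ = ‖z - (z - p)‖ := by rw [sub_sub_cancel]
        _ ≤ ‖z‖ + ‖z - p‖ := norm_sub_le _ _
        _ < 2 := by linarith
    have hne : z - p ≠ z := by simpa using hp
    have h1 := neg_greenSplit_le hz hm' hne
    rw [sub_sub_cancel] at h1
    rw [shiftedGreen, indicator_of_mem hm, indicator_of_mem hp2, norm_mul,
      Real.norm_of_nonneg (neg_greenSplit_nonneg hz hm' hne)]
    calc _ ≤ (2 * √(1 - normSq z) * ‖p‖⁻¹) * C :=
          mul_le_mul h1 (hC _ (ball_subset_closedBall hm)) (norm_nonneg _) (by positivity)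
      _ = _ := by ring
  · rw [shiftedGreen, indicator_of_notMem hm, norm_zero]
    refine mul_nonneg (by positivity) (indicator_nonneg (fun _ _ => by positivity) _)

theorem integrable_indicator_inv_norm :
    Integrable ((ball (0 : ℂ) 2).indicator fun p : ℂ => ‖p‖⁻¹) :=
  (integrableOn_inv_norm_ball 2).integrable_indicator measurableSet_ball

theorem exists_greenPotential_le (hν : ContinuousOn ν (closedBall (0 : ℂ) 1)) :
    ∃ C, 0 ≤ C ∧ ∀ z : ℂ, ‖z‖ < 1 → greenPotential ν z ≤ C * √(1 - normSq z) := by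
  obtain ⟨C, hC⟩ := (isCompact_closedBall (0 : ℂ) 1).exists_bound_of_continuousOn hν
  have hC0 : 0 ≤ C := (norm_nonneg _).trans (hC 0 (mem_closedBall_self zero_le_one))
  refine ⟨2 * C * ∫ p, (ball (0 : ℂ) 2).indicator (fun p : ℂ => ‖p‖⁻¹) p,
    mul_nonneg (by positivity) (integral_nonneg (indicator_nonneg fun _ _ => by positivity)),
    fun z hz => ?_⟩
  rw [greenPotential_eq_integral_shiftedGreen]
  refine (Real.le_norm_self _).trans ((norm_integral_le_of_norm_le
    (integrable_indicator_inv_norm.const_mul (2 * C * √(1 - normSq z))) ?_).trans_eq ?_)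
  · filter_upwards [Measure.ae_ne volume (0 : ℂ)] with p hp
    exact norm_shiftedGreen_le hC hz hp
  · rw [integral_const_mul]
    ring

theorem continuousAt_shiftedGreen (hν : ContinuousOn ν (closedBall (0 : ℂ) 1)) {p : ℂ}
    (hz : ‖z‖ < 1) (hne : ‖z - p‖ ≠ 1) :
    ContinuousAt (fun w => shiftedGreen ν w p) z := by
  have hs : Continuous fun w : ℂ => w - p := by fun_prop
  rcases hne.lt_or_gt with h | h
  · have hev : (fun w => shiftedGreen ν w p) =ᶠ[nhds z]
        fun w => -greenSplit w (w - p) * ν (w - p) := by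
      filter_upwards [(isOpen_ball.preimage hs).mem_nhds (mem_ball_zero_iff.2 h)] with w hw
      rw [shiftedGreen, indicator_of_mem (show w - p ∈ ball (0 : ℂ) 1 from hw)]
    refine ContinuousAt.congr ?_ hev.symm
    have hν' : ContinuousAt ν (z - p) := hν.continuousAt
      (Filter.mem_of_superset (isOpen_ball.mem_nhds (mem_ball_zero_iff.2 h)) ball_subset_closedBall)
    refine ContinuousAt.mul ?_ (ContinuousAt.comp (f := fun w => w - p) hν' hs.continuousAt)
    simp only [greenSplit, sub_sub_cancel]
    have hcn : ContinuousAt (fun w : ℂ => normSq (1 - conj w * (w - p))) z :=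
      (continuous_normSq.comp (by fun_prop)).continuousAt
    exact (continuousAt_const.sub (hcn.log
      (normSq_pos.2 (one_sub_conj_mul_ne_zero hz h.le)).ne')).neg
  · have hev : (fun w => shiftedGreen ν w p) =ᶠ[nhds z] fun _ => 0 := by
      filter_upwards [(isClosed_closedBall.isOpen_compl.preimage hs).mem_nhds
        (show z - p ∈ (closedBall (0 : ℂ) 1)ᶜ by simpa using h)] with w hw
      rw [shiftedGreen, indicator_of_notMem]
      exact fun h' => hw (ball_subset_closedBall h')
    exact continuousAt_const.congr hev.symm

theorem continuousOn_greenPotential (hν : ContinuousOn ν (closedBall (0 : ℂ) 1)) :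
    ContinuousOn (greenPotential ν) (ball 0 1) := by
  obtain ⟨C, hC⟩ := (isCompact_closedBall (0 : ℂ) 1).exists_bound_of_continuousOn hν
  have hC0 : 0 ≤ C := (norm_nonneg _).trans (hC 0 (mem_closedBall_self zero_le_one))
  have e : greenPotential ν = fun z => ∫ p, shiftedGreen ν z p :=
    funext (greenPotential_eq_integral_shiftedGreen ν)
  rw [e]
  intro z hz
  refine ContinuousAt.continuousWithinAt ?_
  refine continuousAt_of_dominated (bound := fun p =>
    2 * C * (ball (0 : ℂ) 2).indicator (fun p : ℂ => ‖p‖⁻¹) p) ?_ ?_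
    (integrable_indicator_inv_norm.const_mul _) ?_
  · refine Filter.Eventually.of_forall fun w => ?_
    have h : AEStronglyMeasurable
        ((ball (0 : ℂ) 1).indicator (fun ζ => -greenSplit w ζ * ν ζ)) volume := by
      rw [aestronglyMeasurable_indicator_iff measurableSet_ball]
      exact (measurable_greenSplit.comp measurable_prodMk_left).neg.aestronglyMeasurable.mul
        ((hν.mono ball_subset_closedBall).aestronglyMeasurable measurableSet_ball)
    exact h.comp_measurePreserving (Measure.measurePreserving_sub_left volume w)
  · filter_upwards [isOpen_ball.mem_nhds hz] with w hw
    filter_upwards [Measure.ae_ne volume (0 : ℂ)] with p hp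
    refine (norm_shiftedGreen_le hC (mem_ball_zero_iff.1 hw) hp).trans ?_
    refine mul_le_mul_of_nonneg_right (mul_le_of_le_one_right (by positivity) ?_)
      (indicator_nonneg (fun _ _ => by positivity) _)
    exact Real.sqrt_le_one.2 (sub_le_self _ (normSq_nonneg _))
  · have hsph : ∀ᵐ p ∂(volume : Measure ℂ), p ∉ sphere z 1 :=
      measure_eq_zero_iff_ae_notMem.1 (Measure.addHaar_sphere volume z 1)
    filter_upwards [hsph] with p hps
    refine continuousAt_shiftedGreen hν (mem_ball_zero_iff.1 hz) fun h => hps ?_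
    rw [mem_sphere_iff_norm, norm_sub_rev, h]

end potential

section poisson

open InnerProductSpace Real

variable {z : ℂ} {ν : ℂ → ℝ}

theorem harmKernel_eq_re (z ζ : ℂ) : harmKernel z ζ =
    (((1 - normSq z : ℝ) : ℂ) * (2 * (1 - conj z * ζ)⁻¹ - 1 +
      ((1 - normSq z : ℝ) : ℂ) * (((1 - conj z * ζ)⁻¹) ^ 2 - 1 / 2))).re := by
  have hA : (1 - z * conj z : ℂ) = ((1 - normSq z : ℝ) : ℂ) := by
    push_cast
    rw [mul_conj]
  have hw : (1 - z * conj ζ)⁻¹ = conj ((1 - conj z * ζ)⁻¹) := by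
    simp [map_inv₀]
  rw [harmKernel, harmPolar, hA, hw]
  generalize (1 - conj z * ζ)⁻¹ = v
  simp [pow_two, -mul_eq_mul_left_iff]
  ring

theorem harmonicOnNhd_harmKernel (hz : ‖z‖ < 1) :
    HarmonicOnNhd (harmKernel z) (closedBall 0 1) := by
  intro ζ hζ
  have h1 := one_sub_conj_mul_ne_zero hz (mem_closedBall_zero_iff.1 hζ)
  have hv : AnalyticAt ℂ (fun ζ => (1 - conj z * ζ)⁻¹) ζ :=
    (analyticAt_const.sub (analyticAt_const.mul analyticAt_id)).inv h1
  have hF : AnalyticAt ℂ (fun ζ => ((1 - normSq z : ℝ) : ℂ) * (2 * (1 - conj z * ζ)⁻¹ - 1 +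
      ((1 - normSq z : ℝ) : ℂ) * (((1 - conj z * ζ)⁻¹) ^ 2 - 1 / 2))) ζ := by
    fun_prop
  have e : harmKernel z = fun ζ => (((1 - normSq z : ℝ) : ℂ) * (2 * (1 - conj z * ζ)⁻¹ - 1 +
      ((1 - normSq z : ℝ) : ℂ) * (((1 - conj z * ζ)⁻¹) ^ 2 - 1 / 2))).re :=
    funext (harmKernel_eq_re z)
  rw [e]
  exact hF.harmonicAt_re

theorem circleAverage_harmKernel (hz : ‖z‖ < 1) :
    circleAverage (harmKernel z) 0 1 = harmKernel z 0 := by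
  have h := harmonicOnNhd_harmKernel hz
  exact InnerProductSpace.HarmonicOnNhd.circleAverage_eq (by simpa using h)

theorem circleAverage_poisson_harmKernel (hz : ‖z‖ < 1) {w : ℂ} (hw : ‖w‖ < 1) :
    circleAverage (fun η => harmKernel z η / normSq (η - w)) 0 1 =
      harmKernel z w / (1 - normSq w) := by
  rw [← (harmonicOnNhd_harmKernel hz).circleAverage_poissonKernel_smul (mem_ball_zero_iff.2 hw),
    div_eq_inv_mul, ← smul_eq_mul, ← circleAverage_fun_smul]
  refine circleAverage_congr_sphere fun η hη => ?_
  rw [abs_one, mem_sphere_zero_iff_norm] at hη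
  have := (sub_pos.2 (normSq_lt_one hw)).ne'
  simp only [Pi.smul_apply', smul_eq_mul, poissonKernel, sub_zero, hη, normSq_eq_norm_sq] at this ⊢
  field_simp

theorem integral_le_div_normSq (hz : ‖z‖ < 1) (h0 : z ≠ 0) {t : ℝ} (ht : 0 ≤ t)
    (hν : ContinuousOn ν (closedBall (0 : ℂ) 1)) (hpos : ∀ ζ ∈ closedBall (0 : ℂ) 1, 0 < ν ζ)
    (h : greenPotential ν z ≤ t * -Real.log (normSq z)) :
    ∫ ζ in ball (0 : ℂ) 1, (1 - normSq ζ) / normSq (1 - conj z * ζ) * ν ζ ≤ t / normSq z := by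
  have hA := sub_pos.2 (normSq_lt_one hz)
  have hN := normSq_pos.2 h0
  have hc : ContinuousOn (fun ζ => (1 - normSq ζ) / normSq (1 - conj z * ζ)) (closedBall 0 1) := by
    have hn := continuous_normSq
    refine ContinuousOn.div (by fun_prop) (hn.comp (by fun_prop)).continuousOn fun ζ hζ => ?_
    exact (normSq_pos.2 (one_sub_conj_mul_ne_zero hz (mem_closedBall_zero_iff.1 hζ))).ne'
  have hle : (1 - normSq z) *
      ∫ ζ in ball (0 : ℂ) 1, (1 - normSq ζ) / normSq (1 - conj z * ζ) * ν ζ ≤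
      greenPotential ν z := by
    rw [← integral_const_mul]
    refine integral_mono_ae ?_
      (integrableOn_mul_of_continuousOn (integrableOn_greenSplit hz).neg hν) ?_
    · exact (((hc.mul hν).integrableOn_compact (isCompact_closedBall 0 1)).mono_set
        ball_subset_closedBall).const_mul _
    · filter_upwards [ae_ball_ne z] with ζ ⟨hζ, hne⟩
      have := mul_le_mul_of_nonneg_right (le_neg_greenSplit hz hζ hne)
        (hpos ζ (mem_closedBall_zero_iff.2 hζ.le)).le
      calc _ = (1 - normSq z) * (1 - normSq ζ) / normSq (1 - conj z * ζ) * ν ζ := by ring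
        _ ≤ _ := this
  have hlog : -Real.log (normSq z) ≤ (1 - normSq z) / normSq z := by
    rw [← Real.log_inv]
    refine (Real.log_le_sub_one_of_pos (inv_pos.2 hN)).trans_eq ?_
    field_simp
  rw [← mul_le_mul_iff_right₀ hA]
  calc _ ≤ t * -Real.log (normSq z) := hle.trans h
    _ ≤ t * ((1 - normSq z) / normSq z) := mul_le_mul_of_nonneg_left hlog ht
    _ = _ := by ring

end poisson

section poisson

open Real

variable {z : ℂ} {ν : ℂ → ℝ}

theorem setIntegral_circleMap_eq (f : ℂ → ℝ) :
    ∫ θ in Ioc 0 (2 * π), f (circleMap 0 1 θ) = 2 * π * circleAverage f 0 1 := by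
  rw [circleAverage_def, intervalIntegral.integral_of_le two_pi_pos.le, smul_eq_mul,
    mul_inv_cancel_left₀ two_pi_pos.ne']

theorem normSq_one_sub_conj_smul {η : ℂ} (hη : ‖η‖ = 1) (r : ℝ) (ζ : ℂ) :
    normSq (1 - conj (r • η) * ζ) = normSq (η - r • ζ) := by
  have h1 : conj η * η = 1 := by
    rw [← normSq_eq_conj_mul_self, normSq_eq_norm_sq, hη]
    simp
  have h2 : (1 - conj (r • η) * ζ) = conj η * (η - r • ζ) := by
    rw [mul_sub, h1]
    simp only [real_smul, map_mul, conj_ofReal]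
    ring
  rw [h2, map_mul, normSq_conj, normSq_eq_norm_sq η, hη]
  simp

theorem integral_harmKernel_smul_le (hz : ‖z‖ < 1) {t r : ℝ} (ht : 0 ≤ t) (hr : r ∈ Ioo (0 : ℝ) 1)
    (hν : ContinuousOn ν (closedBall (0 : ℂ) 1)) (hpos : ∀ ζ ∈ closedBall (0 : ℂ) 1, 0 < ν ζ)
    (h : ∀ z, ‖z‖ < 1 → z ≠ 0 → greenPotential ν z ≤ t * -Real.log (normSq z)) :
    ∫ ζ in ball (0 : ℂ) 1, harmKernel z (r • ζ) * ((1 - normSq ζ) / (1 - normSq (r • ζ))) * ν ζ ≤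
      t / r ^ 2 * harmKernel z 0 := by
  have hrn (ζ : ℂ) (hζ : ‖ζ‖ ≤ 1) : ‖r • ζ‖ < 1 := by
    rw [norm_smul, Real.norm_eq_abs, abs_of_pos hr.1]
    nlinarith [hr.1, hr.2, norm_nonneg ζ]
  have hη (θ : ℝ) : ‖circleMap 0 1 θ‖ = 1 := by simp
  set Φ : ℝ → ℂ → ℝ := fun θ ζ => harmKernel z (circleMap 0 1 θ) *
    ((1 - normSq ζ) / normSq (circleMap 0 1 θ - r • ζ) * ν ζ) with hΦ
  have hcont : ContinuousOn (Function.uncurry Φ) (Icc 0 (2 * π) ×ˢ closedBall 0 1) := by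
    have hn := continuous_normSq
    have hm := continuous_circleMap 0 1
    have h1 : Continuous fun p : ℝ × ℂ => harmKernel z (circleMap 0 1 p.1) :=
      ((continuousOn_harmKernel hz).comp_continuous hm fun θ =>
        mem_closedBall_zero_iff.2 (hη θ).le).comp continuous_fst
    have h2 : Continuous fun p : ℝ × ℂ => normSq (circleMap 0 1 p.1 - r • p.2) :=
      hn.comp ((hm.comp continuous_fst).sub (continuous_snd.const_smul r))
    refine h1.continuousOn.mul (ContinuousOn.mul (ContinuousOn.div (by fun_prop) h2.continuousOn
      fun p hp => ?_) (hν.comp continuousOn_snd fun p hp => hp.2))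
    refine (normSq_pos.2 (sub_ne_zero.2 fun e => ?_)).ne'
    have := hrn p.2 (mem_closedBall_zero_iff.1 hp.2)
    rw [← e, hη] at this
    exact this.false
  have hint : Integrable (Function.uncurry Φ)
      ((volume.restrict (Ioc 0 (2 * π))).prod (volume.restrict (ball 0 1))) := by
    rw [Measure.prod_restrict]
    exact (hcont.integrableOn_compact (isCompact_Icc.prod (isCompact_closedBall 0 1))).mono_set
      (prod_mono Ioc_subset_Icc_self ball_subset_closedBall)
  have hswap := integral_integral_swap hint
  have hr2 : 0 < r ^ 2 := pow_pos hr.1 2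
  have hle : ∫ θ in Ioc 0 (2 * π), ∫ ζ in ball (0 : ℂ) 1, Φ θ ζ ≤
      ∫ θ in Ioc 0 (2 * π), t / r ^ 2 * harmKernel z (circleMap 0 1 θ) := by
    refine integral_mono hint.integral_prod_left ?_ fun θ => ?_
    · refine (Continuous.integrableOn_Ioc ?_)
      exact continuous_const.mul ((continuousOn_harmKernel hz).comp_continuous
        (continuous_circleMap 0 1) fun θ => mem_closedBall_zero_iff.2 (hη θ).le)
    · have hrη : ‖r • circleMap 0 1 θ‖ < 1 := hrn _ (hη θ).le
      have hne : r • circleMap 0 1 θ ≠ 0 := smul_ne_zero hr.1.ne' (by simp)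
      have hb := integral_le_div_normSq hrη hne ht hν hpos (h _ hrη hne)
      simp only [normSq_one_sub_conj_smul (hη θ)] at hb
      have e : normSq (r • circleMap 0 1 θ) = r ^ 2 := by
        rw [normSq_eq_norm_sq, norm_smul, hη, mul_one, Real.norm_eq_abs, sq_abs]
      rw [e] at hb
      simp only [hΦ]
      rw [integral_const_mul, mul_comm (t / r ^ 2)]
      exact mul_le_mul_of_nonneg_left hb (harmKernel_nonneg hz (hη θ))
  rw [hswap, integral_const_mul, setIntegral_circleMap_eq, circleAverage_harmKernel hz] at hle
  have hinner (ζ : ℂ) (hζ : ζ ∈ ball (0 : ℂ) 1) : ∫ θ in Ioc 0 (2 * π), Φ θ ζ =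
      2 * π * (harmKernel z (r • ζ) * ((1 - normSq ζ) / (1 - normSq (r • ζ))) * ν ζ) := by
    have hp := circleAverage_poisson_harmKernel hz (hrn ζ (mem_ball_zero_iff.1 hζ).le)
    have e (θ : ℝ) : Φ θ ζ = ((1 - normSq ζ) * ν ζ) *
        (harmKernel z (circleMap 0 1 θ) / normSq (circleMap 0 1 θ - r • ζ)) := by
      simp only [hΦ]
      ring
    simp only [e]
    rw [integral_const_mul, setIntegral_circleMap_eq
      (fun η => harmKernel z η / normSq (η - r • ζ)), hp]
    ring
  rw [setIntegral_congr_fun measurableSet_ball hinner, integral_const_mul] at hle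
  refine le_of_mul_le_mul_left (hle.trans_eq ?_) two_pi_pos
  ring

theorem integral_harmKernel_le (hz : ‖z‖ < 1) {t : ℝ} (ht : 0 ≤ t)
    (hν : ContinuousOn ν (closedBall (0 : ℂ) 1)) (hpos : ∀ ζ ∈ closedBall (0 : ℂ) 1, 0 < ν ζ)
    (h : ∀ z, ‖z‖ < 1 → z ≠ 0 → greenPotential ν z ≤ t * -Real.log (normSq z)) :
    ∫ ζ in ball (0 : ℂ) 1, harmKernel z ζ * ν ζ ≤ t * harmKernel z 0 := by
  have hstep (n : ℕ) := integral_harmKernel_smul_le hz ht (one_sub_inv_mem n) hν hpos h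
  have hH := continuousOn_harmKernel hz
  have hmem (n : ℕ) (ζ : ℂ) (hζ : ζ ∈ ball (0 : ℂ) 1) :
      ‖(1 - 1 / ((n : ℝ) + 2)) • ζ‖ ≤ ‖ζ‖ := by
    rw [norm_smul, Real.norm_eq_abs, abs_of_pos (one_sub_inv_mem n).1]
    exact mul_le_of_le_one_left (norm_nonneg ζ) (one_sub_inv_mem n).2.le
  have hmem' (n : ℕ) (ζ : ℂ) (hζ : ζ ∈ ball (0 : ℂ) 1) :
      (1 - 1 / ((n : ℝ) + 2)) • ζ ∈ ball (0 : ℂ) 1 :=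
    mem_ball_zero_iff.2 ((hmem n ζ hζ).trans_lt (mem_ball_zero_iff.1 hζ))
  obtain ⟨C, hC⟩ := (isCompact_closedBall (0 : ℂ) 1).exists_bound_of_continuousOn hH
  refine le_of_tendsto_of_tendsto' (b := Filter.atTop) ?_ ?_ hstep
  · refine tendsto_integral_of_dominated_convergence (fun ζ => C * ‖ν ζ‖) (fun n => ?_) ?_
      (fun n => ?_) ?_
    · refine ContinuousOn.aestronglyMeasurable ?_ measurableSet_ball
      have hn := continuous_normSq
      have hs : Continuous fun ζ : ℂ => (1 - 1 / ((n : ℝ) + 2)) • ζ := continuous_const_smul _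
      refine ((hH.comp hs.continuousOn fun ζ hζ => ball_subset_closedBall (hmem' n ζ hζ)).mul
        (ContinuousOn.div (by fun_prop) (continuous_const.sub (hn.comp hs)).continuousOn
          fun ζ hζ => ?_)).mul (hν.mono ball_subset_closedBall)
      exact (sub_pos.2 (normSq_lt_one (mem_ball_zero_iff.1 (hmem' n ζ hζ)))).ne'
    · exact ((hν.norm.integrableOn_compact (isCompact_closedBall 0 1)).mono_set
        ball_subset_closedBall).const_mul C
    · filter_upwards [ae_restrict_mem measurableSet_ball] with ζ hζ
      have h1 := sub_pos.2 (normSq_lt_one (mem_ball_zero_iff.1 (hmem' n ζ hζ)))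
      have h2 := sub_pos.2 (normSq_lt_one (mem_ball_zero_iff.1 hζ))
      rw [norm_mul, norm_mul, Real.norm_of_nonneg (div_pos h2 h1).le]
      refine mul_le_mul_of_nonneg_right ?_ (norm_nonneg _)
      have hle : (1 - normSq ζ) / (1 - normSq ((1 - 1 / ((n : ℝ) + 2)) • ζ)) ≤ 1 := by
        rw [div_le_one h1, normSq_eq_norm_sq, normSq_eq_norm_sq]
        linarith [pow_le_pow_left₀ (norm_nonneg _) (hmem n ζ hζ) 2]
      calc _ ≤ C * 1 := mul_le_mul (hC _ (ball_subset_closedBall (hmem' n ζ hζ))) hle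
            (div_pos h2 h1).le ((norm_nonneg _).trans (hC 0 (mem_closedBall_self zero_le_one)))
        _ = C := mul_one C
    · filter_upwards [ae_restrict_mem measurableSet_ball] with ζ hζ
      have h2 := sub_pos.2 (normSq_lt_one (mem_ball_zero_iff.1 hζ))
      refine Filter.Tendsto.mul_const _ ?_
      have e : harmKernel z ζ = harmKernel z ((1 : ℝ) • ζ) *
          ((1 - normSq ζ) / (1 - normSq ((1 : ℝ) • ζ))) := by
        rw [one_smul, div_self h2.ne', mul_one]
      rw [e]
      have hs := tendsto_one_sub_inv.smul_const ζ
      refine Filter.Tendsto.mul ?_ (Filter.Tendsto.div tendsto_const_nhds ?_ ?_)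
      · have hc : ContinuousAt (harmKernel z) ((1 : ℝ) • ζ) := by
          rw [one_smul]
          exact hH.continuousAt (Filter.mem_of_superset (isOpen_ball.mem_nhds hζ)
            ball_subset_closedBall)
        exact hc.tendsto.comp hs
      · exact ((continuous_normSq.tendsto _).comp hs).const_sub 1
      · rw [one_smul]
        exact h2.ne'
  · have h1 := ((tendsto_const_nhds (x := t)).div (tendsto_one_sub_inv.pow 2)
      (by norm_num)).mul_const (harmKernel z 0)
    simpa using h1

/-- A bound `-∫ G(z,ζ)ν(ζ) ≤ -t log|z|²` on the punctured disk self-improves. -/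
theorem greenPotential_le (hz : ‖z‖ < 1) {t : ℝ} (ht : 0 ≤ t)
    (hν : ContDiffOn ℝ (⊤ : ℕ∞) ν (closedBall (0 : ℂ) 1))
    (hpos : ∀ ζ ∈ closedBall (0 : ℂ) 1, 0 < ν ζ)
    (hsub : ∀ z ∈ ball (0 : ℂ) 1, 0 ≤ lap (fun w => ν w / (1 - normSq w)) z)
    (h : ∀ z, ‖z‖ < 1 → z ≠ 0 → greenPotential ν z ≤ t * -Real.log (normSq z)) :
    greenPotential ν z ≤ t * (3 / 2 - 2 * normSq z + normSq z ^ 2 / 2) := by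
  rw [← harmKernel_zero_right]
  exact (greenPotential_le_integral_harmKernel hz hν hsub).trans
    (integral_harmKernel_le hz ht hν.continuousOn hpos h)

end poisson

section submean

open Real

theorem setIntegral_ball_rotation (f : ℂ → ℝ) (r θ : ℝ) :
    ∫ w in ball (0 : ℂ) r, f (circleMap 0 1 θ * w) = ∫ w in ball (0 : ℂ) r, f w := by
  have hm := (rotation (Circle.exp θ)).measurePreserving
  have he := (rotation (Circle.exp θ)).toHomeomorph.measurableEmbedding
  have h := hm.setIntegral_preimage_emb he f (ball 0 r)
  have hpre : rotation (Circle.exp θ) ⁻¹' ball 0 r = ball 0 r := by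
    ext w
    rw [mem_preimage, mem_ball_zero_iff, LinearIsometryEquiv.norm_map, mem_ball_zero_iff]
  rw [hpre] at h
  rw [← h]
  congr 1 with w
  rw [rotation_apply, Circle.coe_exp, circleMap_zero]
  simp

/-- The sub-mean-value inequality on circles implies the one on disks. -/
theorem le_setAverage_of_le_circleAverage {f : ℂ → ℝ} (hf : Continuous f) {z : ℂ} {r : ℝ}
    (hr : 0 < r) (h : ∀ᵐ w : ℂ, f z ≤ circleAverage (fun η => f (z + η * w)) 0 1) :
    f z ≤ ⨍ w in ball z r, f w := by
  have hm := continuous_circleMap 0 1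
  have hint : Integrable (Function.uncurry fun (θ : ℝ) (w : ℂ) => f (z + circleMap 0 1 θ * w))
      ((volume.restrict (Ioc 0 (2 * π))).prod (volume.restrict (ball 0 r))) := by
    have hc : Continuous
        (Function.uncurry fun (θ : ℝ) (w : ℂ) => f (z + circleMap 0 1 θ * w)) :=
      hf.comp (continuous_const.add ((hm.comp continuous_fst).mul continuous_snd))
    rw [Measure.prod_restrict]
    exact (hc.continuousOn.integrableOn_compact
      (isCompact_Icc.prod (isCompact_closedBall 0 r))).mono_set
      (prod_mono Ioc_subset_Icc_self ball_subset_closedBall)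
  have hswap := integral_integral_swap hint
  have hshift : ∫ w in ball (0 : ℂ) r, f (z + w) = ∫ w in ball z r, f w := by
    have h1 := (measurePreserving_add_left volume z).setIntegral_preimage_emb
      (measurableEmbedding_addLeft z) f (ball z r)
    rw [← h1]
    congr 2
    ext w
    simp
  simp only [setIntegral_ball_rotation (fun w => f (z + w)), hshift] at hswap
  have hle : volume.real (ball (0 : ℂ) r) * (2 * π * f z) ≤ 2 * π * ∫ w in ball z r, f w := by
    have e : ∫ _ in Ioc 0 (2 * π), ∫ w in ball z r, f w = 2 * π * ∫ w in ball z r, f w := by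
      simp [two_pi_pos.le]
    rw [← e, hswap]
    have e2 : volume.real (ball (0 : ℂ) r) * (2 * π * f z) =
        ∫ _ in ball (0 : ℂ) r, 2 * π * f z := by
      rw [setIntegral_const, smul_eq_mul]
    rw [e2]
    refine integral_mono_ae (integrableOn_const measure_ball_lt_top.ne) hint.integral_prod_right ?_
    filter_upwards [ae_restrict_of_ae h] with w hw
    rw [setIntegral_circleMap_eq fun η => f (z + η * w)]
    exact mul_le_mul_of_nonneg_left hw two_pi_pos.le
  have hV : 0 < volume.real (ball z r) :=
    ENNReal.toReal_pos (measure_ball_pos volume z hr).ne' measure_ball_lt_top.ne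
  have hVe : volume.real (ball (0 : ℂ) r) = volume.real (ball z r) := by
    simp only [measureReal_def, Complex.volume_ball]
  rw [hVe] at hle
  rw [setAverage_eq, smul_eq_mul, inv_mul_eq_div, le_div_iff₀ hV]
  refine le_of_mul_le_mul_left ?_ two_pi_pos
  linarith

theorem continuous_log_max {δ : ℝ} (hδ : 0 < δ) :
    Continuous fun w : ℂ => Real.log (max (normSq w) δ) :=
  (continuous_normSq.max continuous_const).log fun _ => (lt_max_of_lt_right hδ).ne'

theorem log_max_le_circleAverage {δ : ℝ} (hδ : 0 < δ) {z w : ℂ} (hw : w ≠ 0) (hne : ‖w‖ ≠ ‖z‖) :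
    Real.log (max (normSq z) δ) ≤
      circleAverage (fun η => Real.log (max (normSq (z + η * w)) δ)) 0 1 := by
  have hcont : Continuous fun η => Real.log (max (normSq (z + η * w)) δ) :=
    (continuous_log_max hδ).comp (by fun_prop)
  have hci : CircleIntegrable (fun η => Real.log (max (normSq (z + η * w)) δ)) 0 1 :=
    hcont.continuousOn.circleIntegrable'
  rcases le_total (normSq z) δ with h | h
  · rw [max_eq_right h, ← circleAverage_const (Real.log δ) (0 : ℂ) 1]
    refine circleAverage_mono (circleIntegrable_const _ _ _) hci fun η _ => ?_
    exact Real.log_le_log hδ (le_max_right _ _)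
  · rw [max_eq_left h]
    have hz : z ≠ 0 := normSq_pos.1 (hδ.trans_le h)
    have ha : CircleIntegrable (fun η => Real.log ‖η + z / w‖) 0 1 := by
      have := circleIntegrable_log_norm_sub_const (a := -(z / w)) (c := 0) 1
      simpa using this
    have hav := circleAverage_log_norm_add_const_eq_posLog (a := z / w)
    have hmono : circleAverage (fun η => 2 * Real.log ‖w‖ + 2 * Real.log ‖η + z / w‖) 0 1 ≤
        circleAverage (fun η => Real.log (max (normSq (z + η * w)) δ)) 0 1 := by
      refine circleAverage_mono ((circleIntegrable_const _ _ _).add (ha.const_smul (a := (2 : ℝ))))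
        hci fun η hη => ?_
      rw [abs_one, mem_sphere_zero_iff_norm] at hη
      have h0 : z + η * w ≠ 0 := fun h0 => hne <| by
        rw [eq_neg_of_add_eq_zero_left h0, norm_neg, norm_mul, hη, one_mul]
      have e : z + η * w = w * (η + z / w) := by
        field_simp
        ring
      have hn : η + z / w ≠ 0 := fun h => h0 (by rw [e, h, mul_zero])
      calc _ = Real.log (normSq (z + η * w)) := by
            rw [normSq_eq_norm_sq, e, norm_mul, Real.log_pow,
              Real.log_mul (norm_ne_zero_iff.2 hw) (norm_ne_zero_iff.2 hn)]
            push_cast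
            ring
        _ ≤ _ := Real.log_le_log (normSq_pos.2 h0) (le_max_left _ _)
    refine le_trans ?_ hmono
    have e : circleAverage (fun η => 2 * Real.log ‖w‖ + 2 * Real.log ‖η + z / w‖) 0 1 =
        2 * Real.log ‖w‖ + 2 * log⁺ ‖z / w‖ := by
      have h2 : CircleIntegrable (fun η => 2 * Real.log ‖η + z / w‖) 0 1 :=
        ha.const_smul (a := (2 : ℝ))
      rw [circleAverage_fun_add (circleIntegrable_const _ _ _) h2, circleAverage_const, ← hav]
      congr 1
      exact circleAverage_smul (a := (2 : ℝ)) (f := fun η => Real.log ‖η + z / w‖)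
    rw [e, normSq_eq_norm_sq, Real.log_pow]
    have hl : Real.log ‖z‖ = Real.log ‖w‖ + Real.log ‖z / w‖ := by
      rw [← Real.log_mul (norm_ne_zero_iff.2 hw) (norm_ne_zero_iff.2 (div_ne_zero hz hw)),
        ← norm_mul, mul_div_cancel₀ _ hw]
    have : Real.log ‖z / w‖ ≤ log⁺ ‖z / w‖ := le_max_right _ _
    push_cast
    linarith

theorem superharmonicOn_sub_log_max {δ c : ℝ} (hδ : 0 < δ) (hc : 0 ≤ c) (M : ℝ) (U : Set ℂ) :
    SuperharmonicOn (fun w => M - c * Real.log (max (normSq w) δ)) U := by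
  have hf := continuous_log_max hδ
  have hs : Continuous fun w : ℂ => M - c * Real.log (max (normSq w) δ) := by fun_prop
  refine ⟨hs.lowerSemicontinuous.lowerSemicontinuousOn _, fun z _ r hr _ => ?_⟩
  have hsph : ∀ᵐ w ∂(volume : Measure ℂ), w ∉ sphere (0 : ℂ) ‖z‖ :=
    measure_eq_zero_iff_ae_notMem.1 (Measure.addHaar_sphere volume 0 ‖z‖)
  have hle := le_setAverage_of_le_circleAverage hf (z := z) hr <| by
    filter_upwards [Measure.ae_ne volume (0 : ℂ), hsph] with w hw hw'
    exact log_max_le_circleAverage hδ hw fun h => hw' (mem_sphere_zero_iff_norm.2 h)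
  have hV : 0 < volume.real (ball z r) :=
    ENNReal.toReal_pos (measure_ball_pos volume z hr).ne' measure_ball_lt_top.ne
  have hI : IntegrableOn (fun w : ℂ => Real.log (max (normSq w) δ)) (ball z r) :=
    (hf.continuousOn.integrableOn_compact (isCompact_closedBall z r)).mono_set
      ball_subset_closedBall
  rw [setAverage_eq, smul_eq_mul] at hle ⊢
  have hM : IntegrableOn (fun _ : ℂ => M) (ball z r) := integrableOn_const measure_ball_lt_top.ne
  rw [integral_sub hM (hI.const_mul c),
    integral_const_mul, setIntegral_const, smul_eq_mul, mul_sub, inv_mul_cancel_left₀ hV.ne']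
  nlinarith [mul_le_mul_of_nonneg_left hle hc]

end submean

section obstacle

theorem log_normSq_neg {z : ℂ} (hz : ‖z‖ < 1) (h0 : z ≠ 0) : Real.log (normSq z) < 0 :=
  Real.log_neg (normSq_pos.2 h0) (normSq_lt_one hz)

theorem log_add_quadratic_neg {x : ℝ} (hx : 0 < x) (hx1 : x < 1) :
    Real.log x + (3 / 2 - 2 * x + x ^ 2 / 2) < 0 := by
  have hd : ∀ y ∈ interior (Icc x 1), HasDerivAt
      (fun y => Real.log y + (3 / 2 - 2 * y + y ^ 2 / 2)) (y⁻¹ + (-2 + y)) y := fun y hy => by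
    rw [interior_Icc] at hy
    have h0 : y ≠ 0 := (hx.trans hy.1).ne'
    have h2 := (((hasDerivAt_id y).const_mul 2).const_sub (3 / 2)).add
      (((hasDerivAt_id y).pow 2).div_const 2)
    refine ((Real.hasDerivAt_log h0).add h2).congr_deriv ?_
    simp
  have hmono : StrictMonoOn (fun y => Real.log y + (3 / 2 - 2 * y + y ^ 2 / 2)) (Icc x 1) := by
    refine strictMonoOn_of_deriv_pos (convex_Icc x 1) ?_ fun y hy => ?_
    · have : ∀ y ∈ Icc x 1, y ≠ 0 := fun y hy => (hx.trans_le hy.1).ne'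
      exact (continuousOn_id.log this).add (Continuous.continuousOn (by fun_prop))
    · rw [(hd y hy).deriv]
      rw [interior_Icc] at hy
      have h0 : 0 < y := hx.trans hy.1
      have : y⁻¹ + (-2 + y) = (1 - y) ^ 2 / y := by
        field_simp
        ring
      rw [this]
      exact div_pos (pow_pos (sub_pos.2 hy.2) 2) h0
  have h := hmono (left_mem_Icc.2 hx1.le) (right_mem_Icc.2 hx1.le) hx1
  norm_num at h
  linarith

/-- The minimum principle for superharmonic functions dominating `log|z|²` in the disk. -/
theorem SuperharmonicOn.nonneg_of_log_le {s : ℂ → ℝ} (hs : SuperharmonicOn s (ball 0 1))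
    (hle : ∀ z : ℂ, ‖z‖ < 1 → z ≠ 0 → Real.log (normSq z) ≤ s z) {z : ℂ} (hz : ‖z‖ < 1) :
    0 ≤ s z := by
  by_contra! hneg
  set R : ℝ := Real.exp (s z / 2) with hR
  have hR0 : 0 < R := Real.exp_pos _
  have hR1 : R < 1 := Real.exp_lt_one_iff.2 (by linarith)
  have hsub : closedBall (0 : ℂ) R ⊆ ball 0 1 := closedBall_subset_ball hR1
  have hout (w : ℂ) (hw : ‖w‖ < 1) (hwR : R < ‖w‖) : s z < s w := by
    have h0 : w ≠ 0 := norm_pos_iff.1 (hR0.trans hwR)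
    have h1 := Real.log_lt_log hR0 hwR
    rw [hR, Real.log_exp] at h1
    have h2 := hle w hw h0
    rw [normSq_eq_norm_sq, Real.log_pow] at h2
    push_cast at h2
    linarith
  have hzR : z ∈ closedBall (0 : ℂ) R := by
    rw [mem_closedBall_zero_iff]
    by_contra! h
    exact (hout z hz h).false
  have hlsc := hs.1.mono hsub
  obtain ⟨a, ha, hmin⟩ := hlsc.exists_isMinOn ⟨z, hzR⟩ (isCompact_closedBall 0 R)
  have hglob (w : ℂ) (hw : ‖w‖ < 1) : s a ≤ s w := by
    by_cases h : ‖w‖ ≤ R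
    · exact hmin (mem_closedBall_zero_iff.2 h)
    · exact (hmin hzR).trans (hout w hw (not_le.1 h)).le
  have hcpt := hlsc.isCompact_inter_preimage_Iic (isCompact_closedBall 0 R) (s a)
  obtain ⟨b, ⟨hbR, hb⟩, hmax⟩ := hcpt.exists_isMaxOn ⟨a, ha, le_refl (s a)⟩
    continuous_norm.continuousOn
  have hb1 : ‖b‖ < 1 := mem_ball_zero_iff.1 (hsub hbR)
  have hfar (w : ℂ) (hw : ‖w‖ < 1) (hbw : ‖b‖ < ‖w‖) : s a < s w := by
    by_contra! h
    have hwR : w ∈ closedBall (0 : ℂ) R := by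
      rw [mem_closedBall_zero_iff]
      by_contra! h'
      exact ((hout w hw h').trans_le (h.trans (hmin hzR))).false
    exact (hmax ⟨hwR, h⟩).not_gt hbw
  set r : ℝ := (1 - ‖b‖) / 2 with hr
  have hr0 : 0 < r := by linarith
  have hball : closedBall b r ⊆ ball 0 1 := fun w hw => by
    rw [mem_closedBall_iff_norm] at hw
    rw [mem_ball_zero_iff]
    have := norm_add_le (w - b) b
    rw [sub_add_cancel] at this
    linarith
  have hmean := (hs.2 b (hsub hbR) r hr0 hball).trans hb
  have hV : 0 < volume.real (ball b r) :=
    ENNReal.toReal_pos (measure_ball_pos volume b hr0).ne' measure_ball_lt_top.ne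
  rw [setAverage_eq, smul_eq_mul, inv_mul_eq_div, div_le_iff₀ hV] at hmean
  have hsa : s a < 0 := (hmin hzR).trans_lt hneg
  have hI : IntegrableOn s (ball b r) := by
    by_contra h
    rw [integral_undef h] at hmean
    nlinarith
  have hc : IntegrableOn (fun _ : ℂ => s a) (ball b r) := integrableOn_const measure_ball_lt_top.ne
  have hin (w : ℂ) (hw : w ∈ ball b r) : ‖w‖ < 1 :=
    mem_ball_zero_iff.1 (hball (ball_subset_closedBall hw))
  have hnonneg : 0 ≤ᵐ[volume.restrict (ball b r)] fun w => s w - s a := by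
    filter_upwards [ae_restrict_mem measurableSet_ball] with w hw
    exact sub_nonneg.2 (hglob w (hin w hw))
  have hzero : ∫ w in ball b r, (s w - s a) = 0 := by
    refine le_antisymm ?_ (integral_nonneg_of_ae hnonneg)
    rw [integral_sub hI hc, setIntegral_const, smul_eq_mul]
    linarith
  have hae := (setIntegral_eq_zero_iff_of_nonneg_ae hnonneg (hI.sub hc)).1 hzero
  rw [Filter.EventuallyEq, ae_restrict_iff' measurableSet_ball] at hae
  have hopen : IsOpen (ball b r ∩ {w : ℂ | ‖b‖ < ‖w‖}) :=
    isOpen_ball.inter (isOpen_lt continuous_const continuous_norm)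
  have hne : (ball b r ∩ {w : ℂ | ‖b‖ < ‖w‖}).Nonempty := by
    rcases eq_or_ne b 0 with rfl | hb0
    · refine ⟨((r / 2 : ℝ) : ℂ), ?_, ?_⟩
      · rw [mem_ball_zero_iff, norm_real, Real.norm_eq_abs, abs_of_pos (by linarith)]
        linarith
      · rw [mem_ofPred_eq, norm_real, Real.norm_eq_abs, abs_of_pos (by linarith), norm_zero]
        linarith
    · have hbp := norm_pos_iff.2 hb0
      have hk : 0 < r / (2 * ‖b‖) := by positivity
      refine ⟨(1 + r / (2 * ‖b‖)) • b, ?_, ?_⟩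
      · rw [mem_ball_iff_norm, add_smul, one_smul, add_sub_cancel_left, norm_smul,
          Real.norm_eq_abs, abs_of_pos hk]
        have : r / (2 * ‖b‖) * ‖b‖ = r / 2 := by field_simp
        linarith
      · rw [mem_ofPred_eq, norm_smul, Real.norm_eq_abs, abs_of_pos (by linarith)]
        nlinarith
  have hpos := hopen.measure_pos volume hne
  refine hpos.ne' (measure_eq_zero_iff_ae_notMem.2 ?_)
  filter_upwards [hae] with w hw ⟨hwb, hbw⟩
  have h1 := hfar w (hin w hwb) hbw
  have h2 : s w - s a = 0 := hw hwb
  linarith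

end obstacle

section obstacle

variable {P : ℂ → ℝ} {C : ℝ}

theorem exists_forall_mul_log_add_le (hP : ContinuousOn P (ball 0 1)) (hC : 0 ≤ C)
    (hPC : ∀ z : ℂ, ‖z‖ < 1 → P z ≤ C * √(1 - normSq z)) {t : ℝ} (ht : 1 ≤ t) {a : ℂ}
    (ha : ‖a‖ < 1) (ha0 : a ≠ 0) (hpos : 0 < t * Real.log (normSq a) + P a) :
    ∃ b : ℂ, ‖b‖ < 1 ∧ b ≠ 0 ∧ 0 < t * Real.log (normSq b) + P b ∧ ∀ w : ℂ, ‖w‖ < 1 → w ≠ 0 →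
      t * Real.log (normSq w) + P w ≤ t * Real.log (normSq b) + P b := by
  set m := t * Real.log (normSq a) + P a with hm
  set q := m / (2 * (C + 1)) with hq
  have hq0 : 0 < q := by positivity
  have hCq : C * q < m := by
    rw [hq, ← mul_div_assoc, div_lt_iff₀ (by positivity)]
    nlinarith
  have hsmall (w : ℂ) (hw : ‖w‖ < 1) (h0 : w ≠ 0) (h : normSq w < Real.exp (-C)) :
      t * Real.log (normSq w) + P w < m := by
    have h1 := Real.log_lt_log (normSq_pos.2 h0) h
    rw [Real.log_exp] at h1
    have h2 := hPC w hw
    have h3 : √(1 - normSq w) ≤ 1 := Real.sqrt_le_one.2 (sub_le_self _ (normSq_nonneg w))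
    nlinarith
  have hlarge (w : ℂ) (hw : ‖w‖ < 1) (h0 : w ≠ 0) (h : 1 - q ^ 2 < normSq w) :
      t * Real.log (normSq w) + P w < m := by
    have h1 := log_normSq_neg hw h0
    have h2 := hPC w hw
    have h3 : √(1 - normSq w) ≤ q := Real.sqrt_le_iff.2 ⟨hq0.le, by linarith⟩
    nlinarith
  set S : Set ℂ := {w | Real.exp (-C) ≤ normSq w ∧ normSq w ≤ 1 - q ^ 2} with hS
  have hSmem (w : ℂ) (hw : w ∈ S) : ‖w‖ < 1 ∧ w ≠ 0 := by
    refine ⟨?_, normSq_pos.1 ((Real.exp_pos _).trans_le hw.1)⟩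
    have h := hw.2
    rw [normSq_eq_norm_sq] at h
    have := pow_pos hq0 2
    exact lt_of_pow_lt_pow_left₀ 2 zero_le_one (by linarith)
  have hScpt : IsCompact S := by
    refine (isCompact_closedBall (0 : ℂ) 1).of_isClosed_subset ?_ fun w hw =>
      mem_closedBall_zero_iff.2 (hSmem w hw).1.le
    exact (isClosed_le continuous_const continuous_normSq).inter
      (isClosed_le continuous_normSq continuous_const)
  have haS : a ∈ S := by
    refine ⟨?_, ?_⟩
    · by_contra! h
      exact (hsmall a ha ha0 h).false
    · by_contra! h
      exact (hlarge a ha ha0 h).false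
  have hcont : ContinuousOn (fun w => t * Real.log (normSq w) + P w) S := by
    refine ContinuousOn.add (continuousOn_const.mul (continuous_normSq.continuousOn.log
      fun w hw => (normSq_pos.2 (hSmem w hw).2).ne')) (hP.mono fun w hw => ?_)
    exact mem_ball_zero_iff.2 (hSmem w hw).1
  obtain ⟨b, hb, hmax⟩ := hScpt.exists_isMaxOn ⟨a, haS⟩ hcont
  have hmb : m ≤ t * Real.log (normSq b) + P b := hmax haS
  refine ⟨b, (hSmem b hb).1, (hSmem b hb).2, hpos.trans_le hmb, fun w hw h0 => ?_⟩
  by_cases h1 : Real.exp (-C) ≤ normSq w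
  · by_cases h2 : normSq w ≤ 1 - q ^ 2
    · exact hmax ⟨h1, h2⟩
    · exact (hlarge w hw h0 (not_le.1 h2)).le.trans hmb
  · exact (hsmall w hw h0 (not_le.1 h1)).le.trans hmb

variable {s : ℂ → ℝ}

/-- Maximum points of `t log|z|² + P` at positive height are contact points of the obstacle
`log|z|² + P` with its least superharmonic majorant. -/
theorem le_of_forall_mul_log_add_le (hC : 0 ≤ C)
    (hPC : ∀ z : ℂ, ‖z‖ < 1 → P z ≤ C * √(1 - normSq z))
    (hleast : ∀ u : ℂ → ℝ, SuperharmonicOn u (ball 0 1) →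
      (∀ z : ℂ, ‖z‖ < 1 → z ≠ 0 → Real.log (normSq z) + P z ≤ u z) →
      ∀ z : ℂ, ‖z‖ < 1 → s z ≤ u z)
    {t : ℝ} (ht : 1 ≤ t) {b : ℂ} (hb : ‖b‖ < 1) (hb0 : b ≠ 0)
    (hpos : 0 < t * Real.log (normSq b) + P b)
    (hmax : ∀ w : ℂ, ‖w‖ < 1 → w ≠ 0 →
      t * Real.log (normSq w) + P w ≤ t * Real.log (normSq b) + P b) :
    s b ≤ Real.log (normSq b) + P b := by
  set δ := min (normSq b) (Real.exp (-C)) with hδ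
  have hδ0 : 0 < δ := lt_min (normSq_pos.2 hb0) (Real.exp_pos _)
  have h := hleast _ (superharmonicOn_sub_log_max hδ0 (sub_nonneg.2 ht)
    (t * Real.log (normSq b) + P b) _) (fun w hw h0 => ?_) b hb
  · simp only [max_eq_left (min_le_left (normSq b) (Real.exp (-C))), hδ] at h
    linarith
  · rcases le_total δ (normSq w) with hle | hle
    · simp only [max_eq_left hle]
      linarith [hmax w hw h0]
    · simp only [max_eq_right hle]
      have h1 : Real.log (normSq w) ≤ -C := by
        rw [Real.log_le_iff_le_exp (normSq_pos.2 h0)]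
        exact hle.trans (min_le_right _ _)
      have h2 : Real.log δ ≤ -C := by
        rw [Real.log_le_iff_le_exp hδ0]
        exact min_le_right _ _
      have h3 : √(1 - normSq w) ≤ 1 := Real.sqrt_le_one.2 (sub_le_self _ (normSq_nonneg w))
      nlinarith [hPC w hw]

theorem le_neg_log_of_isCompact (hP : ContinuousOn P (ball 0 1)) (hC : 0 ≤ C)
    (hPC : ∀ z : ℂ, ‖z‖ < 1 → P z ≤ C * √(1 - normSq z))
    (himp : ∀ t, 0 ≤ t → (∀ z : ℂ, ‖z‖ < 1 → z ≠ 0 → P z ≤ t * -Real.log (normSq z)) →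
      ∀ z : ℂ, ‖z‖ < 1 → P z ≤ t * (3 / 2 - 2 * normSq z + normSq z ^ 2 / 2))
    (hdom : ∀ z : ℂ, ‖z‖ < 1 → z ≠ 0 → Real.log (normSq z) + P z ≤ s z)
    (hleast : ∀ u : ℂ → ℝ, SuperharmonicOn u (ball 0 1) →
      (∀ z : ℂ, ‖z‖ < 1 → z ≠ 0 → Real.log (normSq z) + P z ≤ u z) →
      ∀ z : ℂ, ‖z‖ < 1 → s z ≤ u z)
    (hK : IsCompact {z : ℂ | ‖z‖ < 1 ∧ z ≠ 0 ∧ Real.log (normSq z) + P z = s z})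
    {z : ℂ} (hz : ‖z‖ < 1) (hz0 : z ≠ 0) : P z ≤ -Real.log (normSq z) := by
  set K := {z : ℂ | ‖z‖ < 1 ∧ z ≠ 0 ∧ Real.log (normSq z) + P z = s z} with hKdef
  have key (t : ℝ) (ht : 1 ≤ t) (hle : ∀ z ∈ K, P z ≤ t * -Real.log (normSq z)) (z : ℂ)
      (hz : ‖z‖ < 1) (hz0 : z ≠ 0) : P z ≤ t * -Real.log (normSq z) := by
    by_contra! h
    obtain ⟨b, hb, hb0, hpos, hmax⟩ :=
      exists_forall_mul_log_add_le hP hC hPC ht hz hz0 (by linarith)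
    have hbK : b ∈ K := ⟨hb, hb0, (hdom b hb hb0).antisymm
      (le_of_forall_mul_log_add_le hC hPC hleast ht hb hb0 hpos hmax)⟩
    linarith [hle b hbK]
  by_contra! hlt
  have hex : ∃ a ∈ K, 1 * -Real.log (normSq a) < P a := by
    by_contra! h
    linarith [key 1 le_rfl h z hz hz0]
  obtain ⟨a, haK, ha⟩ := hex
  have hLpos (w : ℂ) (hw : w ∈ K) : 0 < -Real.log (normSq w) :=
    neg_pos.2 (log_normSq_neg hw.1 hw.2.1)
  have hcont : ContinuousOn (fun w => P w / -Real.log (normSq w)) K := by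
    refine (hP.mono fun w hw => mem_ball_zero_iff.2 hw.1).div
      (continuous_normSq.continuousOn.log fun w hw => (normSq_pos.2 hw.2.1).ne').neg
      fun w hw => (hLpos w hw).ne'
  obtain ⟨b, hbK, hmax⟩ := hK.exists_isMaxOn ⟨a, haK⟩ hcont
  set t := P b / -Real.log (normSq b) with ht
  have ht1 : 1 < t := by
    refine lt_of_lt_of_le ?_ (hmax haK)
    rwa [lt_div_iff₀ (hLpos a haK)]
  have hall := key t ht1.le fun w hw => (div_le_iff₀ (hLpos w hw)).1 (hmax hw)
  have h1 := himp t (by linarith) hall b hbK.1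
  have h2 : P b = t * -Real.log (normSq b) := (div_mul_cancel₀ _ (hLpos b hbK).ne').symm
  have h3 := log_add_quadratic_neg (normSq_pos.2 hbK.2.1) (normSq_lt_one hbK.1)
  rw [h2] at h1
  have h4 := le_of_mul_le_mul_left h1 (by linarith)
  linarith

end obstacle

/-- If `ν > 0` is smooth on the closed disk with `ν/(1-|z|²)` subharmonic,
`W(z) = log|z|² - ∫_D G(z,ζ)ν(ζ) dΣ(ζ)`, and `Ŵ` is the smallest superharmonic majorant
of `W` in `D`, then compactness of the coincidence set `{W = Ŵ}` forces
`W(z) ≤ log|z|² + 3/2 - 2|z|² + |z|⁴/2 < 0` on `D \ {0}`; in particular the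
coincidence set is empty. -/
theorem statement4 (ν : ℂ → ℝ)
    (hν : ContDiffOn ℝ (⊤ : ℕ∞) ν (closedBall (0:ℂ) 1))
    (hpos : ∀ z ∈ closedBall (0:ℂ) 1, 0 < ν z)
    (hsub : ∀ z ∈ ball (0:ℂ) 1, 0 ≤ lap (fun w => ν w / (1 - normSq w)) z)
    (W : ℂ → EReal)
    (hW : ∀ z : ℂ, W z =
      logAbsSq z - ((∫ ζ in ball (0:ℂ) 1, greenG z ζ * ν ζ ∂areaM : ℝ) : EReal))
    (What : ℂ → ℝ)
    -- `Ŵ` is the smallest superharmonic majorant of `W` in the unit disk: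
    (hmaj : SuperharmonicOn What (ball (0:ℂ) 1))
    (hdom : ∀ z ∈ ball (0:ℂ) 1, W z ≤ (What z : EReal))
    (hleast : ∀ s : ℂ → ℝ, SuperharmonicOn s (ball (0:ℂ) 1) →
      (∀ z ∈ ball (0:ℂ) 1, W z ≤ (s z : EReal)) → ∀ z ∈ ball (0:ℂ) 1, What z ≤ s z)
    -- the coincidence set is a compact subset of the open unit disk:
    (hcpt : IsCompact {z ∈ ball (0:ℂ) 1 | W z = (What z : EReal)}) :
    (∀ z ∈ ball (0:ℂ) 1, z ≠ 0 →
        W z ≤ ((Real.log (normSq z) + 3/2 - 2 * normSq z + (1/2) * normSq z ^ 2 : ℝ) : EReal) ∧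
        Real.log (normSq z) + 3/2 - 2 * normSq z + (1/2) * normSq z ^ 2 < 0) ∧
      {z ∈ ball (0:ℂ) 1 | W z = (What z : EReal)} = ∅ := by
  set P : ℂ → ℝ := fun z => Real.pi⁻¹ * greenPotential ν z with hPdef
  have hpi : 0 < Real.pi⁻¹ := inv_pos.2 Real.pi_pos
  have hW0 : W 0 = ⊥ := by
    rw [hW, logAbsSq, if_pos rfl, EReal.bot_sub]
  have hW1 (z : ℂ) (hz : ‖z‖ < 1) (h0 : z ≠ 0) :
      W z = ((Real.log (normSq z) + P z : ℝ) : EReal) := by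
    rw [hW, logAbsSq, if_neg h0, integral_greenG_eq hz, ← EReal.coe_sub, sub_neg_eq_add]
  have hPnonneg (z : ℂ) (hz : ‖z‖ < 1) : 0 ≤ P z :=
    mul_nonneg hpi.le (greenPotential_nonneg hz hpos)
  obtain ⟨C, hC, hPC⟩ := exists_greenPotential_le hν.continuousOn
  have himp (t : ℝ) (ht : 0 ≤ t)
      (h : ∀ z : ℂ, ‖z‖ < 1 → z ≠ 0 → P z ≤ t * -Real.log (normSq z)) (z : ℂ) (hz : ‖z‖ < 1) :
      P z ≤ t * (3 / 2 - 2 * normSq z + normSq z ^ 2 / 2) := by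
    have := greenPotential_le hz (mul_nonneg Real.pi_pos.le ht) hν hpos hsub fun w hw h0 => by
      have := h w hw h0
      rwa [hPdef, inv_mul_le_iff₀ Real.pi_pos, ← mul_assoc] at this
    rwa [hPdef, inv_mul_le_iff₀ Real.pi_pos, ← mul_assoc]
  have hdom' (z : ℂ) (hz : ‖z‖ < 1) (h0 : z ≠ 0) : Real.log (normSq z) + P z ≤ What z := by
    have := hdom z (mem_ball_zero_iff.2 hz)
    rw [hW1 z hz h0] at this
    exact_mod_cast this
  have hset : {z ∈ ball (0 : ℂ) 1 | W z = (What z : EReal)} =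
      {z : ℂ | ‖z‖ < 1 ∧ z ≠ 0 ∧ Real.log (normSq z) + P z = What z} := by
    ext z
    constructor
    · rintro ⟨hz, h⟩
      have hz' := mem_ball_zero_iff.1 hz
      have h0 : z ≠ 0 := by
        rintro rfl
        rw [hW0] at h
        exact EReal.coe_ne_bot _ h.symm
      rw [hW1 z hz' h0] at h
      exact ⟨hz', h0, by exact_mod_cast h⟩
    · rintro ⟨hz, h0, h⟩
      exact ⟨mem_ball_zero_iff.2 hz, by rw [hW1 z hz h0, h]⟩
  have hle (z : ℂ) (hz : ‖z‖ < 1) (h0 : z ≠ 0) : P z ≤ -Real.log (normSq z) := by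
    refine le_neg_log_of_isCompact (s := What) (C := Real.pi⁻¹ * C)
      (continuousOn_const.mul (continuousOn_greenPotential hν.continuousOn))
      (mul_nonneg hpi.le hC) (fun w hw => ?_) himp hdom' (fun u hu hub w hw => ?_)
      (hset ▸ hcpt) hz h0
    · rw [mul_assoc]
      exact mul_le_mul_of_nonneg_left (hPC w hw) hpi.le
    · refine hleast u hu (fun v hv => ?_) w (mem_ball_zero_iff.2 hw)
      rcases eq_or_ne v 0 with rfl | hv0
      · rw [hW0]
        exact bot_le
      · rw [hW1 v (mem_ball_zero_iff.1 hv) hv0]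
        exact_mod_cast hub v (mem_ball_zero_iff.1 hv) hv0
  have hbound (z : ℂ) (hz : ‖z‖ < 1) := himp 1 zero_le_one (by simpa only [one_mul] using hle) z hz
  have hneg (z : ℂ) (hz : ‖z‖ < 1) (h0 : z ≠ 0) :=
    log_add_quadratic_neg (normSq_pos.2 h0) (normSq_lt_one hz)
  refine ⟨fun z hz h0 => ?_, ?_⟩
  · have hz' := mem_ball_zero_iff.1 hz
    refine ⟨?_, by linarith [hneg z hz' h0]⟩
    rw [hW1 z hz' h0]
    exact_mod_cast (by linarith [hbound z hz'] : Real.log (normSq z) + P z ≤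
      Real.log (normSq z) + 3/2 - 2 * normSq z + (1/2) * normSq z ^ 2)
  · rw [hset, eq_empty_iff_forall_notMem]
    rintro z ⟨hz, h0, h⟩
    have h1 := hmaj.nonneg_of_log_le (fun w hw hw0 =>
      (le_add_of_nonneg_right (hPnonneg w hw)).trans (hdom' w hw hw0)) hz
    linarith [hbound z hz, hneg z hz h0]
end
end

section
/- Fix α with 0 < α < +∞ and p with 0 < p < π/(π + 2α(4−π)). Let ω be a nonnegative function on the open unit disk D, integrable with respect to dΣ, such that z ↦ log(ω(z)/(1−|z|²)^{2α}) is subharmonic in D (with log 0 = −∞), and reproducing at the origin: h(0) = ∫_D h(z)ω(z) dΣ(z) for all harmonic polynomials h. Then ∫₀¹ ω(r)^p dr ≤ c_{p,α}, where c_{p,α} = (∫₀¹ [(1−r²)F(r)]^{2αp/(1−p)} dr)^{1−p} with F(r) = exp{(1−r)^{−2} ∫_{𝔻(r,1−r)} log(1/(1−|z|²)) dΣ(z)}, and c_{p,α} < +∞. -/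
open Complex MeasureTheory Metric Set ComplexConjugate
noncomputable section

/-- A harmonic polynomial: of the form `p(z) + conj (q(z))` for complex polynomials `p, q`. -/
def IsHarmonicPolynomial (h : ℂ → ℝ) : Prop :=
  ∃ p q : Polynomial ℂ, ∀ z : ℂ, (h z : ℂ) = p.eval z + conj (q.eval z)

/-- The logarithm with values in `[-∞,∞)`, sending `0` (and negative reals) to `-∞`. -/
def logE (x : ℝ) : EReal := if x ≤ 0 then ⊥ else (Real.log x : EReal)

/-- Subharmonicity on a set for `[-∞,∞)`-valued functions: upper semicontinuity together
with the sub-mean-value inequality on disks (expressed equivalently through all the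
truncations `max(f, -n)`, which are real-valued). -/
def SubharmonicOnE (f : ℂ → EReal) (U : Set ℂ) : Prop :=
  UpperSemicontinuousOn f U ∧
    ∀ z ∈ U, ∀ r : ℝ, 0 < r → closedBall z r ⊆ U → ∀ n : ℕ,
      (max (f z) ((-(n:ℝ) : ℝ) : EReal)).toReal
        ≤ ⨍ w in ball z r, (max (f w) ((-(n:ℝ) : ℝ) : EReal)).toReal

/-- `F(r) = exp{(1-r)⁻² ∫_{𝔻(r,1-r)} log(1/(1-|z|²)) dΣ(z)}`. -/
def Fkor (r : ℝ) : ℝ :=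
  Real.exp (((1 - r) ^ 2)⁻¹ *
    ∫ z in ball ((r : ℂ)) (1 - r), Real.log (1 / (1 - normSq z)) ∂areaM)

instance isAddHaarMeasure_areaM : areaM.IsAddHaarMeasure :=
  Measure.IsAddHaarMeasure.smul _ (by simp) (by simp [Real.pi_pos])

theorem areaM_real_ball (z : ℂ) {s : ℝ} (hs : 0 ≤ s) : areaM.real (ball z s) = s ^ 2 := by
  have : areaM (ball z s) = ENNReal.ofReal (s ^ 2) := by
    rw [areaM, Measure.smul_apply, Complex.volume_ball, smul_eq_mul,
      ← ENNReal.ofReal_pow hs, mul_comm, mul_assoc]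
    have : (NNReal.pi : ENNReal) = ENNReal.ofReal Real.pi := by
      rw [ENNReal.ofReal, ← NNReal.coe_real_pi, Real.toNNReal_coe]
    rw [this, ENNReal.mul_inv_cancel (by simp [Real.pi_pos]) (by simp), mul_one]
  rw [Measure.real, this, ENNReal.toReal_ofReal (sq_nonneg s)]

theorem setAverage_ball_eq (f : ℂ → ℝ) (z : ℂ) {s : ℝ} (hs : 0 ≤ s) :
    ⨍ w in ball z s, f w = (s ^ 2)⁻¹ * ∫ w in ball z s, f w ∂areaM := by
  have hπ : (ENNReal.ofReal Real.pi)⁻¹.toReal = Real.pi⁻¹ := by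
    rw [ENNReal.toReal_inv, ENNReal.toReal_ofReal Real.pi_pos.le]
  have hv : (volume : Measure ℂ).real (ball z s) = s ^ 2 * Real.pi := by
    rw [Measure.real, Complex.volume_ball]
    simp [hs]
  rw [setAverage_eq, hv, areaM, Measure.restrict_smul, integral_smul_measure, hπ, smul_eq_mul,
    smul_eq_mul, mul_inv, mul_assoc]

theorem one_sub_normSq_pos {z : ℂ} (hz : z ∈ ball (0 : ℂ) 1) : 0 < 1 - normSq z := by
  rw [mem_ball_zero_iff] at hz
  rw [normSq_eq_norm_sq]
  nlinarith [norm_nonneg z]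

theorem log_one_div_one_sub_normSq_nonneg {z : ℂ} (hz : z ∈ ball (0 : ℂ) 1) :
    0 ≤ Real.log (1 / (1 - normSq z)) := by
  have := one_sub_normSq_pos hz
  apply Real.log_nonneg
  rw [le_div_iff₀ this]
  linarith [normSq_nonneg z]

theorem integrableOn_log_one_div_one_sub_normSq :
    IntegrableOn (fun z => Real.log (1 / (1 - normSq z))) (ball (0 : ℂ) 1) areaM := by
  rw [← integrable_indicator_iff measurableSet_ball]
  let f : ℝ → ℝ := (Iio 1).indicator fun r => Real.log (1 / (1 - r ^ 2))
  have hf : (ball (0 : ℂ) 1).indicator (fun z => Real.log (1 / (1 - normSq z))) =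
      fun z => f ‖z‖ := by
    ext z
    by_cases hz : ‖z‖ < 1 <;> simp [f, indicator, hz, normSq_eq_norm_sq]
  rw [hf, integrable_fun_norm_addHaar]
  have h₁ : IntervalIntegrable (fun r : ℝ => Real.log (1 - r)) volume 0 1 := by
    simpa using ((intervalIntegral.intervalIntegrable_log' (a := 1) (b := 0)).comp_sub_left 1)
  have h₂ : IntervalIntegrable (fun r : ℝ => Real.log (1 + r)) volume 0 1 := by
    apply ContinuousOn.intervalIntegrable
    apply ContinuousOn.log (by fun_prop)
    intro x hx
    rw [uIcc_of_le zero_le_one] at hx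
    linarith [hx.1]
  have h₃ := ((h₁.add h₂).continuousOn_mul (continuous_id.continuousOn)).neg
  rw [intervalIntegrable_iff_integrableOn_Ioo_of_le zero_le_one] at h₃
  rw [← integrable_indicator_iff measurableSet_Ioo] at h₃
  rw [← integrable_indicator_iff measurableSet_Ioi]
  refine h₃.congr (.of_forall fun r => ?_)
  by_cases h0 : 0 < r
  · by_cases h1 : r < 1
    · have : 1 - r ^ 2 = (1 - r) * (1 + r) := by ring
      simp only [finrank_real_complex, indicator, mem_Ioi, h0, f, mem_Iio, h1, mem_Ioo,
        if_true, and_self, smul_eq_mul, one_div, Real.log_inv]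
      rw [this, Real.log_mul (by linarith) (by linarith)]
      simp
      ring
    · simp [indicator, f, h1]
  · simp [indicator, h0]

theorem ball_subset_unit_ball {r : ℝ} (h0 : 0 ≤ r) : ball (r : ℂ) (1 - r) ⊆ ball 0 1 := by
  apply ball_subset_ball'
  rw [dist_zero_right, Complex.norm_real, Real.norm_of_nonneg h0]
  linarith

theorem setIntegral_ball_comp_affine (f : ℂ → ℝ) (a : ℂ) {s : ℝ} (hs : 0 < s) :
    (s ^ 2)⁻¹ * ∫ z in ball a s, f z ∂areaM = ∫ w in ball (0 : ℂ) 1, f (a + s * w) ∂areaM := by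
  have h := Measure.setIntegral_comp_smul_of_pos areaM (fun w => f (a + w)) (ball 0 1) hs
  simp only [finrank_real_complex, smul_eq_mul, real_smul, smul_unitBall_of_pos hs] at h
  rw [h]
  congr 1
  have := (measurePreserving_add_left areaM a).setIntegral_preimage_emb
    (measurableEmbedding_addLeft a) f (ball a s)
  rw [← this]
  simp

theorem one_sub_sq_mul_Fkor_le {r : ℝ} (h0 : 0 ≤ r) (h1 : r < 1) :
    (1 - r ^ 2) * Fkor r ≤
      2 * Real.exp (∫ z in ball (0 : ℂ) 1, Real.log (1 / (1 - normSq z)) ∂areaM) := by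
  have hs : 0 < 1 - r := by linarith
  set K := ∫ z in ball (0 : ℂ) 1, Real.log (1 / (1 - normSq z)) ∂areaM
  have hfin : IsFiniteMeasure (areaM.restrict (ball (0 : ℂ) 1)) :=
    ⟨by simpa using measure_ball_lt_top⟩
  have hle : ∫ w in ball (0 : ℂ) 1, Real.log (1 / (1 - normSq (r + ((1 - r : ℝ) : ℂ) * w))) ∂areaM
      ≤ Real.log (1 / (1 - r)) + K := by
    have : Real.log (1 / (1 - r)) + K = ∫ w in ball (0 : ℂ) 1,
        (Real.log (1 / (1 - r)) + Real.log (1 / (1 - normSq w))) ∂areaM := by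
      rw [integral_add (integrable_const _) integrableOn_log_one_div_one_sub_normSq]
      simp [areaM_real_ball, K]
    rw [this]
    apply integral_mono_of_nonneg
    · filter_upwards [ae_restrict_mem measurableSet_ball] with w hw
      apply log_one_div_one_sub_normSq_nonneg
      apply ball_subset_unit_ball h0
      rw [mem_ball_zero_iff] at hw
      rw [mem_ball_iff_norm, add_sub_cancel_left, norm_mul, Complex.norm_real,
        Real.norm_of_nonneg hs.le]
      nlinarith
    · exact (integrable_const _).add integrableOn_log_one_div_one_sub_normSq
    · filter_upwards [ae_restrict_mem measurableSet_ball] with w hw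
      have hw' := one_sub_normSq_pos hw
      rw [← Real.log_mul (by positivity) (by positivity), div_mul_div_comm, one_mul]
      have hn : (1 - r) * (1 - normSq w) ≤ 1 - normSq (r + ((1 - r : ℝ) : ℂ) * w) := by
        have : 0 ≤ r * (1 - r) * normSq (1 - w) :=
          mul_nonneg (mul_nonneg h0 hs.le) (normSq_nonneg _)
        simp only [normSq_apply, add_re, add_im, mul_re, mul_im, ofReal_re, ofReal_im, sub_re,
          sub_im, one_re, one_im] at this ⊢
        nlinarith
      have hp : 0 < (1 - r) * (1 - normSq w) := by positivity
      exact Real.log_le_log (by have := hp.trans_le hn; positivity)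
        (one_div_le_one_div_of_le hp hn)
  have hF : Fkor r ≤ 1 / (1 - r) * Real.exp K := by
    rw [Fkor, setIntegral_ball_comp_affine _ _ hs]
    refine (Real.exp_le_exp.2 hle).trans_eq ?_
    rw [Real.exp_add, Real.exp_log (by positivity)]
  calc (1 - r ^ 2) * Fkor r ≤ (1 - r ^ 2) * (1 / (1 - r) * Real.exp K) := by
        gcongr
        nlinarith
    _ = (1 + r) * Real.exp K := by field_simp; ring
    _ ≤ 2 * Real.exp K := by gcongr; linarith

theorem measurable_Fkor : Measurable Fkor := by
  unfold Fkor
  have hm : MeasurableSet {x : ℝ × ℂ | x.2 ∈ ball (x.1 : ℂ) (1 - x.1)} := by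
    simp only [mem_ball]
    exact measurableSet_lt (by fun_prop) (by fun_prop)
  have : Measurable fun r : ℝ =>
      ∫ z in ball (r : ℂ) (1 - r), Real.log (1 / (1 - normSq z)) ∂areaM := by
    simp only [← integral_indicator measurableSet_ball]
    refine (StronglyMeasurable.integral_prod_right (f := fun (r : ℝ) (z : ℂ) =>
      (ball (r : ℂ) (1 - r)).indicator (fun z => Real.log (1 / (1 - normSq z))) z)
      (Measurable.stronglyMeasurable ?_)).measurable
    have h2 : Measurable fun x : ℝ × ℂ => Real.log (1 / (1 - normSq x.2)) := by
      simp only [normSq_eq_norm_sq]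
      fun_prop
    exact h2.indicator hm
  fun_prop

theorem le_mean_of_forall_lt {v : ℂ → ℝ} {a : ℂ} {s c : ℝ} (hs : 0 < s)
    (hv : IntegrableOn v (ball a s) areaM)
    (h : ∀ ρ, 0 < ρ → ρ < s → c ≤ (ρ ^ 2)⁻¹ * ∫ z in ball a ρ, v z ∂areaM) :
    c ≤ (s ^ 2)⁻¹ * ∫ z in ball a s, v z ∂areaM := by
  obtain ⟨u, hu, hus, hlim⟩ := exists_seq_strictMono_tendsto' hs
  have hU : ⋃ n, ball a (u n) = ball a s := by
    ext z
    simp only [mem_iUnion, mem_ball]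
    refine ⟨fun ⟨n, hn⟩ => hn.trans (hus n).2, fun hz => ?_⟩
    exact (hlim.eventually_const_lt hz).exists
  have := tendsto_setIntegral_of_monotone (f := v) (μ := areaM) (s := fun n => ball a (u n))
    (fun n => measurableSet_ball) (fun m n hmn => ball_subset_ball (hu.monotone hmn))
    (by rwa [hU])
  rw [hU] at this
  exact ge_of_tendsto' (((hlim.pow 2).inv₀ (by positivity)).mul this)
    fun n => h _ (hus n).1 (hus n).2

theorem exp_mean_le {f : ℂ → ℝ} {a : ℂ} {s : ℝ} (hs : 0 < s)
    (hf : IntegrableOn f (ball a s) areaM)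
    (hexp : IntegrableOn (fun z => Real.exp (f z)) (ball a s) areaM) :
    Real.exp ((s ^ 2)⁻¹ * ∫ z in ball a s, f z ∂areaM) ≤
      (s ^ 2)⁻¹ * ∫ z in ball a s, Real.exp (f z) ∂areaM := by
  have := convexOn_exp.map_set_average_le (μ := areaM) (t := ball a s) (f := f)
    Real.continuous_exp.continuousOn isClosed_univ (measure_ball_pos _ _ hs).ne'
    measure_ball_lt_top.ne (by simp) hf hexp
  simpa only [setAverage_eq, areaM_real_ball a hs.le, smul_eq_mul] using this

theorem toReal_max_logE (x t : ℝ) :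
    (max (logE x) (t : EReal)).toReal = Real.log (max x (Real.exp t)) := by
  rcases le_or_gt x 0 with hx | hx
  · rw [max_eq_right (hx.trans (Real.exp_pos t).le)]
    simp [logE, hx]
  · rw [logE, if_neg hx.not_ge]
    rcases le_total x (Real.exp t) with h | h
    · have : Real.log x ≤ t := (Real.log_le_iff_le_exp hx).2 h
      rw [max_eq_right h, max_eq_right (EReal.coe_le_coe_iff.2 this)]
      simp
    · have : t ≤ Real.log x := (Real.le_log_iff_exp_le hx).2 h
      rw [max_eq_left h, max_eq_left (EReal.coe_le_coe_iff.2 this)]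
      simp

theorem le_Fkor_rpow_mul_mean {α : ℝ} (hα : 0 < α) {ω : ℂ → ℝ}
    (hnn : ∀ z ∈ ball (0 : ℂ) 1, 0 ≤ ω z) (hint : IntegrableOn ω (ball (0 : ℂ) 1) areaM)
    (hsub : SubharmonicOnE
      (fun z => logE (ω z / (1 - normSq z) ^ (2 * α))) (ball (0 : ℂ) 1))
    {r : ℝ} (h0 : 0 ≤ r) (h1 : r < 1) :
    ω r ≤ ((1 - r ^ 2) * Fkor r) ^ (2 * α) *
      (((1 - r) ^ 2)⁻¹ * ∫ z in ball (r : ℂ) (1 - r), ω z ∂areaM) := by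
  have hs : 0 < 1 - r := by linarith
  set s := 1 - r with hs_def
  have hB : ball (r : ℂ) s ⊆ ball 0 1 := ball_subset_unit_ball h0
  have hr : (r : ℂ) ∈ ball (0 : ℂ) 1 := hB (mem_ball_self hs)
  set L : ℂ → ℝ := fun z => Real.log (1 / (1 - normSq z))
  have hL : IntegrableOn L (ball (0 : ℂ) 1) areaM := integrableOn_log_one_div_one_sub_normSq
  set d : ℂ → ℝ := fun z => (1 - normSq z) ^ (2 * α) with hd_def
  have hd : ∀ z ∈ ball (0 : ℂ) 1, 0 < d z := fun z hz =>
    Real.rpow_pos_of_pos (one_sub_normSq_pos hz) _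
  have hd1 : ∀ z ∈ ball (0 : ℂ) 1, d z ≤ 1 := fun z hz =>
    Real.rpow_le_one (one_sub_normSq_pos hz).le (by linarith [normSq_nonneg z]) (by positivity)
  have hlogd : ∀ z ∈ ball (0 : ℂ) 1, Real.log (d z) = -(2 * α * L z) := fun z hz => by
    simp only [hd_def, L]
    rw [Real.log_rpow (one_sub_normSq_pos hz), one_div, Real.log_inv]
    ring
  have hdm : Measurable d := by
    simp only [hd_def, normSq_eq_norm_sq]
    fun_prop
  have hfin : IsFiniteMeasure (areaM.restrict (ball (0 : ℂ) 1)) :=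
    ⟨by simpa using measure_ball_lt_top⟩
  have key : ∀ n : ℕ, ω r ≤ ((1 - r ^ 2) * Fkor r) ^ (2 * α) *
      ((s ^ 2)⁻¹ * (∫ z in ball (r : ℂ) s, ω z ∂areaM) + Real.exp (-(n : ℝ))) := by
    intro n
    set e := Real.exp (-(n : ℝ)) with he_def
    have he : 0 < e := Real.exp_pos _
    have he1 : e ≤ 1 := Real.exp_le_one_iff.2 (by simp)
    set g : ℂ → ℝ := fun z => max (ω z) (e * d z) with hg_def
    have hg : ∀ z ∈ ball (0 : ℂ) 1, 0 < g z := fun z hz =>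
      lt_max_of_lt_right (mul_pos he (hd z hz))
    have hgle : ∀ z ∈ ball (0 : ℂ) 1, g z ≤ ω z + e := fun z hz => by
      refine max_le (by linarith) ?_
      nlinarith [hnn z hz, hd1 z hz]
    have hgm : AEStronglyMeasurable g (areaM.restrict (ball (0 : ℂ) 1)) :=
      (hint.aemeasurable.max (hdm.aemeasurable.const_mul e)).aestronglyMeasurable
    have hgi : IntegrableOn g (ball (0 : ℂ) 1) areaM := by
      refine (hint.add (integrable_const e)).mono' hgm ?_
      filter_upwards [ae_restrict_mem measurableSet_ball] with z hz
      rw [Real.norm_of_nonneg (hg z hz).le]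
      exact hgle z hz
    have hlog : IntegrableOn (fun z => Real.log (g z)) (ball (0 : ℂ) 1) areaM := by
      refine ((hint.add (integrable_const (1 + n : ℝ))).add (hL.const_mul (2 * α))).mono'
        (Real.measurable_log.comp_aemeasurable hgm.aemeasurable).aestronglyMeasurable ?_
      filter_upwards [ae_restrict_mem measurableSet_ball] with z hz
      have hL0 : 0 ≤ L z := log_one_div_one_sub_normSq_nonneg hz
      have h2 : 0 ≤ 2 * α * L z := by positivity
      have hup : Real.log (g z) ≤ g z := Real.log_le_self (hg z hz).le
      have hlow : Real.log (e * d z) ≤ Real.log (g z) :=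
        Real.log_le_log (mul_pos he (hd z hz)) (le_max_right _ _)
      rw [Real.log_mul he.ne' (hd z hz).ne', hlogd z hz, he_def, Real.log_exp] at hlow
      have := hgle z hz
      have := hnn z hz
      have : (0 : ℝ) ≤ n := n.cast_nonneg
      simp only [Pi.add_apply, Real.norm_eq_abs]
      rw [abs_le]
      constructor <;> linarith
    have hv : ∀ z ∈ ball (0 : ℂ) 1,
        (max (logE (ω z / d z)) ((-(n : ℝ) : ℝ) : EReal)).toReal =
          Real.log (g z) + 2 * α * L z := by
      intro z hz
      have : max (ω z / d z) e = g z / d z := by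
        rw [show g z = max (ω z) (e * d z) from rfl, ← max_div_div_right (hd z hz).le,
          mul_div_cancel_right₀ _ (hd z hz).ne']
      rw [toReal_max_logE, this, Real.log_div (hg z hz).ne' (hd z hz).ne', hlogd z hz]
      ring
    have hmean : Real.log (g r) + 2 * α * L r ≤
        (s ^ 2)⁻¹ * ∫ z in ball (r : ℂ) s, (Real.log (g z) + 2 * α * L z) ∂areaM := by
      refine le_mean_of_forall_lt hs ((hlog.add (hL.const_mul _)).mono_set hB) fun ρ hρ hρs => ?_
      have := hsub.2 r hr ρ hρ ((closedBall_subset_ball hρs).trans hB) n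
      rw [hv r hr, setAverage_ball_eq _ _ hρ.le] at this
      refine this.trans_eq ?_
      congr 1
      exact setIntegral_congr_fun measurableSet_ball
        fun z hz => hv z (hB (ball_subset_ball hρs.le hz))
    rw [integral_add (hlog.mono_set hB) ((hL.mono_set hB).const_mul _),
      integral_const_mul, mul_add] at hmean
    have hexp : ∀ z ∈ ball (0 : ℂ) 1, Real.exp (Real.log (g z)) = g z := fun z hz =>
      Real.exp_log (hg z hz)
    have hJ := exp_mean_le hs (hlog.mono_set hB)
      ((hgi.mono_set hB).congr_fun (fun z hz => (hexp z (hB hz)).symm) measurableSet_ball)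
    rw [setIntegral_congr_fun measurableSet_ball fun z hz => hexp z (hB hz)] at hJ
    have hgint : (s ^ 2)⁻¹ * ∫ z in ball (r : ℂ) s, g z ∂areaM ≤
        (s ^ 2)⁻¹ * (∫ z in ball (r : ℂ) s, ω z ∂areaM) + e := by
      have hfin' : IsFiniteMeasure (areaM.restrict (ball (r : ℂ) s)) :=
        ⟨by simpa using measure_ball_lt_top⟩
      have : ∫ z in ball (r : ℂ) s, g z ∂areaM ≤ ∫ z in ball (r : ℂ) s, (ω z + e) ∂areaM :=
        setIntegral_mono_on (hgi.mono_set hB) ((hint.mono_set hB).add (integrable_const e))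
          measurableSet_ball fun z hz => hgle z (hB hz)
      rw [integral_add (hint.mono_set hB) (integrable_const e), setIntegral_const,
        areaM_real_ball _ hs.le, smul_eq_mul] at this
      calc _ ≤ (s ^ 2)⁻¹ * ((∫ z in ball (r : ℂ) s, ω z ∂areaM) + s ^ 2 * e) := by gcongr
        _ = _ := by field_simp
    have hF : Real.exp (2 * α * ((s ^ 2)⁻¹ * ∫ z in ball (r : ℂ) s, L z ∂areaM)) =
        Fkor r ^ (2 * α) := by
      rw [Fkor, ← Real.exp_mul, mul_comm]
    have hr2 : 1 - normSq (r : ℂ) = 1 - r ^ 2 := by rw [normSq_ofReal]; ring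
    have hr2pos : 0 < 1 - r ^ 2 := hr2 ▸ one_sub_normSq_pos hr
    calc ω r ≤ g r := le_max_left _ _
      _ = d r * Real.exp (Real.log (g r) + 2 * α * L r) := by
        rw [Real.exp_add, hexp r hr, show 2 * α * L r = -Real.log (d r) by rw [hlogd r hr, neg_neg],
          Real.exp_neg, Real.exp_log (hd r hr)]
        have := hd r hr
        field_simp
      _ ≤ d r * (((s ^ 2)⁻¹ * (∫ z in ball (r : ℂ) s, ω z ∂areaM) + e) * Fkor r ^ (2 * α)) := by
        refine mul_le_mul_of_nonneg_left ?_ (hd r hr).le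
        rw [← hF]
        refine (Real.exp_le_exp.2 hmean).trans ?_
        rw [Real.exp_add, mul_left_comm _ (2 * α)]
        exact mul_le_mul_of_nonneg_right (hJ.trans hgint) (Real.exp_pos _).le
      _ = _ := by
        rw [Real.mul_rpow hr2pos.le (show 0 ≤ Fkor r from (Real.exp_pos _).le), hd_def]
        simp only [hr2]
        ring
  have hlim : Filter.Tendsto (fun n : ℕ => ((1 - r ^ 2) * Fkor r) ^ (2 * α) *
      ((s ^ 2)⁻¹ * (∫ z in ball (r : ℂ) s, ω z ∂areaM) + Real.exp (-(n : ℝ)))) Filter.atTop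
      (nhds (((1 - r ^ 2) * Fkor r) ^ (2 * α) *
      ((s ^ 2)⁻¹ * (∫ z in ball (r : ℂ) s, ω z ∂areaM) + 0))) :=
    ((Real.tendsto_exp_neg_atTop_nhds_zero.comp tendsto_natCast_atTop_atTop).const_add _).const_mul _
  rw [add_zero] at hlim
  exact ge_of_tendsto' hlim key

theorem isHarmonicPolynomial_geom_sum (ρ : ℝ) (N : ℕ) :
    IsHarmonicPolynomial fun z => 2 * (∑ n ∈ Finset.range N, ((ρ : ℂ) * z) ^ n).re - 1 := by
  refine ⟨∑ n ∈ Finset.range N, (Polynomial.C (ρ : ℂ) * Polynomial.X) ^ n - 1,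
    ∑ n ∈ Finset.range N, (Polynomial.C (ρ : ℂ) * Polynomial.X) ^ n, fun z => ?_⟩
  simp only [Polynomial.eval_sub, Polynomial.eval_finsetSum, Polynomial.eval_pow,
    Polynomial.eval_mul, Polynomial.eval_C, Polynomial.eval_X, Polynomial.eval_one]
  have := add_conj (∑ n ∈ Finset.range N, ((ρ : ℂ) * z) ^ n)
  push_cast at this ⊢
  linear_combination -this

/-- The Poisson kernel of the unit disk with pole at `1`. -/
def poissonOne (w : ℂ) : ℝ := 2 * ((1 - w)⁻¹).re - 1

theorem one_sub_ne_zero_of_mem_ball {w : ℂ} (hw : w ∈ ball (0 : ℂ) 1) : 1 - w ≠ 0 := by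
  intro h
  rw [← sub_eq_zero.1 h] at hw
  simp at hw

theorem poissonOne_eq {w : ℂ} (hw : w ∈ ball (0 : ℂ) 1) :
    poissonOne w = (1 - normSq w) / normSq (1 - w) := by
  have h : normSq (1 - w) ≠ 0 := normSq_eq_zero.not.2 (one_sub_ne_zero_of_mem_ball hw)
  rw [poissonOne, inv_re, eq_div_iff h, sub_mul, mul_assoc, div_mul_cancel₀ _ h]
  simp only [normSq_apply, sub_re, sub_im, one_re, one_im]
  ring

theorem poissonOne_nonneg {w : ℂ} (hw : w ∈ ball (0 : ℂ) 1) : 0 ≤ poissonOne w := by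
  rw [poissonOne_eq hw]
  exact div_nonneg (one_sub_normSq_pos hw).le (normSq_nonneg _)

theorem ofReal_mul_mem_ball {ρ : ℝ} (h0 : 0 ≤ ρ) (h1 : ρ < 1) {z : ℂ}
    (hz : z ∈ ball (0 : ℂ) 1) : (ρ : ℂ) * z ∈ ball (0 : ℂ) 1 := by
  rw [mem_ball_zero_iff] at hz ⊢
  rw [norm_mul, Complex.norm_real, Real.norm_of_nonneg h0]
  nlinarith [norm_nonneg z]

theorem measurable_poissonOne : Measurable poissonOne := by
  unfold poissonOne
  fun_prop

theorem lintegral_poissonOne_dilation {ω : ℂ → ℝ}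
    (hnn : ∀ z ∈ ball (0 : ℂ) 1, 0 ≤ ω z) (hint : IntegrableOn ω (ball (0 : ℂ) 1) areaM)
    (hrep : ∀ h : ℂ → ℝ, IsHarmonicPolynomial h →
      h 0 = ∫ z in ball (0 : ℂ) 1, h z * ω z ∂areaM)
    {ρ : ℝ} (h0 : 0 ≤ ρ) (h1 : ρ < 1) :
    ∫⁻ z in ball (0 : ℂ) 1, ENNReal.ofReal (poissonOne (ρ * z) * ω z) ∂areaM = 1 := by
  set f : ℕ → ℂ → ℝ := fun N z =>
    2 * (∑ n ∈ Finset.range (N + 1), ((ρ : ℂ) * z) ^ n).re - 1 with hf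
  have hval : ∀ N, ∫ z in ball (0 : ℂ) 1, f N z * ω z ∂areaM = 1 := fun N => by
    rw [← hrep _ (isHarmonicPolynomial_geom_sum ρ (N + 1))]
    simp [Finset.sum_range_succ']
    norm_num
  set C := 2 * (1 - ρ)⁻¹ + 1
  have hbound : ∀ N, ∀ z ∈ ball (0 : ℂ) 1, |f N z| ≤ C := by
    intro N z hz
    rw [mem_ball_zero_iff] at hz
    have : |(∑ n ∈ Finset.range (N + 1), ((ρ : ℂ) * z) ^ n).re| ≤ (1 - ρ)⁻¹ := by
      refine (abs_re_le_norm _).trans ((norm_sum_le _ _).trans ?_)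
      rw [← tsum_geometric_of_lt_one h0 h1]
      refine le_trans (Finset.sum_le_sum fun n _ => ?_)
        ((summable_geometric_of_lt_one h0 h1).sum_le_tsum (Finset.range (N + 1))
          fun n _ => by positivity)
      rw [norm_pow, norm_mul, Complex.norm_real, Real.norm_of_nonneg h0]
      exact pow_le_pow_left₀ (by positivity) (mul_le_of_le_one_right h0 hz.le) n
    rw [abs_le] at this ⊢
    constructor <;> simp only [hf, C] <;> linarith [this.1, this.2]
  have hlim : ∀ z ∈ ball (0 : ℂ) 1,
      Filter.Tendsto (fun N => f N z) Filter.atTop (nhds (poissonOne (ρ * z))) := by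
    intro z hz
    have hw := mem_ball_zero_iff.1 (ofReal_mul_mem_ball h0 h1 hz)
    have := ((hasSum_geometric_of_norm_lt_one hw).tendsto_sum_nat).comp
      (Filter.tendsto_add_atTop_nat 1)
    exact (((continuous_re.tendsto _).comp this).const_mul 2).sub_const 1
  have hfm : ∀ N, Continuous (f N) := fun N => by
    simp only [hf]
    fun_prop
  have hDCT := tendsto_integral_of_dominated_convergence
    (μ := areaM.restrict (ball (0 : ℂ) 1)) (F := fun N z => f N z * ω z)
    (f := fun z => poissonOne (ρ * z) * ω z) (fun z => C * ω z)
    (fun N => (hfm N).aestronglyMeasurable.mul hint.1) (hint.const_mul C)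
    (fun N => by
      filter_upwards [ae_restrict_mem measurableSet_ball] with z hz
      rw [norm_mul, Real.norm_of_nonneg (hnn z hz)]
      exact mul_le_mul_of_nonneg_right (hbound N z hz) (hnn z hz))
    (by
      filter_upwards [ae_restrict_mem measurableSet_ball] with z hz
      exact (hlim z hz).mul_const _)
  simp only [hval] at hDCT
  have hone := tendsto_nhds_unique hDCT tendsto_const_nhds
  rw [← ofReal_integral_eq_lintegral_ofReal, hone,
    ENNReal.ofReal_one]
  · refine (hint.const_mul C).mono'
      ((measurable_poissonOne.comp (by fun_prop)).aestronglyMeasurable.mul hint.1) ?_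
    filter_upwards [ae_restrict_mem measurableSet_ball] with z hz
    rw [norm_mul, Real.norm_of_nonneg (hnn z hz)]
    refine mul_le_mul_of_nonneg_right ?_ (hnn z hz)
    exact le_of_tendsto' (hlim z hz).abs fun N => hbound N z hz
  · filter_upwards [ae_restrict_mem measurableSet_ball] with z hz
    exact mul_nonneg (poissonOne_nonneg (ofReal_mul_mem_ball h0 h1 hz)) (hnn z hz)

theorem lintegral_poissonOne_le_one {ω : ℂ → ℝ}
    (hnn : ∀ z ∈ ball (0 : ℂ) 1, 0 ≤ ω z) (hint : IntegrableOn ω (ball (0 : ℂ) 1) areaM)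
    (hrep : ∀ h : ℂ → ℝ, IsHarmonicPolynomial h →
      h 0 = ∫ z in ball (0 : ℂ) 1, h z * ω z ∂areaM) :
    ∫⁻ z in ball (0 : ℂ) 1, ENNReal.ofReal (poissonOne z * ω z) ∂areaM ≤ 1 := by
  obtain ⟨u, -, hu, hlim⟩ := exists_seq_strictMono_tendsto' (zero_lt_one (α := ℝ))
  have hF := lintegral_liminf_le' (u := Filter.atTop) (μ := areaM.restrict (ball (0 : ℂ) 1))
    (f := fun n z => ENNReal.ofReal (poissonOne (u n * z) * ω z))
    (fun n => ((measurable_poissonOne.comp (by fun_prop)).aemeasurable.mul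
      hint.aemeasurable).ennreal_ofReal)
  simp only [fun n => lintegral_poissonOne_dilation hnn hint hrep (hu n).1.le (hu n).2,
    Filter.liminf_const] at hF
  refine le_trans (le_of_eq ?_) hF
  refine setLIntegral_congr_fun measurableSet_ball fun z hz => ?_
  refine (Filter.Tendsto.liminf_eq ?_).symm
  refine (ENNReal.continuous_ofReal.tendsto _).comp (Filter.Tendsto.mul_const _ ?_)
  have h1 : Filter.Tendsto (fun n => 1 - (u n : ℂ) * z) Filter.atTop (nhds (1 - z)) := by
    simpa using (((continuous_ofReal.tendsto _).comp hlim).mul_const z).const_sub 1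
  exact (((continuous_re.tendsto _).comp
    (h1.inv₀ (one_sub_ne_zero_of_mem_ball hz))).const_mul 2).sub_const 1

theorem lintegral_indicator_ball_le_poissonOne {z : ℂ} (hz : z ∈ ball (0 : ℂ) 1) :
    ∫⁻ r in Ioo (0 : ℝ) 1,
      (ball (r : ℂ) (1 - r)).indicator (fun _ => ENNReal.ofReal ((1 - r) ^ 2)⁻¹) z ≤
      ENNReal.ofReal (poissonOne z) := by
  have hpos := one_sub_normSq_pos hz
  have hre : 0 < 1 - z.re := by
    have := (abs_re_le_norm z).trans_lt (mem_ball_zero_iff.1 hz)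
    linarith [(abs_lt.1 this).2]
  have hD : 0 < normSq (1 - z) := normSq_pos.2 (one_sub_ne_zero_of_mem_ball hz)
  have hDeq : normSq (1 - z) = 1 - 2 * z.re + normSq z := by
    simp only [normSq_apply, sub_re, sub_im, one_re, one_im]
    ring
  set R := (1 - normSq z) / (2 * (1 - z.re)) with hR
  have hR0 : 0 < R := by positivity
  have hR1 : R < 1 := by
    rw [hR, div_lt_one (by positivity)]
    linarith
  have hle : ∀ r ∈ Ioo (0 : ℝ) 1,
      (ball (r : ℂ) (1 - r)).indicator (fun _ => ENNReal.ofReal ((1 - r) ^ 2)⁻¹) z ≤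
      (Ioo 0 R).indicator (fun r => ENNReal.ofReal ((1 - r) ^ 2)⁻¹) r := by
    intro r hr
    by_cases h : z ∈ ball (r : ℂ) (1 - r)
    · have hrR : r < R := by
        rw [mem_ball_iff_norm] at h
        have h2 : normSq (z - r) < (1 - r) ^ 2 := by
          rw [normSq_eq_norm_sq]
          exact pow_lt_pow_left₀ h (norm_nonneg _) two_ne_zero
        rw [hR, lt_div_iff₀ (by positivity)]
        simp only [normSq_apply, sub_re, sub_im, ofReal_re, ofReal_im] at h2 ⊢
        linarith
      rw [indicator_of_mem h, indicator_of_mem (show r ∈ Ioo 0 R from ⟨hr.1, hrR⟩)]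
    · rw [indicator_of_notMem h]
      exact zero_le
  have hderiv : ∀ r ∈ uIcc 0 R, HasDerivAt (fun r : ℝ => (1 - r)⁻¹) ((1 - r) ^ 2)⁻¹ r := by
    intro r hr
    rw [uIcc_of_le hR0.le] at hr
    exact (((hasDerivAt_id' r).const_sub 1).fun_inv (by linarith [hr.2])).congr_deriv (by simp)
  have hii : IntervalIntegrable (fun r : ℝ => ((1 - r) ^ 2)⁻¹) volume 0 R := by
    apply ContinuousOn.intervalIntegrable
    refine ContinuousOn.inv₀ (by fun_prop) fun r hr => ?_
    rw [uIcc_of_le hR0.le] at hr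
    exact pow_ne_zero 2 (by linarith [hr.2])
  have hFTC := intervalIntegral.integral_eq_sub_of_hasDerivAt hderiv hii
  rw [intervalIntegral.integral_of_le hR0.le, integral_Ioc_eq_integral_Ioo] at hFTC
  calc _ ≤ ∫⁻ r in Ioo (0 : ℝ) 1,
        (Ioo 0 R).indicator (fun r => ENNReal.ofReal ((1 - r) ^ 2)⁻¹) r :=
        setLIntegral_mono' measurableSet_Ioo hle
    _ ≤ ∫⁻ r, (Ioo 0 R).indicator (fun r => ENNReal.ofReal ((1 - r) ^ 2)⁻¹) r :=
        setLIntegral_le_lintegral _ _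
    _ = ENNReal.ofReal (∫ r in Ioo 0 R, ((1 - r) ^ 2)⁻¹) := by
        rw [lintegral_indicator measurableSet_Ioo, ofReal_integral_eq_lintegral_ofReal
          ((intervalIntegrable_iff_integrableOn_Ioo_of_le hR0.le).1 hii)
          (.of_forall fun r => by positivity)]
    _ = ENNReal.ofReal (poissonOne z) := by
        rw [hFTC, poissonOne_eq hz]
        congr 1
        have h1R : 1 - R = normSq (1 - z) / (2 * (1 - z.re)) := by
          rw [hR, hDeq]
          field_simp
          ring
        rw [h1R, hDeq]
        rw [hDeq] at hD
        field_simp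
        ring

theorem lintegral_mean_le_one {ω : ℂ → ℝ}
    (hnn : ∀ z ∈ ball (0 : ℂ) 1, 0 ≤ ω z) (hint : IntegrableOn ω (ball (0 : ℂ) 1) areaM)
    (hrep : ∀ h : ℂ → ℝ, IsHarmonicPolynomial h →
      h 0 = ∫ z in ball (0 : ℂ) 1, h z * ω z ∂areaM) :
    AEMeasurable (fun r : ℝ => ENNReal.ofReal
        (((1 - r) ^ 2)⁻¹ * ∫ z in ball (r : ℂ) (1 - r), ω z ∂areaM))
        (volume.restrict (Ioo (0 : ℝ) 1)) ∧
      ∫⁻ r in Ioo (0 : ℝ) 1, ENNReal.ofReal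
        (((1 - r) ^ 2)⁻¹ * ∫ z in ball (r : ℂ) (1 - r), ω z ∂areaM) ≤ 1 := by
  set k : ℝ → ℂ → ENNReal := fun r z =>
    (ball (r : ℂ) (1 - r)).indicator (fun _ => ENNReal.ofReal ((1 - r) ^ 2)⁻¹) z with hk
  have hkm : Measurable (Function.uncurry k) := by
    have hm : MeasurableSet {x : ℝ × ℂ | x.2 ∈ ball (x.1 : ℂ) (1 - x.1)} := by
      simp only [mem_ball]
      exact measurableSet_lt (by fun_prop) (by fun_prop)
    have h2 : Measurable fun x : ℝ × ℂ => ENNReal.ofReal ((1 - x.1) ^ 2)⁻¹ := by fun_prop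
    exact h2.indicator hm
  have hW : AEMeasurable (Function.uncurry fun (r : ℝ) z => k r z * ENNReal.ofReal (ω z))
      ((volume.restrict (Ioo (0 : ℝ) 1)).prod (areaM.restrict (ball (0 : ℂ) 1))) :=
    hkm.aemeasurable.mul (hint.aemeasurable.ennreal_ofReal.comp_snd)
  have hmean : ∀ r ∈ Ioo (0 : ℝ) 1,
      ENNReal.ofReal (((1 - r) ^ 2)⁻¹ * ∫ z in ball (r : ℂ) (1 - r), ω z ∂areaM) =
        ∫⁻ z in ball (0 : ℂ) 1, k r z * ENNReal.ofReal (ω z) ∂areaM := by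
    intro r hr
    have hB : ball (r : ℂ) (1 - r) ⊆ ball 0 1 := ball_subset_unit_ball hr.1.le
    have : (fun z => k r z * ENNReal.ofReal (ω z)) = (ball (r : ℂ) (1 - r)).indicator
        fun z => ENNReal.ofReal ((1 - r) ^ 2)⁻¹ * ENNReal.ofReal (ω z) := by
      ext z
      by_cases h : z ∈ ball (r : ℂ) (1 - r)
      · simp only [hk, indicator_of_mem h]
      · simp only [hk, indicator_of_notMem h, zero_mul]
    rw [this, lintegral_indicator measurableSet_ball, Measure.restrict_restrict measurableSet_ball,
      inter_eq_left.2 hB, lintegral_const_mul' _ _ ENNReal.ofReal_ne_top,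
      ENNReal.ofReal_mul (by positivity), ofReal_integral_eq_lintegral_ofReal (hint.mono_set hB)]
    filter_upwards [ae_restrict_mem measurableSet_ball] with z hz
    exact hnn z (hB hz)
  refine ⟨hW.lintegral_prod_right'.congr ?_, ?_⟩
  · filter_upwards [ae_restrict_mem measurableSet_Ioo] with r hr
    exact (hmean r hr).symm
  · rw [setLIntegral_congr_fun measurableSet_Ioo hmean, lintegral_lintegral_swap hW]
    refine le_trans ?_ (lintegral_poissonOne_le_one hnn hint hrep)
    refine setLIntegral_mono' measurableSet_ball fun z hz => ?_
    rw [lintegral_mul_const' _ _ ENNReal.ofReal_ne_top, ENNReal.ofReal_mul (poissonOne_nonneg hz)]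
    gcongr
    exact lintegral_indicator_ball_le_poissonOne hz

theorem one_sub_sq_mul_Fkor_nonneg {r : ℝ} (h0 : 0 ≤ r) (h1 : r < 1) :
    0 ≤ (1 - r ^ 2) * Fkor r :=
  mul_nonneg (by nlinarith) (Real.exp_pos _).le

theorem integrableOn_one_sub_sq_mul_Fkor_rpow {q : ℝ} (hq : 0 ≤ q) :
    IntegrableOn (fun r => ((1 - r ^ 2) * Fkor r) ^ q) (Ioo (0 : ℝ) 1) := by
  have hm : Measurable fun r : ℝ => ((1 - r ^ 2) * Fkor r) ^ q := by
    have := measurable_Fkor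
    fun_prop
  refine Measure.integrableOn_of_bounded (M := (2 * Real.exp
    (∫ z in ball (0 : ℂ) 1, Real.log (1 / (1 - normSq z)) ∂areaM)) ^ q) (by simp)
    hm.aestronglyMeasurable ?_
  filter_upwards [ae_restrict_mem measurableSet_Ioo] with r hr
  have h0 := one_sub_sq_mul_Fkor_nonneg hr.1.le hr.2
  rw [Real.norm_of_nonneg (Real.rpow_nonneg h0 q)]
  exact Real.rpow_le_rpow h0 (one_sub_sq_mul_Fkor_le hr.1.le hr.2) hq

/-- Korenblum-type lemma: if `log(ω/(1-|z|²)^{2α})` is subharmonic in `D` and `ω ≥ 0` is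
area-integrable and reproducing at the origin, then `∫₀¹ ω(r)^p dr ≤ c_{p,α} < ∞` for
`0 < p < π/(π + 2α(4-π))`, where
`c_{p,α} = (∫₀¹ [(1-r²)F(r)]^{2αp/(1-p)} dr)^{1-p}`. -/
theorem statement7 (α p : ℝ) (hα : 0 < α)
    (hp0 : 0 < p) (hp1 : p < Real.pi / (Real.pi + 2 * α * (4 - Real.pi)))
    (ω : ℂ → ℝ)
    (hnn : ∀ z ∈ ball (0:ℂ) 1, 0 ≤ ω z)
    (hint : IntegrableOn ω (ball (0:ℂ) 1) areaM)
    (hsub : SubharmonicOnE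
      (fun z => logE (ω z / (1 - normSq z) ^ (2 * α))) (ball (0:ℂ) 1))
    (hrep : ∀ h : ℂ → ℝ, IsHarmonicPolynomial h →
      h 0 = ∫ z in ball (0:ℂ) 1, h z * ω z ∂areaM) :
    IntervalIntegrable (fun r => ((1 - r ^ 2) * Fkor r) ^ (2 * α * p / (1 - p)))
        MeasureTheory.volume 0 1 ∧
      (∫⁻ r in Ioo (0:ℝ) 1, ENNReal.ofReal (ω ((r : ℂ)) ^ p))
        ≤ ENNReal.ofReal
            ((∫ r in (0:ℝ)..1, ((1 - r ^ 2) * Fkor r) ^ (2 * α * p / (1 - p))) ^ (1 - p)) := by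
  have hp1' : p < 1 := by
    refine hp1.trans_le ((div_le_one ?_).2 ?_) <;>
      nlinarith [Real.pi_pos, mul_nonneg hα.le (sub_nonneg.2 Real.pi_le_four)]
  have hq : 0 ≤ 2 * α * p / (1 - p) := div_nonneg (by positivity) (by linarith)
  have hH := integrableOn_one_sub_sq_mul_Fkor_rpow hq
  refine ⟨(intervalIntegrable_iff_integrableOn_Ioo_of_le zero_le_one).2 hH, ?_⟩
  obtain ⟨hmeas, hmean⟩ := lintegral_mean_le_one hnn hint hrep
  set H : ℝ → ℝ := fun r => ((1 - r ^ 2) * Fkor r) ^ (2 * α * p / (1 - p)) with hH_def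
  set m : ℝ → ℝ := fun r => ((1 - r) ^ 2)⁻¹ * ∫ z in ball (r : ℂ) (1 - r), ω z ∂areaM
  have hH0 : ∀ r ∈ Ioo (0 : ℝ) 1, 0 ≤ H r := fun r hr =>
    Real.rpow_nonneg (one_sub_sq_mul_Fkor_nonneg hr.1.le hr.2) _
  calc ∫⁻ r in Ioo (0 : ℝ) 1, ENNReal.ofReal (ω (r : ℂ) ^ p)
      ≤ ∫⁻ r in Ioo (0 : ℝ) 1, ENNReal.ofReal (H r) ^ (1 - p) * ENNReal.ofReal (m r) ^ p := by
        refine setLIntegral_mono' measurableSet_Ioo fun r hr => ?_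
        have hB : ball (r : ℂ) (1 - r) ⊆ ball 0 1 := ball_subset_unit_ball hr.1.le
        have hm0 : 0 ≤ m r := mul_nonneg (by positivity)
          (setIntegral_nonneg measurableSet_ball fun z hz => hnn z (hB hz))
        have hA := one_sub_sq_mul_Fkor_nonneg hr.1.le hr.2
        rw [ENNReal.ofReal_rpow_of_nonneg (hH0 r hr) (by linarith),
          ENNReal.ofReal_rpow_of_nonneg hm0 hp0.le,
          ← ENNReal.ofReal_mul (Real.rpow_nonneg (hH0 r hr) _)]
        refine ENNReal.ofReal_le_ofReal ?_
        have hexp : H r ^ (1 - p) = (((1 - r ^ 2) * Fkor r) ^ (2 * α)) ^ p := by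
          rw [hH_def, ← Real.rpow_mul hA, ← Real.rpow_mul hA,
            div_mul_cancel₀ _ (by linarith : 1 - p ≠ 0)]
        rw [hexp, ← Real.mul_rpow (Real.rpow_nonneg hA _) hm0]
        exact Real.rpow_le_rpow (hnn _ (hB (mem_ball_self (by linarith [hr.2]))))
          (le_Fkor_rpow_mul_mean hα hnn hint hsub hr.1.le hr.2) hp0.le
    _ ≤ (∫⁻ r in Ioo (0 : ℝ) 1, ENNReal.ofReal (H r)) ^ (1 - p) *
          (∫⁻ r in Ioo (0 : ℝ) 1, ENNReal.ofReal (m r)) ^ p :=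
        ENNReal.lintegral_mul_norm_pow_le hH.aemeasurable.ennreal_ofReal hmeas
          (by linarith) hp0.le (by ring)
    _ ≤ (∫⁻ r in Ioo (0 : ℝ) 1, ENNReal.ofReal (H r)) ^ (1 - p) * 1 := by
        gcongr
        exact ENNReal.rpow_le_one hmean hp0.le
    _ = ENNReal.ofReal ((∫ r in (0 : ℝ)..1, H r) ^ (1 - p)) := by
        have hnonneg : 0 ≤ᵐ[volume.restrict (Ioo (0 : ℝ) 1)] H := by
          filter_upwards [ae_restrict_mem measurableSet_Ioo] with r hr using hH0 r hr
        rw [mul_one, ← ofReal_integral_eq_lintegral_ofReal hH hnonneg,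
          intervalIntegral.integral_of_le zero_le_one, integral_Ioc_eq_integral_Ioo,
          ENNReal.ofReal_rpow_of_nonneg (integral_nonneg_of_ae hnonneg) (by linarith)]
end
end

section
/- Fix r with 0 < r < 1. Then ∫_D (2(1−|z|²)/|1−rz|⁶) dΣ(z) = (1−r²)^{−3}, and ∫_D (|z−1|²/|1−rz|⁶) dΣ(z) ≤ 1/(r²(1−r²)²). In particular, there is no constant C such that (1−r²)^{−3} ≤ C/(r²(1−r²)²) for all r close to 1. -/
open Complex MeasureTheory Metric Set ComplexConjugate
noncomputable section

/-- The involutive automorphism `z ↦ (r - z) / (1 - r z)` of the unit disk. -/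
def diskInvolution (r : ℝ) (z : ℂ) : ℂ := (r - z) / (1 - r * z)

lemma one_sub_real_mul_ne_zero {r : ℝ} (h0 : 0 < r) (h1 : r < 1) {z : ℂ} (hz : ‖z‖ ≤ 1) :
    1 - (r : ℂ) * z ≠ 0 := by
  intro h
  have h2 : ‖(r : ℂ) * z‖ = 1 := by rw [← sub_eq_zero.mp h, norm_one]
  rw [norm_mul, Complex.norm_real, Real.norm_of_nonneg h0.le] at h2
  nlinarith

lemma one_sub_ofReal_sq_ne_zero {r : ℝ} (h0 : 0 < r) (h1 : r < 1) : 1 - (r : ℂ) ^ 2 ≠ 0 := by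
  have h : (1 : ℝ) - r ^ 2 ≠ 0 := by nlinarith
  exact_mod_cast h

lemma one_sub_mul_diskInvolution {r : ℝ} {z : ℂ} (h : 1 - (r : ℂ) * z ≠ 0) :
    1 - (r : ℂ) * diskInvolution r z = ((1 - r ^ 2 : ℝ) : ℂ) / (1 - r * z) := by
  unfold diskInvolution
  push_cast
  field_simp
  ring

lemma normSq_one_sub_mul_diskInvolution {r : ℝ} {z : ℂ} (h : 1 - (r : ℂ) * z ≠ 0) :
    normSq (1 - (r : ℂ) * diskInvolution r z) = (1 - r ^ 2) ^ 2 / normSq (1 - (r : ℂ) * z) := by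
  rw [one_sub_mul_diskInvolution h, normSq_div, normSq_ofReal]
  ring

lemma one_sub_normSq_diskInvolution {r : ℝ} {z : ℂ} (h : 1 - (r : ℂ) * z ≠ 0) :
    1 - normSq (diskInvolution r z)
      = (1 - r ^ 2) * (1 - normSq z) / normSq (1 - (r : ℂ) * z) := by
  have h' : normSq (1 - (r : ℂ) * z) ≠ 0 := by simpa using h
  rw [diskInvolution, normSq_div, eq_div_iff h', sub_mul, div_mul_cancel₀ _ h']
  simp [normSq_apply]
  ring

lemma diskInvolution_mem_ball {r : ℝ} (h0 : 0 < r) (h1 : r < 1) {z : ℂ} (hz : z ∈ ball (0 : ℂ) 1) :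
    diskInvolution r z ∈ ball (0 : ℂ) 1 := by
  rw [mem_ball_zero_iff] at hz ⊢
  have h := one_sub_real_mul_ne_zero h0 h1 hz.le
  have hpos : 0 < normSq (1 - (r : ℂ) * z) := normSq_pos.mpr h
  have hr : 0 < 1 - r ^ 2 := by nlinarith
  have hz' : 0 < 1 - normSq z := by
    rw [normSq_eq_norm_sq]
    nlinarith [norm_nonneg z]
  have key : 0 < 1 - normSq (diskInvolution r z) := by
    rw [one_sub_normSq_diskInvolution h]
    positivity
  rw [normSq_eq_norm_sq] at key
  nlinarith [norm_nonneg (diskInvolution r z)]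

lemma diskInvolution_diskInvolution {r : ℝ} (h0 : 0 < r) (h1 : r < 1) {z : ℂ}
    (hz : z ∈ ball (0 : ℂ) 1) : diskInvolution r (diskInvolution r z) = z := by
  have h := one_sub_real_mul_ne_zero h0 h1 (mem_ball_zero_iff.mp hz).le
  have h2 := one_sub_ofReal_sq_ne_zero h0 h1
  rw [diskInvolution, one_sub_mul_diskInvolution h, diskInvolution]
  push_cast
  rw [div_eq_iff (div_ne_zero h2 h)]
  field_simp
  ring

lemma image_diskInvolution_ball {r : ℝ} (h0 : 0 < r) (h1 : r < 1) :
    diskInvolution r '' ball (0 : ℂ) 1 = ball 0 1 := by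
  apply Subset.antisymm
  · rintro _ ⟨z, hz, rfl⟩
    exact diskInvolution_mem_ball h0 h1 hz
  · exact fun z hz ↦ ⟨_, diskInvolution_mem_ball h0 h1 hz, diskInvolution_diskInvolution h0 h1 hz⟩

lemma hasDerivAt_diskInvolution {r : ℝ} {z : ℂ} (h : 1 - (r : ℂ) * z ≠ 0) :
    HasDerivAt (diskInvolution r) (((r ^ 2 - 1 : ℝ) : ℂ) / (1 - r * z) ^ 2) z := by
  have hn : HasDerivAt (fun z : ℂ ↦ (r : ℂ) - z) (-1) z := (hasDerivAt_id z).const_sub _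
  have hd : HasDerivAt (fun z : ℂ ↦ 1 - (r : ℂ) * z) (-(r * 1)) z :=
    ((hasDerivAt_id z).const_mul (r : ℂ)).const_sub _
  refine (hn.fun_div hd h).congr_deriv ?_
  push_cast
  ring

lemma det_restrictScalars_toSpanSingleton (a : ℂ) :
    ((ContinuousLinearMap.toSpanSingleton ℂ a).restrictScalars ℝ).det = normSq a := by
  simp [ContinuousLinearMap.det, LinearMap.det_restrictScalars, Algebra.norm_complex_eq]

/-- Change of variables along `diskInvolution`. -/
lemma integral_ball_eq_integral_diskInvolution {r : ℝ} (h0 : 0 < r) (h1 : r < 1) (g : ℂ → ℝ) :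
    ∫ z in ball (0 : ℂ) 1, g z = ∫ z in ball (0 : ℂ) 1,
      (1 - r ^ 2) ^ 2 / normSq (1 - (r : ℂ) * z) ^ 2 * g (diskInvolution r z) := by
  have hinj : InjOn (diskInvolution r) (ball 0 1) :=
    LeftInvOn.injOn fun z hz ↦ diskInvolution_diskInvolution h0 h1 hz
  have key := integral_image_eq_integral_abs_det_fderiv_smul volume measurableSet_ball
    (fun z hz ↦ ((hasDerivAt_diskInvolution (one_sub_real_mul_ne_zero h0 h1
      (mem_ball_zero_iff.mp hz).le)).hasFDerivAt.restrictScalars ℝ).hasFDerivWithinAt) hinj g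
  rw [image_diskInvolution_ball h0 h1] at key
  rw [key]
  refine setIntegral_congr_fun measurableSet_ball fun z _ ↦ ?_
  rw [det_restrictScalars_toSpanSingleton, abs_of_nonneg (normSq_nonneg _), smul_eq_mul,
    normSq_div, normSq_ofReal, map_pow]
  ring

lemma setIntegral_areaM (s : Set ℂ) (g : ℂ → ℝ) :
    ∫ z in s, g z ∂areaM = Real.pi⁻¹ * ∫ z in s, g z := by
  rw [areaM, Measure.restrict_smul, integral_smul_measure, ENNReal.toReal_inv,
    ENNReal.toReal_ofReal Real.pi_pos.le, smul_eq_mul]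

lemma volume_real_unit_ball : (volume : Measure ℂ).real (ball 0 1) = Real.pi := by
  simp [Measure.real, Complex.volume_ball]

lemma integral_one_sub_normSq_ball :
    ∫ z in ball (0 : ℂ) 1, 2 * (1 - normSq z) = Real.pi := by
  have hrad : ∫ z in ball (0 : ℂ) 1, 2 * (1 - normSq z)
      = ∫ z : ℂ, (Iio (1 : ℝ)).indicator (fun t ↦ 2 * (1 - t ^ 2)) ‖z‖ := by
    rw [← integral_indicator measurableSet_ball]
    congr 1 with z
    simp [indicator, normSq_eq_norm_sq]
  have hone : ∫ y in Ioi (0 : ℝ), y ^ (2 - 1) •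
      (Iio (1 : ℝ)).indicator (fun t ↦ 2 * (1 - t ^ 2)) y = 1 / 2 := by
    have h : ∀ y : ℝ, y ^ (2 - 1) • (Iio (1 : ℝ)).indicator (fun t ↦ 2 * (1 - t ^ 2)) y
        = (Iio (1 : ℝ)).indicator (fun t ↦ 2 * t - 2 * t ^ 3) y := by
      intro y
      by_cases hy : y < 1 <;> simp [indicator, hy]
      ring
    simp_rw [h]
    rw [setIntegral_indicator measurableSet_Iio, Ioi_inter_Iio,
      ← integral_Ioc_eq_integral_Ioo, ← intervalIntegral.integral_of_le zero_le_one,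
      intervalIntegral.integral_sub (Continuous.intervalIntegrable (by fun_prop) _ _)
        (Continuous.intervalIntegrable (by fun_prop) _ _),
      intervalIntegral.integral_const_mul, intervalIntegral.integral_const_mul,
      integral_id, integral_pow]
    norm_num
  rw [hrad, integral_fun_norm_addHaar volume, Complex.finrank_real_complex, hone,
    volume_real_unit_ball]
  simp only [nsmul_eq_mul, smul_eq_mul]
  push_cast
  ring

/-- The squared norm of the reproducing kernel of the Bergman space with weight
`2 (1 - |z|²)`. -/
lemma integral_weighted_kernel {r : ℝ} (h0 : 0 < r) (h1 : r < 1) :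
    ∫ z in ball (0 : ℂ) 1, 2 * (1 - normSq z) / normSq (1 - (r : ℂ) * z) ^ 3 ∂areaM
      = ((1 - r ^ 2) ^ 3)⁻¹ := by
  have hr : 1 - r ^ 2 ≠ 0 := by nlinarith
  rw [setIntegral_areaM, integral_ball_eq_integral_diskInvolution h0 h1]
  have hcongr : ∀ z ∈ ball (0 : ℂ) 1, (1 - r ^ 2) ^ 2 / normSq (1 - (r : ℂ) * z) ^ 2 *
      (2 * (1 - normSq (diskInvolution r z)) / normSq (1 - (r : ℂ) * diskInvolution r z) ^ 3)
      = ((1 - r ^ 2) ^ 3)⁻¹ * (2 * (1 - normSq z)) := by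
    intro z hz
    have h := one_sub_real_mul_ne_zero h0 h1 (mem_ball_zero_iff.mp hz).le
    have h' : normSq (1 - (r : ℂ) * z) ≠ 0 := by simpa using h
    rw [normSq_one_sub_mul_diskInvolution h, one_sub_normSq_diskInvolution h]
    field_simp
  rw [setIntegral_congr_fun measurableSet_ball hcongr, integral_const_mul,
    integral_one_sub_normSq_ball]
  field_simp

/-- The squared norm of the reproducing kernel of the unweighted Bergman space. -/
lemma integral_unweighted_kernel {r : ℝ} (h0 : 0 < r) (h1 : r < 1) :
    ∫ z in ball (0 : ℂ) 1, (normSq (1 - (r : ℂ) * z) ^ 2)⁻¹ ∂areaM = ((1 - r ^ 2) ^ 2)⁻¹ := by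
  have hr : 1 - r ^ 2 ≠ 0 := by nlinarith
  rw [setIntegral_areaM, integral_ball_eq_integral_diskInvolution h0 h1]
  have hcongr : ∀ z ∈ ball (0 : ℂ) 1, (1 - r ^ 2) ^ 2 / normSq (1 - (r : ℂ) * z) ^ 2 *
      (normSq (1 - (r : ℂ) * diskInvolution r z) ^ 2)⁻¹ = ((1 - r ^ 2) ^ 2)⁻¹ := by
    intro z hz
    have h := one_sub_real_mul_ne_zero h0 h1 (mem_ball_zero_iff.mp hz).le
    have h' : normSq (1 - (r : ℂ) * z) ≠ 0 := by simpa using h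
    rw [normSq_one_sub_mul_diskInvolution h]
    field_simp
  rw [setIntegral_congr_fun measurableSet_ball hcongr, setIntegral_const, volume_real_unit_ball,
    smul_eq_mul]
  field_simp

lemma sq_mul_normSq_sub_one_le {r : ℝ} (h0 : 0 < r) (h1 : r < 1) {z : ℂ} (hz : ‖z‖ ≤ 1) :
    r ^ 2 * normSq (z - 1) ≤ normSq (1 - (r : ℂ) * z) := by
  have hre : z.re ≤ 1 := (re_le_norm z).trans hz
  simp only [normSq_apply, sub_re, sub_im, one_re, one_im, re_ofReal_mul, im_ofReal_mul]
  nlinarith [mul_nonneg (mul_nonneg h0.le (sub_nonneg.mpr h1.le)) (sub_nonneg.mpr hre),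
    sq_nonneg (1 - r)]

/-- Comparison of a squared kernel norm for the weight `|z - 1|²` with the unweighted one. -/
lemma integral_normSq_sub_one_kernel_le {r : ℝ} (h0 : 0 < r) (h1 : r < 1) :
    ∫ z in ball (0 : ℂ) 1, normSq (z - 1) / normSq (1 - (r : ℂ) * z) ^ 3 ∂areaM
      ≤ 1 / (r ^ 2 * (1 - r ^ 2) ^ 2) := by
  have hcont : ContinuousOn (fun z : ℂ ↦ (r ^ 2)⁻¹ * (normSq (1 - (r : ℂ) * z) ^ 2)⁻¹)
      (closedBall 0 1) := by
    refine continuousOn_const.mul (ContinuousOn.inv₀ ?_ fun z hz ↦ ?_)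
    · exact ((continuous_normSq.comp (by fun_prop :
        Continuous fun z : ℂ ↦ 1 - (r : ℂ) * z)).pow 2).continuousOn
    · exact pow_ne_zero _ (normSq_pos.mpr (one_sub_real_mul_ne_zero h0 h1
        (mem_closedBall_zero_iff.mp hz))).ne'
  have hint : IntegrableOn (fun z : ℂ ↦ (r ^ 2)⁻¹ * (normSq (1 - (r : ℂ) * z) ^ 2)⁻¹)
      (ball 0 1) volume :=
    (hcont.integrableOn_compact (isCompact_closedBall 0 1)).mono_set ball_subset_closedBall
  have hmono : ∫ z in ball (0 : ℂ) 1, normSq (z - 1) / normSq (1 - (r : ℂ) * z) ^ 3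
      ≤ ∫ z in ball (0 : ℂ) 1, (r ^ 2)⁻¹ * (normSq (1 - (r : ℂ) * z) ^ 2)⁻¹ := by
    refine integral_mono_of_nonneg (.of_forall fun z ↦ ?_) hint ?_
    · exact div_nonneg (normSq_nonneg _) (pow_nonneg (normSq_nonneg _) _)
    · filter_upwards [ae_restrict_mem measurableSet_ball] with z hz
      have hz' := (mem_ball_zero_iff.mp hz).le
      have hpos := normSq_pos.mpr (one_sub_real_mul_ne_zero h0 h1 hz')
      rw [← mul_inv, ← one_div, div_le_div_iff₀ (by positivity) (by positivity)]
      nlinarith [mul_le_mul_of_nonneg_right (sq_mul_normSq_sub_one_le h0 h1 hz')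
        (sq_nonneg (normSq (1 - (r : ℂ) * z)))]
  calc ∫ z in ball (0 : ℂ) 1, normSq (z - 1) / normSq (1 - (r : ℂ) * z) ^ 3 ∂areaM
      ≤ ∫ z in ball (0 : ℂ) 1, (r ^ 2)⁻¹ * (normSq (1 - (r : ℂ) * z) ^ 2)⁻¹ ∂areaM := by
        rw [setIntegral_areaM, setIntegral_areaM]
        exact mul_le_mul_of_nonneg_left hmono (inv_nonneg.mpr Real.pi_pos.le)
    _ = 1 / (r ^ 2 * (1 - r ^ 2) ^ 2) := by
        rw [integral_const_mul, integral_unweighted_kernel h0 h1, ← mul_inv, one_div]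

lemma not_exists_inv_one_sub_sq_cube_le : ¬ ∃ C : ℝ, ∃ r₀ : ℝ, 0 < r₀ ∧ r₀ < 1 ∧
    ∀ r : ℝ, r₀ < r → r < 1 → ((1 - r ^ 2) ^ 3)⁻¹ ≤ C / (r ^ 2 * (1 - r ^ 2) ^ 2) := by
  rintro ⟨C, r₀, hr₀, hr₀', h⟩
  have hle : ∀ᶠ r : ℝ in nhdsWithin 1 (Iio 1), r ^ 2 ≤ C * (1 - r ^ 2) := by
    filter_upwards [Ioo_mem_nhdsLT hr₀'] with r hr
    have h0 : 0 < r := hr₀.trans hr.1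
    have hpos : 0 < 1 - r ^ 2 := by nlinarith [hr.2]
    have hr' := h r hr.1 hr.2
    rw [← one_div, div_le_div_iff₀ (by positivity) (by positivity)] at hr'
    refine le_of_mul_le_mul_right ?_ (pow_pos hpos 2)
    linarith
  have hl : Filter.Tendsto (fun r : ℝ ↦ r ^ 2) (nhdsWithin 1 (Iio 1)) (nhds (1 ^ 2)) :=
    (Continuous.tendsto (by fun_prop) 1).mono_left nhdsWithin_le_nhds
  have hr : Filter.Tendsto (fun r : ℝ ↦ C * (1 - r ^ 2)) (nhdsWithin 1 (Iio 1))
      (nhds (C * (1 - 1 ^ 2))) :=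
    (Continuous.tendsto (f := fun r : ℝ ↦ C * (1 - r ^ 2)) (by fun_prop) 1).mono_left
      nhdsWithin_le_nhds
  have := le_of_tendsto_of_tendsto hl hr hle
  norm_num at this

/-- For `0 < r < 1`: `∫_D |K₁(z,r)|² 2(1-|z|²) dΣ(z) = (1-r²)⁻³` (reproducing property
of the kernel `K₁(z,ζ) = (1-zζ̄)⁻³`), while
`∫_D |K₁(z,r)|² |z-1|² dΣ(z) ≤ 1/(r²(1-r²)²)`. In particular there is no constant `C`
with `(1-r²)⁻³ ≤ C/(r²(1-r²)²)` for all `r` close to `1`. -/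
theorem statement14 :
    (∀ r : ℝ, 0 < r → r < 1 →
      (∫ z in ball (0:ℂ) 1,
          2 * (1 - normSq z) / normSq (1 - (r : ℂ) * z) ^ 3 ∂areaM)
        = ((1 - r ^ 2) ^ 3)⁻¹ ∧
      (∫ z in ball (0:ℂ) 1,
          normSq (z - 1) / normSq (1 - (r : ℂ) * z) ^ 3 ∂areaM)
        ≤ 1 / (r ^ 2 * (1 - r ^ 2) ^ 2)) ∧
    ¬ ∃ C : ℝ, ∃ r₀ : ℝ, 0 < r₀ ∧ r₀ < 1 ∧
      ∀ r : ℝ, r₀ < r → r < 1 → ((1 - r ^ 2) ^ 3)⁻¹ ≤ C / (r ^ 2 * (1 - r ^ 2) ^ 2) := by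
  exact ⟨fun r h0 h1 ↦ ⟨integral_weighted_kernel h0 h1, integral_normSq_sub_one_kernel_le h0 h1⟩,
    not_exists_inv_one_sub_sq_cube_le⟩
end
end
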